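/- Let n ≥ 2, p > 1, let Ω ⊂ ℝⁿ be a strongly convex bounded open set with boundary of class C², and let u be the unique positive first eigenfunction of the Gaussian-weighted p-Laplacian on Ω normalized by ∫_Ω u^p dγ = 1. Then u_ε → u uniformly on cl Ω as ε → 0⁺: for every η > 0 there exists ε₀ > 0 such that for every ε ∈ (0, ε₀) and every normalized minimizer u_ε of the ε-regularized problem, sup_{x ∈ cl Ω} |u_ε(x) − u(x)| < η. -/

import Mathlib

open MeasureTheory Real Set Metric Bornology
open scoped RealInnerProductSpace Pointwise NNReal Topology

noncomputable def gaussianMeasure (n : ℕ) : Measure (EuclideanSpace ℝ (Fin n)) :=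
  (volume : Measure (EuclideanSpace ℝ (Fin n))).withDensity
    (fun x => ENNReal.ofReal ((2 * π) ^ (-(n : ℝ) / 2) * Real.exp (-‖x‖ ^ 2 / 2)))

/-- `φ` is a smooth compactly supported test function on `Ω`. -/
def IsTestFun (n : ℕ) (Ω : Set (EuclideanSpace ℝ (Fin n)))
    (φ : EuclideanSpace ℝ (Fin n) → ℝ) : Prop :=
  ContDiff ℝ (⊤ : ℕ∞) φ ∧ HasCompactSupport φ ∧ tsupport φ ⊆ Ω

/-- The first eigenvalue of the Gaussian-weighted `p`-Laplacian on `Ω`. -/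
noncomputable def lambdaPGamma (n : ℕ) (p : ℝ) (Ω : Set (EuclideanSpace ℝ (Fin n))) : ℝ :=
  sInf { r : ℝ | ∃ v : EuclideanSpace ℝ (Fin n) → ℝ, IsTestFun n Ω v ∧ v ≠ 0 ∧
    r = (∫ x in Ω, ‖gradient v x‖ ^ p ∂(gaussianMeasure n)) /
        (∫ x in Ω, |v x| ^ p ∂(gaussianMeasure n)) }

/-- `Ω` has boundary of class `C²`. -/
def HasC2Boundary (n : ℕ) (Ω : Set (EuclideanSpace ℝ (Fin n))) : Prop :=
  ∀ x ∈ frontier Ω, ∃ (U : Set (EuclideanSpace ℝ (Fin n))) (f : EuclideanSpace ℝ (Fin n) → ℝ),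
    IsOpen U ∧ x ∈ U ∧ ContDiff ℝ 2 f ∧ (∀ y ∈ U, (y ∈ Ω ↔ f y < 0)) ∧
    (∀ y ∈ U, y ∈ frontier Ω → fderiv ℝ f y ≠ 0)

/-- The regularized functional `J_ε(v) = ∫_Ω (ε v² + ‖∇v‖²)^{p/2} dγ`. -/
noncomputable def Jeps (n : ℕ) (p ε : ℝ) (Ω : Set (EuclideanSpace ℝ (Fin n)))
    (v : EuclideanSpace ℝ (Fin n) → ℝ) : ℝ :=
  ∫ x in Ω, (ε * v x ^ 2 + ‖gradient v x‖ ^ 2) ^ (p / 2) ∂(gaussianMeasure n)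

/-- The infimum of the regularized functional over normalized test functions. -/
noncomputable def lambdaEps (n : ℕ) (p ε : ℝ) (Ω : Set (EuclideanSpace ℝ (Fin n))) : ℝ :=
  sInf { r : ℝ | ∃ v : EuclideanSpace ℝ (Fin n) → ℝ, IsTestFun n Ω v ∧
    (∫ x in Ω, |v x| ^ p ∂(gaussianMeasure n)) = 1 ∧ r = Jeps n p ε Ω v }

/-- A normalized minimizer of the `ε`-regularized problem. -/
def IsNormalizedMinimizer (n : ℕ) (p ε : ℝ) (Ω : Set (EuclideanSpace ℝ (Fin n)))
    (uε : EuclideanSpace ℝ (Fin n) → ℝ) : Prop :=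
  ContinuousOn uε (closure Ω) ∧ ContDiffOn ℝ 1 uε Ω ∧
  (∀ x ∈ closure Ω, 0 ≤ uε x) ∧ (∀ x ∈ frontier Ω, uε x = 0) ∧
  (∫ x in Ω, uε x ^ p ∂(gaussianMeasure n)) = 1 ∧
  Jeps n p ε Ω uε = lambdaEps n p ε Ω

noncomputable def qf (r t : ℝ) : ℝ := (max t 0) ^ 2 / (max t 0 + r)
noncomputable def qd (r t : ℝ) : ℝ := 1 - r ^ 2 / (max t 0 + r) ^ 2

lemma qf_hasDerivAt {r : ℝ} (hr : 0 < r) (t : ℝ) : HasDerivAt (qf r) (qd r t) t := by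
  rcases lt_trichotomy t 0 with h | h | h
  · have h1 : qf r =ᶠ[𝓝 t] fun _ => 0 := by
      filter_upwards [Iio_mem_nhds h] with s hs
      simp [qf, max_eq_right (le_of_lt (mem_Iio.1 hs))]
    have : qd r t = 0 := by
      simp [qd, max_eq_right h.le, hr.ne']
    rw [this]
    exact (hasDerivAt_const t (0:ℝ)).congr_of_eventuallyEq h1
  · subst h
    have : qd r 0 = 0 := by simp [qd, hr.ne']
    rw [this]
    rw [hasDerivAt_iff_isLittleO]
    simp only [sub_zero, smul_zero]
    have h0 : qf r 0 = 0 := by simp [qf]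
    rw [h0]
    simp only [sub_zero]
    have h2 : (fun x : ℝ => x ^ 2) =o[𝓝 0] fun x => x := by
      simpa using Asymptotics.isLittleO_pow_id (𝕜 := ℝ) (n := 2) (by norm_num)
    refine Asymptotics.IsBigO.trans_isLittleO ?_ h2
    refine Asymptotics.IsBigO.of_bound (1 / r) (Filter.Eventually.of_forall fun x => ?_)
    have hm : 0 ≤ max x 0 := le_max_right _ _
    have hm2 : (max x 0) ^ 2 ≤ x ^ 2 := by
      rcases le_total x 0 with h | h
      · rw [max_eq_right h]; nlinarith
      · rw [max_eq_left h]
    rw [Real.norm_of_nonneg (by unfold qf; positivity), Real.norm_of_nonneg (by positivity)]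
    unfold qf
    rw [div_le_iff₀ (by positivity)]
    calc (max x 0) ^ 2 ≤ x ^ 2 := hm2
      _ = 1 / r * x ^ 2 * r := by field_simp
      _ ≤ 1 / r * x ^ 2 * (max x 0 + r) := by gcongr; linarith
  · have h1 : qf r =ᶠ[𝓝 t] fun s => s ^ 2 / (s + r) := by
      filter_upwards [Ioi_mem_nhds h] with s hs
      simp [qf, max_eq_left (le_of_lt (mem_Ioi.1 hs))]
    have h2 : HasDerivAt (fun s : ℝ => s ^ 2 / (s + r)) (qd r t) t := by
      have := (hasDerivAt_pow 2 t).div ((hasDerivAt_id t).add_const r) (by simp; positivity)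
      refine HasDerivAt.congr_deriv this ?_
      simp only [qd, max_eq_left h.le]
      have : t + r ≠ 0 := by positivity
      simp
      field_simp
      ring
    exact h2.congr_of_eventuallyEq h1

noncomputable def Sf (k r t : ℝ) : ℝ := qf r (t - k) - qf r (-t - k)
noncomputable def Sd (k r t : ℝ) : ℝ := qd r (t - k) + qd r (-t - k)

lemma Sf_hasDerivAt {k r : ℝ} (hr : 0 < r) (t : ℝ) : HasDerivAt (Sf k r) (Sd k r t) t := by
  have h1 := (qf_hasDerivAt hr (t - k)).comp t ((hasDerivAt_id t).sub_const k)
  have h2 := (qf_hasDerivAt hr (-t - k)).comp t ((hasDerivAt_neg t).sub_const k)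
  have := h1.sub h2
  exact HasDerivAt.congr_deriv this (by simp [Sd])

lemma qd_cont {r : ℝ} (hr : 0 < r) : Continuous (qd r) := by
  unfold qd
  refine continuous_const.sub (continuous_const.div (by fun_prop) ?_)
  intro x
  have : 0 ≤ max x 0 := le_max_right _ _
  positivity

lemma Sd_cont {k r : ℝ} (hr : 0 < r) : Continuous (Sd k r) := by
  unfold Sd
  exact ((qd_cont hr).comp (by fun_prop)).add ((qd_cont hr).comp (by fun_prop))

lemma Sf_contDiff {k r : ℝ} (hr : 0 < r) : ContDiff ℝ 1 (Sf k r) := by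
  rw [contDiff_one_iff_deriv]
  refine ⟨fun t => (Sf_hasDerivAt hr t).differentiableAt, ?_⟩
  have : deriv (Sf k r) = Sd k r := funext fun t => (Sf_hasDerivAt hr t).deriv
  rw [this]
  exact Sd_cont hr

lemma qd_neg {r : ℝ} (hr : 0 < r) {t : ℝ} (h : t ≤ 0) : qd r t = 0 := by
  simp [qd, max_eq_right h, hr.ne']
lemma qf_neg {r : ℝ} {t : ℝ} (h : t ≤ 0) : qf r t = 0 := by
  simp [qf, max_eq_right h]
lemma qd_nonneg {r : ℝ} (hr : 0 < r) (t : ℝ) : 0 ≤ qd r t := by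
  unfold qd
  have : 0 ≤ max t 0 := le_max_right _ _
  rw [sub_nonneg, div_le_one (by positivity)]
  gcongr; linarith
lemma qd_le {r : ℝ} (hr : 0 < r) (t : ℝ) : qd r t ≤ 1 := by
  unfold qd
  have : 0 ≤ max t 0 := le_max_right _ _
  linarith [show 0 ≤ r ^ 2 / (max t 0 + r) ^ 2 by positivity]
lemma qf_nonneg {r : ℝ} (hr : 0 < r) (t : ℝ) : 0 ≤ qf r t := by
  unfold qf
  have : 0 ≤ max t 0 := le_max_right _ _
  positivity
lemma qf_ge {r : ℝ} (hr : 0 < r) (t : ℝ) : t - r ≤ qf r t := by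
  unfold qf
  have : 0 ≤ max t 0 := le_max_right _ _
  have h2 : t ≤ max t 0 := le_max_left _ _
  rw [le_div_iff₀ (by positivity)]
  nlinarith
lemma qf_le {r : ℝ} (hr : 0 < r) {t : ℝ} (ht : 0 ≤ t) : qf r t ≤ qd r t * t := by
  unfold qf qd
  rw [max_eq_left ht]
  have : 0 < t + r := by positivity
  have h : (1 - r ^ 2 / (t + r) ^ 2) * t - t ^ 2 / (t + r) = t ^ 2 * r / (t + r) ^ 2 := by
    field_simp; ring
  have : 0 ≤ t ^ 2 * r / (t + r) ^ 2 := by positivity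
  linarith

lemma Sf_neg (k r t : ℝ) : Sf k r (-t) = - Sf k r t := by simp [Sf]
lemma Sd_neg (k r t : ℝ) : Sd k r (-t) = Sd k r t := by simp [Sd, add_comm]

lemma Sf_pos {k r t : ℝ} (hk : 0 ≤ k) (ht : 0 ≤ t) : Sf k r t = qf r (t - k) := by
  unfold Sf; rw [qf_neg (t := -t - k) (by linarith)]; simp
lemma Sd_pos {k r t : ℝ} (hr : 0 < r) (hk : 0 ≤ k) (ht : 0 ≤ t) : Sd k r t = qd r (t - k) := by
  unfold Sd; rw [qd_neg hr (t := -t - k) (by linarith)]; simp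
lemma Sd_abs (k r t : ℝ) : Sd k r |t| = Sd k r t := by
  rcases abs_choice t with h | h <;> rw [h]; exact Sd_neg _ _ _
lemma Sd_mem {k r : ℝ} (hr : 0 < r) (hk : 0 ≤ k) (t : ℝ) : 0 ≤ Sd k r t ∧ Sd k r t ≤ 1 := by
  rw [← Sd_abs, Sd_pos hr hk (abs_nonneg t)]
  exact ⟨qd_nonneg hr _, qd_le hr _⟩
lemma Sf_abs {k r : ℝ} (hr : 0 < r) (hk : 0 ≤ k) (t : ℝ) : |Sf k r t| = qf r (|t| - k) := by
  rcases le_total 0 t with h | h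
  · rw [Sf_pos hk h, abs_of_nonneg h, abs_of_nonneg (qf_nonneg hr _)]
  · rw [show t = -(-t) by ring, Sf_neg, abs_neg, abs_neg, Sf_pos hk (by linarith),
      abs_of_nonneg (qf_nonneg hr _), abs_of_nonneg (by linarith : 0 ≤ -t)]
lemma Sf_ge {k r : ℝ} (hr : 0 < r) (hk : 0 ≤ k) (t : ℝ) : |t| - k - r ≤ |Sf k r t| := by
  rw [Sf_abs hr hk]; exact qf_ge hr _
lemma Sf_zero {k r : ℝ} (hr : 0 < r) (hk : 0 ≤ k) {t : ℝ} (h : |t| ≤ k) : Sf k r t = 0 := by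
  rw [← abs_eq_zero, Sf_abs hr hk, qf_neg (by linarith)]
lemma Sd_zero {k r : ℝ} (hr : 0 < r) (hk : 0 ≤ k) {t : ℝ} (h : |t| ≤ k) : Sd k r t = 0 := by
  rw [← Sd_abs, Sd_pos hr hk (abs_nonneg t), qd_neg hr (by linarith)]
/-- `S = s * e` with `e` between `0` and `t`. -/
lemma Sf_fac {k r : ℝ} (hr : 0 < r) (hk : 0 ≤ k) (t : ℝ) :
    ∃ c : ℝ, 0 ≤ c ∧ c ≤ 1 ∧ Sf k r t = Sd k r t * (c * t) := by
  have main : ∀ t : ℝ, 0 ≤ t → ∃ c : ℝ, 0 ≤ c ∧ c ≤ 1 ∧ Sf k r t = Sd k r t * (c * t) := by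
    intro t ht
    rcases le_or_gt t k with h | h
    · refine ⟨0, le_rfl, zero_le_one, ?_⟩
      rw [Sf_zero hr hk (by rwa [abs_of_nonneg ht])]; simp
    · rw [Sf_pos hk ht, Sd_pos hr hk ht]
      have h1 := qf_le hr (t := t - k) (by linarith)
      have h0 := qf_nonneg hr (t - k)
      have hd : 0 < qd r (t - k) := by
        unfold qd
        rw [max_eq_left (by linarith), sub_pos, div_lt_one (by nlinarith)]
        exact pow_lt_pow_left₀ (by linarith) hr.le (by norm_num)
      have ht' : 0 < t := by linarith
      refine ⟨qf r (t - k) / (qd r (t-k) * t), by positivity, ?_, by field_simp⟩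
      rw [div_le_one (by positivity)]
      exact h1.trans (by gcongr; linarith)
  rcases le_total 0 t with h | h
  · exact main t h
  · obtain ⟨c, h0, h1, h2⟩ := main (-t) (by linarith)
    refine ⟨c, h0, h1, ?_⟩
    rw [Sf_neg, Sd_neg] at h2
    linarith
lemma Sf_le {k r : ℝ} (hr : 0 < r) (hk : 0 ≤ k) (t : ℝ) : |Sf k r t| ≤ |t| := by
  obtain ⟨c, h0, h1, h2⟩ := Sf_fac hr hk t
  obtain ⟨h3, h4⟩ := Sd_mem hr hk t
  rw [h2, abs_mul, abs_mul, abs_of_nonneg h3, abs_of_nonneg h0]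
  have := abs_nonneg t
  calc Sd k r t * (c * |t|) ≤ 1 * (1 * |t|) := by gcongr
    _ = |t| := by ring

lemma zext {n : ℕ} {Ω F : Set (EuclideanSpace ℝ (Fin n))} (hΩ : IsOpen Ω) (hF : IsCompact F)
    (hFΩ : F ⊆ Ω) {f : EuclideanSpace ℝ (Fin n) → ℝ} (hf : ContDiffOn ℝ 1 f Ω)
    (h0 : ∀ x ∈ Ω, x ∉ F → f x = 0) :
    ContDiff ℝ 1 (Ω.indicator f) ∧ HasCompactSupport (Ω.indicator f) ∧
      tsupport (Ω.indicator f) ⊆ Ω ∧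
      (∀ x ∈ Ω, Ω.indicator f x = f x ∧ fderiv ℝ (Ω.indicator f) x = fderiv ℝ f x) := by
  have hz : ∀ x ∉ F, Ω.indicator f x = 0 := by
    intro x hx
    by_cases hxΩ : x ∈ Ω
    · rw [indicator_of_mem hxΩ]; exact h0 x hxΩ hx
    · exact indicator_of_notMem hxΩ _
  have heq : ∀ x ∈ Ω, Ω.indicator f =ᶠ[𝓝 x] f := by
    intro x hx
    filter_upwards [hΩ.mem_nhds hx] with y hy
    exact indicator_of_mem hy _
  have hts : tsupport (Ω.indicator f) ⊆ F := by
    refine closure_minimal ?_ hF.isClosed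
    intro x hx
    by_contra h
    exact hx (hz x h)
  refine ⟨?_, HasCompactSupport.of_support_subset_isCompact hF (subset_closure.trans hts),
    hts.trans hFΩ, fun x hx => ⟨indicator_of_mem hx _, (heq x hx).fderiv_eq⟩⟩
  rw [contDiff_iff_contDiffAt]
  intro x
  by_cases hx : x ∈ F
  · exact (hf.contDiffAt (hΩ.mem_nhds (hFΩ hx))).congr_of_eventuallyEq (heq x (hFΩ hx))
  · refine (contDiffAt_const (c := (0:ℝ))).congr_of_eventuallyEq ?_
    filter_upwards [hF.isClosed.isOpen_compl.mem_nhds hx] with y hy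
    exact hz y hy

lemma mollify {n : ℕ} {Ω : Set (EuclideanSpace ℝ (Fin n))} (hΩ : IsOpen Ω)
    {w : EuclideanSpace ℝ (Fin n) → ℝ} (hw : ContDiff ℝ 1 w) (hwc : HasCompactSupport w)
    (hws : tsupport w ⊆ Ω) {δ : ℝ} (hδ : 0 < δ) :
    ∃ φ, IsTestFun n Ω φ ∧ (∀ x, |φ x - w x| ≤ δ) ∧
      ∀ x, ‖fderiv ℝ φ x - fderiv ℝ w x‖ ≤ δ := by
  have uc1 : UniformContinuous w := hw.continuous.uniformContinuous_of_tendsto_cocompact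
    (hwc.is_zero_at_infty)
  have hfc : Continuous (fderiv ℝ w) := hw.continuous_fderiv (by norm_num)
  have uc2 : UniformContinuous (fderiv ℝ w) := hfc.uniformContinuous_of_tendsto_cocompact
    ((hwc.fderiv ℝ).is_zero_at_infty)
  obtain ⟨a, ha, ha'⟩ := Metric.uniformContinuous_iff.1 uc1 δ hδ
  obtain ⟨b, hb, hb'⟩ := Metric.uniformContinuous_iff.1 uc2 δ hδ
  obtain ⟨c, hc, hc'⟩ := hwc.isCompact.exists_cthickening_subset_open hΩ hws
  set r := min (min a b) c with hr
  have hrpos : 0 < r := by positivity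
  let ρ : ContDiffBump (0 : EuclideanSpace ℝ (Fin n)) := ⟨r / 2, r, by positivity, by linarith⟩
  let φ : EuclideanSpace ℝ (Fin n) → ℝ :=
    convolution (ρ.normed volume) w (ContinuousLinearMap.lsmul ℝ ℝ) volume
  have hρli : LocallyIntegrable (ρ.normed volume) volume :=
    ρ.continuous_normed.locallyIntegrable
  have hder : ∀ x, fderiv ℝ φ x =
      convolution (ρ.normed volume) (fderiv ℝ w) (ContinuousLinearMap.lsmul ℝ ℝ) volume x := by
    intro x
    have := (hwc.hasFDerivAt_convolution_right (ContinuousLinearMap.lsmul ℝ ℝ) hρli hw x).fderiv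
    rw [show φ = convolution (ρ.normed volume) w (ContinuousLinearMap.lsmul ℝ ℝ) volume from rfl,
      this]
    unfold convolution
    congr 1
  have hsupp : tsupport φ ⊆ cthickening r (tsupport w) := by
    refine closure_minimal ?_ isClosed_cthickening
    refine (support_convolution_subset (ContinuousLinearMap.lsmul ℝ ℝ)).trans ?_
    rw [ρ.support_normed_eq, add_comm]
    intro x hx
    obtain ⟨y, hy, z, hz, rfl⟩ := hx
    refine mem_cthickening_of_dist_le _ y _ _ (subset_closure hy) ?_
    simp only [dist_self_add_left]
    have : ‖z‖ < r := by simpa using hz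
    exact this.le
  refine ⟨φ, ⟨?_, ?_, ?_⟩, ?_, ?_⟩
  · exact ρ.hasCompactSupport_normed.contDiff_convolution_left _ (ρ.contDiff_normed)
      hw.continuous.locallyIntegrable
  · exact HasCompactSupport.of_support_subset_isCompact (hwc.isCompact.cthickening)
      (subset_closure.trans hsupp)
  · exact hsupp.trans ((cthickening_mono (min_le_right _ _) _).trans hc')
  · intro x
    have := ContDiffBump.dist_normed_convolution_le (φ := ρ) (μ := volume) (g := w) (x₀ := x)
      (ε := δ) hw.continuous.aestronglyMeasurable (fun y hy => (ha' (lt_of_lt_of_le hy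
        ((min_le_left _ _).trans (min_le_left _ _)))).le)
    rwa [Real.dist_eq] at this
  · intro x
    have := ContDiffBump.dist_normed_convolution_le (φ := ρ) (μ := volume) (g := fderiv ℝ w)
      (x₀ := x)
      (ε := δ) hfc.aestronglyMeasurable (fun y hy => (hb' (lt_of_lt_of_le hy
        ((min_le_left _ _).trans (min_le_right _ _)))).le)
    rwa [dist_eq_norm, ← hder] at this

/-- admissible functions -/
def Adm {n : ℕ} (Ω : Set (EuclideanSpace ℝ (Fin n))) (v : EuclideanSpace ℝ (Fin n) → ℝ) : Prop :=
  ContinuousOn v (closure Ω) ∧ ContDiffOn ℝ 1 v Ω ∧ ∀ x ∈ frontier Ω, v x = 0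

section
variable {n : ℕ} {Ω : Set (EuclideanSpace ℝ (Fin n))}

lemma Adm.bdd (hb : IsBounded Ω) {v : EuclideanSpace ℝ (Fin n) → ℝ} (hv : Adm Ω v) :
    ∃ M, 0 ≤ M ∧ ∀ x ∈ closure Ω, |v x| ≤ M := by
  obtain ⟨M, hM⟩ := (hb.isCompact_closure).exists_bound_of_continuousOn hv.1
  exact ⟨max M 0, le_max_right _ _, fun x hx => (hM x hx).trans (le_max_left _ _)⟩

lemma Adm.diffAt (hΩ : IsOpen Ω) {v : EuclideanSpace ℝ (Fin n) → ℝ} (hv : Adm Ω v) {x}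
    (hx : x ∈ Ω) : DifferentiableAt ℝ v x :=
  (hv.2.1.contDiffAt (hΩ.mem_nhds hx)).differentiableAt (by norm_num)

lemma Adm.cont_fderiv (hΩ : IsOpen Ω) {v : EuclideanSpace ℝ (Fin n) → ℝ} (hv : Adm Ω v) :
    ContinuousOn (fderiv ℝ v) Ω := hv.2.1.continuousOn_fderiv_of_isOpen hΩ (by norm_num)

lemma Adm.cont (hv : Adm Ω v) : ContinuousOn v Ω := hv.1.mono subset_closure

lemma Adm.add {v w : EuclideanSpace ℝ (Fin n) → ℝ} (hv : Adm Ω v) (hw : Adm Ω w) :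
    Adm Ω (fun x => v x + w x) :=
  ⟨hv.1.add hw.1, hv.2.1.add hw.2.1, fun x hx => by simp [hv.2.2 x hx, hw.2.2 x hx]⟩

lemma Adm.sub {v w : EuclideanSpace ℝ (Fin n) → ℝ} (hv : Adm Ω v) (hw : Adm Ω w) :
    Adm Ω (fun x => v x - w x) :=
  ⟨hv.1.sub hw.1, hv.2.1.sub hw.2.1, fun x hx => by simp [hv.2.2 x hx, hw.2.2 x hx]⟩

lemma Adm.comp {v : EuclideanSpace ℝ (Fin n) → ℝ} (hv : Adm Ω v) {k r : ℝ} (hk : 0 ≤ k)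
    (hr : 0 < r) : Adm Ω (fun x => Sf k r (v x)) :=
  ⟨(Sf_contDiff hr).continuous.comp_continuousOn hv.1, (Sf_contDiff hr).comp_contDiffOn hv.2.1,
    fun x hx => by show Sf k r (v x) = 0; rw [hv.2.2 x hx, Sf_zero hr hk (by simpa)]⟩

lemma fderiv_Sf (hΩ : IsOpen Ω) {v : EuclideanSpace ℝ (Fin n) → ℝ} (hv : Adm Ω v) {k r : ℝ}
    (hr : 0 < r) {x} (hx : x ∈ Ω) :
    fderiv ℝ (fun y => Sf k r (v y)) x = Sd k r (v x) • fderiv ℝ v x :=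
  ((Sf_hasDerivAt hr (v x)).comp_hasFDerivAt x (hv.diffAt hΩ hx).hasFDerivAt).fderiv

lemma trunc_props (hΩ : IsOpen Ω) (hb : IsBounded Ω) {v : EuclideanSpace ℝ (Fin n) → ℝ}
    (hv : Adm Ω v) {k r : ℝ} (hk : 0 < k) (hr : 0 < r) :
    ∃ w : EuclideanSpace ℝ (Fin n) → ℝ, ContDiff ℝ 1 w ∧ HasCompactSupport w ∧ tsupport w ⊆ Ω ∧
      (∀ x ∈ Ω, w x = Sf k r (v x) ∧ fderiv ℝ w x = Sd k r (v x) • fderiv ℝ v x) := by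
  set F := {x ∈ closure Ω | k ≤ |v x|} with hFdef
  have hFc : IsCompact F := by
    refine hb.isCompact_closure.of_isClosed_subset ?_ (fun x hx => hx.1)
    have := (continuous_abs.comp_continuousOn hv.1).preimage_isClosed_of_isClosed isClosed_closure
      (isClosed_Ici (a := k))
    exact this
  have hFΩ : F ⊆ Ω := by
    intro x hx
    by_contra h
    have : x ∈ frontier Ω := by
      rw [frontier, hΩ.interior_eq]; exact ⟨hx.1, h⟩
    have h2 := hx.2
    rw [hv.2.2 x this] at h2
    simp at h2; linarith
  obtain ⟨h1, h2, h3, h4⟩ := zext hΩ hFc hFΩ (hv.comp hk.le hr).2.1 (by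
    intro x hx hxF
    refine Sf_zero hr hk.le ?_
    by_contra h
    exact hxF ⟨subset_closure hx, (not_le.1 h).le⟩)
  exact ⟨_, h1, h2, h3, fun x hx => ⟨(h4 x hx).1, by rw [(h4 x hx).2, fderiv_Sf hΩ hv hr hx]⟩⟩

variable {μ : Measure (EuclideanSpace ℝ (Fin n))} [IsFiniteMeasure μ]

lemma c1c_bound {w : EuclideanSpace ℝ (Fin n) → ℝ} (hw : ContDiff ℝ 1 w)
    (hwc : HasCompactSupport w) : ∃ M, 0 ≤ M ∧ ∀ x, |w x| ≤ M ∧ ‖fderiv ℝ w x‖ ≤ M := by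
  obtain ⟨a, ha⟩ := hwc.exists_bound_of_continuous hw.continuous
  obtain ⟨b, hb⟩ := (hwc.fderiv ℝ).exists_bound_of_continuous
    (hw.continuous_fderiv (by norm_num))
  refine ⟨max (max a b) 0, le_max_right _ _, fun x => ⟨?_, ?_⟩⟩
  · exact (ha x).trans ((le_max_left _ _).trans (le_max_left _ _))
  · exact (hb x).trans ((le_max_right _ _).trans (le_max_left _ _))

lemma mollify_seq (hΩ : IsOpen Ω)
    {w : EuclideanSpace ℝ (Fin n) → ℝ} (hw : ContDiff ℝ 1 w) (hwc : HasCompactSupport w)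
    (hws : tsupport w ⊆ Ω) : ∃ φ : ℕ → EuclideanSpace ℝ (Fin n) → ℝ, (∀ j, IsTestFun n Ω (φ j)) ∧
      (∀ x, Filter.Tendsto (fun j => φ j x) Filter.atTop (𝓝 (w x))) ∧
      (∀ x, Filter.Tendsto (fun j => fderiv ℝ (φ j) x) Filter.atTop (𝓝 (fderiv ℝ w x))) ∧
      ∃ M, 0 ≤ M ∧ ∀ j x, |φ j x| ≤ M ∧ ‖fderiv ℝ (φ j) x‖ ≤ M := by
  choose φ h1 h2 h3 using fun j : ℕ => mollify hΩ hw hwc hws (δ := 1 / ((j : ℝ) + 1))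
    (by positivity)
  obtain ⟨M, hM0, hM⟩ := c1c_bound hw hwc
  refine ⟨φ, h1, fun x => ?_, fun x => ?_, M + 1, by linarith, fun j x => ⟨?_, ?_⟩⟩
  · rw [tendsto_iff_dist_tendsto_zero]
    exact squeeze_zero (fun _ => dist_nonneg) (fun j => h2 j x)
      tendsto_one_div_add_atTop_nhds_zero_nat
  · rw [tendsto_iff_dist_tendsto_zero]
    refine squeeze_zero (fun _ => dist_nonneg) (fun j => ?_)
      tendsto_one_div_add_atTop_nhds_zero_nat
    rw [dist_eq_norm]; exact h3 j x
  · have := h2 j x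
    have h5 : 1 / ((j : ℝ) + 1) ≤ 1 := by
      rw [div_le_one (by positivity)]; linarith [Nat.cast_nonneg (α := ℝ) j]
    have := abs_sub_abs_le_abs_sub (φ j x) (w x)
    linarith [(hM x).1]
  · have := h3 j x
    have h5 : 1 / ((j : ℝ) + 1) ≤ 1 := by
      rw [div_le_one (by positivity)]; linarith [Nat.cast_nonneg (α := ℝ) j]
    have := norm_sub_norm_le (fderiv ℝ (φ j) x) (fderiv ℝ w x)
    linarith [(hM x).2]

lemma ray_c1c (hΩ : IsOpen Ω) {p ε Λ : ℝ} (hp : 1 < p) (hε : 0 ≤ ε)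
    (hΛ : ∀ φ, IsTestFun n Ω φ → Λ * ∫ x, |φ x| ^ p ∂μ ≤
      ∫ x, (ε * φ x ^ 2 + ‖fderiv ℝ φ x‖ ^ 2) ^ (p / 2) ∂μ)
    {w : EuclideanSpace ℝ (Fin n) → ℝ} (hw : ContDiff ℝ 1 w) (hwc : HasCompactSupport w)
    (hws : tsupport w ⊆ Ω) :
    Λ * ∫ x, |w x| ^ p ∂μ ≤ ∫ x, (ε * w x ^ 2 + ‖fderiv ℝ w x‖ ^ 2) ^ (p / 2) ∂μ := by
  obtain ⟨φ, h1, h2, h3, M, hM0, hM⟩ := mollify_seq hΩ hw hwc hws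
  have hc : ∀ j, Continuous (φ j) := fun j => (h1 j).1.continuous
  have hcd : ∀ j, Continuous (fderiv ℝ (φ j)) := fun j =>
    (h1 j).1.continuous_fderiv (by norm_num)
  have t1 : Filter.Tendsto (fun j => ∫ x, |φ j x| ^ p ∂μ) Filter.atTop (𝓝 (∫ x, |w x| ^ p ∂μ)) := by
    refine tendsto_integral_of_dominated_convergence (fun _ => M ^ p) (fun j => ?_)
      (integrable_const _) (fun j => Filter.Eventually.of_forall fun x => ?_)
      (Filter.Eventually.of_forall fun x => ?_)
    · exact ((hc j).abs.rpow_const (fun x => Or.inr (by linarith))).aestronglyMeasurable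
    · rw [Real.norm_of_nonneg (by positivity)]
      exact Real.rpow_le_rpow (abs_nonneg _) (hM j x).1 (by linarith)
    · exact ((h2 x).abs).rpow_const (Or.inr (by linarith))
  have t2 : Filter.Tendsto (fun j => ∫ x, (ε * φ j x ^ 2 + ‖fderiv ℝ (φ j) x‖ ^ 2) ^ (p / 2) ∂μ)
      Filter.atTop (𝓝 (∫ x, (ε * w x ^ 2 + ‖fderiv ℝ w x‖ ^ 2) ^ (p / 2) ∂μ)) := by
    refine tendsto_integral_of_dominated_convergence (fun _ => (ε * M ^ 2 + M ^ 2) ^ (p / 2))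
      (fun j => ?_)
      (integrable_const _) (fun j => Filter.Eventually.of_forall fun x => ?_)
      (Filter.Eventually.of_forall fun x => ?_)
    · refine (Continuous.rpow_const ?_ (fun x => Or.inr (by linarith))).aestronglyMeasurable
      have := hc j
      have := hcd j
      fun_prop
    · rw [Real.norm_of_nonneg (by positivity)]
      refine Real.rpow_le_rpow (by positivity) ?_ (by linarith)
      have := (hM j x).1
      have := (hM j x).2
      rw [← sq_abs (φ j x)]
      gcongr
    · refine Filter.Tendsto.rpow_const ?_ (Or.inr (by linarith))
      exact (((h2 x).pow 2).const_mul ε).add ((h3 x).norm.pow 2)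
  exact le_of_tendsto_of_tendsto' (t1.const_mul Λ) t2 (fun j => hΛ _ (h1 j))

lemma ae_meas_of_cont (hΩ : IsOpen Ω) (hμ : ∀ᵐ x ∂μ, x ∈ Ω) {F : Type*} [TopologicalSpace F]
    [TopologicalSpace.PseudoMetrizableSpace F]
    {f : EuclideanSpace ℝ (Fin n) → F} (hf : ContinuousOn f Ω) : AEStronglyMeasurable f μ := by
  have h := hf.aestronglyMeasurable (μ := μ) hΩ.measurableSet
  rwa [Measure.restrict_eq_self_of_ae_mem hμ] at h

lemma integrable_of_bdd (hΩ : IsOpen Ω) (hμ : ∀ᵐ x ∂μ, x ∈ Ω)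
    {f : EuclideanSpace ℝ (Fin n) → ℝ} (hf : ContinuousOn f Ω) (C : ℝ)
    (hC : ∀ x ∈ Ω, |f x| ≤ C) : Integrable f μ :=
  Integrable.of_bound (ae_meas_of_cont hΩ hμ hf) C (hμ.mono hC)

lemma ray_adm (hΩ : IsOpen Ω) (hb : IsBounded Ω) (hμ : ∀ᵐ x ∂μ, x ∈ Ω)
    {p ε Λ : ℝ} (hp : 1 < p) (hε : 0 ≤ ε)
    (hΛ : ∀ φ, IsTestFun n Ω φ → Λ * ∫ x, |φ x| ^ p ∂μ ≤
      ∫ x, (ε * φ x ^ 2 + ‖fderiv ℝ φ x‖ ^ 2) ^ (p / 2) ∂μ)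
    {v : EuclideanSpace ℝ (Fin n) → ℝ} (hv : Adm Ω v)
    (hi : Integrable (fun x => (ε * v x ^ 2 + ‖fderiv ℝ v x‖ ^ 2) ^ (p / 2)) μ) :
    Λ * ∫ x, |v x| ^ p ∂μ ≤ ∫ x, (ε * v x ^ 2 + ‖fderiv ℝ v x‖ ^ 2) ^ (p / 2) ∂μ := by
  have hd : ∀ j : ℕ, (0:ℝ) < 1 / ((j : ℝ) + 1) := fun j => by positivity
  obtain ⟨M, hM0, hM⟩ := hv.bdd hb
  have key : ∀ j : ℕ, Λ * ∫ x, |Sf (1 / ((j : ℝ) + 1)) (1 / ((j : ℝ) + 1)) (v x)| ^ p ∂μ ≤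
      ∫ x, (ε * v x ^ 2 + ‖fderiv ℝ v x‖ ^ 2) ^ (p / 2) ∂μ := by
    intro j
    obtain ⟨w, w1, w2, w3, w4⟩ := trunc_props hΩ hb hv (hd j) (hd j)
    have h := ray_c1c (μ := μ) hΩ hp hε hΛ w1 w2 w3
    have e : ∫ x, |Sf (1 / ((j : ℝ) + 1)) (1 / ((j : ℝ) + 1)) (v x)| ^ p ∂μ =
        ∫ x, |w x| ^ p ∂μ := integral_congr_ae (hμ.mono fun x hx => by simp only [(w4 x hx).1])
    rw [e]
    refine h.trans (integral_mono_of_nonneg (Filter.Eventually.of_forall fun x => ?_) hi ?_)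
    · show (0:ℝ) ≤ _
      positivity
    · filter_upwards [hμ] with x hx
      refine Real.rpow_le_rpow (by positivity) ?_ (by linarith)
      rw [(w4 x hx).1, (w4 x hx).2, norm_smul, ← sq_abs (Sf _ _ _), ← sq_abs (v x)]
      have h1 := Sf_le (hd j) (hd j).le (v x)
      obtain ⟨h2, h3⟩ := Sd_mem (hd j) (hd j).le (v x)
      rw [Real.norm_of_nonneg h2]
      have : Sd (1 / ((j : ℝ) + 1)) (1 / ((j : ℝ) + 1)) (v x) * ‖fderiv ℝ v x‖ ≤ ‖fderiv ℝ v x‖ :=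
        mul_le_of_le_one_left (norm_nonneg _) h3
      gcongr
  refine le_of_tendsto' (x := Filter.atTop) (Filter.Tendsto.const_mul Λ ?_) key
  refine tendsto_integral_of_dominated_convergence (fun _ => M ^ p) (fun j => ?_)
    (integrable_const _) (fun j => ?_) (Filter.Eventually.of_forall fun x => ?_)
  · refine ae_meas_of_cont hΩ hμ ?_
    refine ContinuousOn.rpow_const ?_ (fun x _ => Or.inr (by linarith))
    exact (hv.comp (hd j).le (hd j)).cont.abs
  · filter_upwards [hμ] with x hx
    rw [Real.norm_of_nonneg (by positivity)]
    exact Real.rpow_le_rpow (abs_nonneg _)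
      ((Sf_le (hd j) (hd j).le _).trans (hM x (subset_closure hx))) (by linarith)
  · refine Filter.Tendsto.rpow_const ?_ (Or.inr (by linarith))
    have h1 : ∀ j : ℕ, |v x| - 1 / ((j : ℝ) + 1) - 1 / ((j : ℝ) + 1) ≤
      |Sf (1 / ((j : ℝ) + 1)) (1 / ((j : ℝ) + 1)) (v x)| := fun j => Sf_ge (hd j) (hd j).le _
    refine tendsto_of_tendsto_of_tendsto_of_le_of_le ?_ tendsto_const_nhds h1
      (fun j => Sf_le (hd j) (hd j).le _)
    have := tendsto_one_div_add_atTop_nhds_zero_nat (𝕜 := ℝ)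
    simpa using (tendsto_const_nhds.sub this).sub this
end

section
variable {n : ℕ} {Ω : Set (EuclideanSpace ℝ (Fin n))}
variable {μ : Measure (EuclideanSpace ℝ (Fin n))} [IsFiniteMeasure μ]

lemma gns (hn : 2 ≤ n) (hΩ : IsOpen Ω) {a b : ℝ≥0} (hμv : μ ≤ (a : ENNReal) • volume)
    (hvμ : volume.restrict Ω ≤ (b : ENNReal) • μ) :
    ∃ C : ℝ, 0 ≤ C ∧ ∀ f : EuclideanSpace ℝ (Fin n) → ℝ, ContDiff ℝ 1 f → HasCompactSupport f →
      tsupport f ⊆ Ω → ∀ S : Set (EuclideanSpace ℝ (Fin n)),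
      ∫ x in S, |f x| ∂μ ≤ C * (μ.real S) ^ (1 / (n : ℝ)) * ∫ x, ‖fderiv ℝ f x‖ ∂μ := by
  have hn1 : (1 : ℝ≥0) < (n : ℝ≥0) := by exact_mod_cast (by omega : 1 < n)
  set q : ℝ≥0 := NNReal.conjExponent (n : ℝ≥0) with hq
  have hconj : NNReal.HolderConjugate (n : ℝ≥0) q := NNReal.HolderConjugate.conjExponent hn1
  set C0 : ℝ≥0 := eLpNormLESNormFDerivOneConst (volume : Measure (EuclideanSpace ℝ (Fin n))) q
    with hC0
  set c1 : ENNReal := (a : ENNReal) ^ (1 / (q : ENNReal)).toReal * C0 * b with hc1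
  have hc1t : c1 ≠ ⊤ := by
    rw [hc1]
    refine ENNReal.mul_ne_top (ENNReal.mul_ne_top ?_ ENNReal.coe_ne_top) ENNReal.coe_ne_top
    exact ENNReal.rpow_ne_top_of_nonneg ENNReal.toReal_nonneg ENNReal.coe_ne_top
  refine ⟨c1.toReal, ENNReal.toReal_nonneg, fun f hf hfc hfs S => ?_⟩
  have hq1 : (1 : ENNReal) ≤ q := by exact_mod_cast hconj.symm.lt.le
  have hfd : Continuous (fderiv ℝ f) := hf.continuous_fderiv (by norm_num)
  have h1 : eLpNorm f 1 (μ.restrict S) ≤ eLpNorm f q (μ.restrict S) * μ S ^ (1 / (n:ℝ)) := by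
    have := eLpNorm_le_eLpNorm_mul_rpow_measure_univ (μ := μ.restrict S) hq1
      hf.continuous.aestronglyMeasurable
    have he : 1 / (1 : ENNReal).toReal - 1 / (q : ENNReal).toReal = 1 / (n:ℝ) := by
      have := hconj.coe.inv_add_inv_eq_one
      simp at this ⊢
      linarith
    rwa [he, Measure.restrict_apply_univ] at this
  have h2 : eLpNorm f q (μ.restrict S) ≤ (a : ENNReal) ^ (1 / (q : ENNReal)).toReal *
      eLpNorm f q volume := by
    refine (eLpNorm_mono_measure f (Measure.restrict_le_self.trans hμv)).trans ?_
    rw [eLpNorm_smul_measure_of_ne_top (by simp)]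
    simp
  have h3 : eLpNorm f q volume ≤ C0 * eLpNorm (fderiv ℝ f) 1 volume := by
    refine eLpNorm_le_eLpNorm_fderiv_one volume hf hfc ?_
    simpa using hconj
  have h4 : eLpNorm (fderiv ℝ f) 1 volume ≤ b * eLpNorm (fderiv ℝ f) 1 μ := by
    have hsup : Function.support (fderiv ℝ f) ⊆ Ω :=
      (subset_closure.trans (tsupport_fderiv_subset ℝ)).trans hfs
    have : eLpNorm (fderiv ℝ f) 1 volume = eLpNorm (fderiv ℝ f) 1 (volume.restrict Ω) := by
      rw [eLpNorm_one_eq_lintegral_enorm, eLpNorm_one_eq_lintegral_enorm,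
        ← lintegral_indicator hΩ.measurableSet]
      congr 1
      ext x
      by_cases hx : x ∈ Ω
      · rw [indicator_of_mem hx]
      · have : fderiv ℝ f x = 0 := by
          by_contra h
          exact hx (hsup h)
        rw [indicator_of_notMem hx, this]
        first
          | exact enorm_zero
          | simp [enorm]
    rw [this]
    refine (eLpNorm_mono_measure _ hvμ).trans ?_
    rw [eLpNorm_smul_measure_of_ne_top (by simp)]
    simp
  have h5 : eLpNorm f 1 (μ.restrict S) ≤ c1 * μ S ^ (1 / (n:ℝ)) * eLpNorm (fderiv ℝ f) 1 μ := by
    refine h1.trans ?_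
    calc eLpNorm f q (μ.restrict S) * μ S ^ (1 / (n:ℝ))
        ≤ ((a : ENNReal) ^ (1 / (q : ENNReal)).toReal * (C0 * (b * eLpNorm (fderiv ℝ f) 1 μ))) *
          μ S ^ (1 / (n:ℝ)) := by
          gcongr
          exact h2.trans (mul_le_mul_right (h3.trans (mul_le_mul_right h4 _)) _)
      _ = _ := by rw [hc1]; ring
  obtain ⟨M, hM0, hM⟩ := c1c_bound hf hfc
  have hid : Integrable (fderiv ℝ f) μ :=
    Integrable.of_bound hfd.aestronglyMeasurable M (Filter.Eventually.of_forall fun x => (hM x).2)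
  rw [eLpNorm_one_eq_lintegral_enorm, eLpNorm_one_eq_lintegral_enorm] at h5
  have e1 : ∫ x in S, |f x| ∂μ = (∫⁻ x in S, ‖f x‖ₑ ∂μ).toReal :=
    integral_norm_eq_lintegral_enorm hf.continuous.aestronglyMeasurable
  rw [e1, integral_norm_eq_lintegral_enorm hfd.aestronglyMeasurable]
  have hS : μ S ^ (1 / (n:ℝ)) ≠ ⊤ := ENNReal.rpow_ne_top_of_nonneg (by positivity)
    (measure_ne_top _ _)
  have := ENNReal.toReal_mono (ENNReal.mul_ne_top (ENNReal.mul_ne_top hc1t hS) hid.2.ne) h5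
  rw [ENNReal.toReal_mul, ENNReal.toReal_mul, ← ENNReal.toReal_rpow] at this
  exact this

lemma young_simple {p s t : ℝ} (hp : 1 < p) (hs : 0 ≤ s) (ht : 0 ≤ t) :
    s ^ (p - 1) * t ≤ s ^ p + t ^ p := by
  have hsp : 0 ≤ s ^ p := by positivity
  have htp : 0 ≤ t ^ p := by positivity
  rcases le_total s t with h | h
  · calc s ^ (p - 1) * t ≤ t ^ (p - 1) * t := by
          gcongr
      _ = t ^ p := by
          rw [← Real.rpow_add_one' ht (by linarith)]; congr 1; ring
      _ ≤ _ := by linarith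
  · calc s ^ (p - 1) * t ≤ s ^ (p - 1) * s := by gcongr
      _ = s ^ p := by
          rw [← Real.rpow_add_one' hs (by linarith)]; congr 1; ring
      _ ≤ _ := by linarith

lemma gns_p (hn : 2 ≤ n) (hΩ : IsOpen Ω) {a b : ℝ≥0} (hμv : μ ≤ (a : ENNReal) • volume)
    (hvμ : volume.restrict Ω ≤ (b : ENNReal) • μ) {p : ℝ} (hp : 1 < p) :
    ∃ C : ℝ, 0 ≤ C ∧ ∀ f : EuclideanSpace ℝ (Fin n) → ℝ, ContDiff ℝ 1 f → HasCompactSupport f →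
      tsupport f ⊆ Ω → ∀ S : Set (EuclideanSpace ℝ (Fin n)),
      ∫ x in S, |f x| ^ p ∂μ ≤ C * (μ.real S) ^ (1 / (n : ℝ)) *
        (∫ x, |f x| ^ p ∂μ + ∫ x, ‖fderiv ℝ f x‖ ^ p ∂μ) := by
  obtain ⟨C, hC0, hC⟩ := gns (μ := μ) hn hΩ hμv hvμ
  refine ⟨C * p, by positivity, fun f hf hfc hfs S => ?_⟩
  have hg : ContDiff ℝ 1 (fun x => ‖f x‖ ^ p) := hf.norm_rpow hp
  have hss : Function.support (fun x => ‖f x‖ ^ p) ⊆ Function.support f := by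
    intro x hx hx0
    apply hx
    have : f x = 0 := hx0
    simp [this, Real.zero_rpow (by linarith : p ≠ 0)]
  have hgt : tsupport (fun x => ‖f x‖ ^ p) ⊆ tsupport f := closure_mono hss
  have h := hC _ hg (hfc.mono hss) (hgt.trans hfs) S
  have e : ∀ x, |‖f x‖ ^ p| = |f x| ^ p := fun x => by
    rw [abs_of_nonneg (by positivity), Real.norm_eq_abs]
  simp only [e] at h
  refine h.trans ?_
  have hS : 0 ≤ (μ.real S) ^ (1 / (n : ℝ)) := by positivity
  have hfd : Continuous (fderiv ℝ f) := hf.continuous_fderiv (by norm_num)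
  obtain ⟨M, hM0, hM⟩ := c1c_bound hf hfc
  have i1 : Integrable (fun x => |f x| ^ p) μ := by
    refine Integrable.of_bound (C := M ^ p)
      (hf.continuous.abs.rpow_const (fun x => Or.inr (by linarith))).aestronglyMeasurable
      (Filter.Eventually.of_forall fun x => ?_)
    rw [Real.norm_of_nonneg (by positivity)]
    exact Real.rpow_le_rpow (abs_nonneg _) (hM x).1 (by linarith)
  have i2 : Integrable (fun x => ‖fderiv ℝ f x‖ ^ p) μ := by
    refine Integrable.of_bound (C := M ^ p)
      (hfd.norm.rpow_const (fun x => Or.inr (by linarith))).aestronglyMeasurable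
      (Filter.Eventually.of_forall fun x => ?_)
    rw [Real.norm_of_nonneg (by positivity)]
    exact Real.rpow_le_rpow (norm_nonneg _) (hM x).2 (by linarith)
  have key : ∫ x, ‖fderiv ℝ (fun x => ‖f x‖ ^ p) x‖ ∂μ ≤
      p * (∫ x, |f x| ^ p ∂μ + ∫ x, ‖fderiv ℝ f x‖ ^ p ∂μ) := by
    rw [← integral_add i1 i2, ← integral_const_mul]
    refine integral_mono_of_nonneg (Filter.Eventually.of_forall fun x => norm_nonneg _)
      ((i1.add i2).const_mul p) (Filter.Eventually.of_forall fun x => ?_)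
    refine (norm_fderiv_norm_rpow_le (hf.differentiable (by norm_num)) hp).trans ?_
    rw [mul_assoc]
    refine mul_le_mul_of_nonneg_left ?_ (by linarith)
    exact young_simple hp (abs_nonneg _) (norm_nonneg _)
  calc _ ≤ C * (μ.real S) ^ (1 / (n : ℝ)) *
        (p * (∫ x, |f x| ^ p ∂μ + ∫ x, ‖fderiv ℝ f x‖ ^ p ∂μ)) := by gcongr
    _ = _ := by ring
end

section
variable {n : ℕ} {Ω : Set (EuclideanSpace ℝ (Fin n))}

lemma ftc_seg (hΩ : IsOpen Ω) {K : Set (EuclideanSpace ℝ (Fin n))} (hKc : Convex ℝ K) (hKΩ : K ⊆ Ω)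
    {D : ℝ≥0} (hD : ∀ x ∈ K, ∀ y ∈ K, ‖x - y‖ ≤ D)
    {f : EuclideanSpace ℝ (Fin n) → ℝ} (hf : ContDiffOn ℝ 1 f Ω) {x y} (hx : x ∈ K) (hy : y ∈ K) :
    ‖f x - f y‖ₑ ≤ D * ∫⁻ t in Ioc (0:ℝ) 1, K.indicator (fun z => ‖fderiv ℝ f z‖ₑ)
      (y + t • (x - y)) := by
  have hmem : ∀ t ∈ Icc (0:ℝ) 1, y + t • (x - y) ∈ K := fun t ht =>
    hKc.add_smul_sub_mem hy hx ht
  have hder : ∀ t ∈ uIcc (0:ℝ) 1, HasDerivAt (fun t : ℝ => f (y + t • (x - y)))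
      (fderiv ℝ f (y + t • (x - y)) (x - y)) t := by
    intro t ht
    rw [uIcc_of_le zero_le_one] at ht
    have h1 : DifferentiableAt ℝ f (y + t • (x - y)) :=
      (hf.differentiableOn (by norm_num)).differentiableAt (hΩ.mem_nhds (hKΩ (hmem t ht)))
    have h2 : HasDerivAt (fun t : ℝ => y + t • (x - y)) (x - y) t := by
      have := ((hasDerivAt_id t).smul_const (x - y)).const_add y
      exact HasDerivAt.congr_deriv this (by simp)
    exact h1.hasFDerivAt.comp_hasDerivAt t h2
  have hcont : ContinuousOn (fun t : ℝ => fderiv ℝ f (y + t • (x - y)) (x - y)) (uIcc 0 1) := by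
    rw [uIcc_of_le zero_le_one]
    have h1 : ContinuousOn (fderiv ℝ f) Ω := hf.continuousOn_fderiv_of_isOpen hΩ (by norm_num)
    have h2 : ContinuousOn (fun t : ℝ => fderiv ℝ f (y + t • (x - y))) (Icc 0 1) :=
      h1.comp (by fun_prop) (fun t ht => hKΩ (hmem t ht))
    exact h2.clm_apply continuousOn_const
  have hI := intervalIntegral.integral_eq_sub_of_hasDerivAt hder hcont.intervalIntegrable
  have e1 : f x - f y = ∫ t in (0:ℝ)..1, fderiv ℝ f (y + t • (x - y)) (x - y) := by
    rw [hI]; simp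
  rw [e1, intervalIntegral.integral_of_le zero_le_one]
  refine (enorm_integral_le_lintegral_enorm _).trans ?_
  rw [← lintegral_const_mul' _ _ ENNReal.coe_ne_top]
  refine setLIntegral_mono' measurableSet_Ioc (fun t ht => ?_)
  have hm := hmem t ⟨ht.1.le, ht.2⟩
  rw [indicator_of_mem hm, mul_comm]
  refine (ContinuousLinearMap.le_opENorm _ _).trans ?_
  gcongr
  rw [enorm_eq_nnnorm]
  exact_mod_cast hD x hx y hy

lemma lint_aff (G : EuclideanSpace ℝ (Fin n) → ENNReal) (hG : Measurable G)
    (c : EuclideanSpace ℝ (Fin n)) {t : ℝ} (ht : 1 / 2 ≤ t) :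
    ∫⁻ x, G (c + t • x) ≤ 2 ^ n * ∫⁻ x, G x := by
  have ht0 : t ≠ 0 := by linarith
  have h1 : ∫⁻ x, G (c + t • x) = ∫⁻ z, G (c + z) ∂(Measure.map (t • ·) volume) := by
    rw [lintegral_map (by fun_prop) (by fun_prop)]
  rw [h1, Measure.map_addHaar_smul _ ht0, lintegral_smul_measure, lintegral_add_left_eq_self]
  simp only [finrank_euclideanSpace, Fintype.card_fin, smul_eq_mul]
  gcongr
  have : |(t ^ n)⁻¹| ≤ 2 ^ n := by
    rw [abs_of_nonneg (by positivity), ← inv_pow]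
    have : t⁻¹ ≤ 2 := by rw [inv_le_comm₀ (by linarith) (by norm_num)]; linarith
    gcongr
  calc ENNReal.ofReal |(t ^ n)⁻¹| ≤ ENNReal.ofReal (2 ^ n) := ENNReal.ofReal_le_ofReal this
    _ = 2 ^ n := by rw [ENNReal.ofReal_pow (by norm_num)]; simp

set_option maxHeartbeats 1000000 in
lemma poincare (hΩ : IsOpen Ω) {K : Set (EuclideanSpace ℝ (Fin n))} (hKc : Convex ℝ K)
    (hKk : IsCompact K) (hK0 : volume K ≠ 0) (hKΩ : K ⊆ Ω) :
    ∃ C : ℝ≥0, ∀ f : EuclideanSpace ℝ (Fin n) → ℝ, ContDiffOn ℝ 1 f Ω →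
      ∃ y ∈ K, ∫⁻ x in K, ‖f x - f y‖ₑ ≤ C * ∫⁻ x in K, ‖fderiv ℝ f x‖ₑ := by
  obtain ⟨D0, hD0⟩ := hKk.isBounded.exists_norm_le
  set D : ℝ≥0 := 2 * (max D0 0).toNNReal with hDdef
  have hD : ∀ x ∈ K, ∀ y ∈ K, ‖x - y‖ ≤ D := by
    intro x hx y hy
    have := norm_sub_le x y
    have h1 := hD0 x hx
    have h2 := hD0 y hy
    have : ((D : ℝ≥0) : ℝ) = 2 * max D0 0 := by simp [hDdef]
    have := le_max_left D0 0
    linarith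
  refine ⟨D * 2 ^ n, fun f hf => ?_⟩
  have hKm : MeasurableSet K := hKk.measurableSet
  set G : EuclideanSpace ℝ (Fin n) → ENNReal := K.indicator (fun z => ‖fderiv ℝ f z‖ₑ) with hGdef
  have hG : Measurable G := (measurable_fderiv ℝ f).enorm.indicator hKm
  set ν : Measure (EuclideanSpace ℝ (Fin n)) := volume.restrict K with hν
  have hfin : IsFiniteMeasure ν := ⟨by simpa [hν] using hKk.measure_lt_top⟩
  set τ : Measure ℝ := volume.restrict (Ioc (0:ℝ) 1) with hτ
  have hFm : Measurable (fun z : (EuclideanSpace ℝ (Fin n) × EuclideanSpace ℝ (Fin n)) × ℝ =>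
      G (z.1.1 + z.2 • (z.1.2 - z.1.1))) := by fun_prop
  set H : EuclideanSpace ℝ (Fin n) → ENNReal := fun y => ∫⁻ x, ∫⁻ t, G (y + t • (x - y)) ∂τ ∂ν with hH
  have hHin : Measurable (fun z : EuclideanSpace ℝ (Fin n) × EuclideanSpace ℝ (Fin n) =>
      ∫⁻ t, G (z.1 + t • (z.2 - z.1)) ∂τ) := hFm.lintegral_prod_right'
  have hHm : Measurable H := hHin.lintegral_prod_right'
  have hbound : ∫⁻ y, H y ∂ν ≤ ν univ * (2 ^ n * ∫⁻ x, G x) := by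
    have e1 : ∫⁻ y, H y ∂ν = ∫⁻ t, ∫⁻ z, G (z.1 + t • (z.2 - z.1)) ∂(ν.prod ν) ∂τ := by
      have hs := lintegral_lintegral_swap (μ := ν.prod ν) (ν := τ)
        (f := fun (z : EuclideanSpace ℝ (Fin n) × EuclideanSpace ℝ (Fin n)) (t : ℝ) =>
          G (z.1 + t • (z.2 - z.1))) hFm.aemeasurable
      rw [← hs, lintegral_prod _ hHin.aemeasurable]
    rw [e1]
    have e2 : ∀ t ∈ Ioc (0:ℝ) 1, ∫⁻ z, G (z.1 + t • (z.2 - z.1)) ∂(ν.prod ν) ≤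
        ν univ * (2 ^ n * ∫⁻ x, G x) := by
      intro t ht
      have hm : Measurable (fun z : EuclideanSpace ℝ (Fin n) × EuclideanSpace ℝ (Fin n) =>
        G (z.1 + t • (z.2 - z.1))) := by fun_prop
      rcases le_total (1 / 2) t with h | h
      · rw [lintegral_prod _ hm.aemeasurable]
        calc _ ≤ ∫⁻ y, (2 ^ n * ∫⁻ x, G x) ∂ν := by
              refine lintegral_mono fun y => ?_
              refine (setLIntegral_le_lintegral _ _).trans ?_
              refine le_trans (le_of_eq ?_) (lint_aff G hG (y - t • y) h)
              congr 1; ext x; congr 1; rw [smul_sub]; abel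
          _ = _ := by rw [lintegral_const, mul_comm]
      · rw [lintegral_prod_symm _ hm.aemeasurable]
        calc _ ≤ ∫⁻ y, (2 ^ n * ∫⁻ x, G x) ∂ν := by
              refine lintegral_mono fun x => ?_
              refine (setLIntegral_le_lintegral _ _).trans ?_
              refine le_trans (le_of_eq ?_) (lint_aff G hG (t • x) (t := 1 - t) (by linarith))
              congr 1; ext y; congr 1; rw [smul_sub, sub_smul, one_smul]; abel
          _ = _ := by rw [lintegral_const, mul_comm]
    calc _ ≤ ∫⁻ t in Ioc (0:ℝ) 1, ν univ * (2 ^ n * ∫⁻ x, G x) :=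
          setLIntegral_mono' measurableSet_Ioc e2
      _ = _ := by simp
  obtain ⟨y, hyK, hy⟩ := exists_le_setLAverage hK0 hKk.measure_lt_top.ne hHm.aemeasurable
  refine ⟨y, hyK, ?_⟩
  have hGint : ∫⁻ x, G x = ∫⁻ x in K, ‖fderiv ℝ f x‖ₑ := by
    rw [hGdef, lintegral_indicator hKm]
  calc ∫⁻ x in K, ‖f x - f y‖ₑ ≤ ∫⁻ x in K, D * ∫⁻ t, G (y + t • (x - y)) ∂τ :=
        setLIntegral_mono' hKm (fun x hx => ftc_seg hΩ hKc hKΩ hD hf hx hyK)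
    _ = D * H y := by rw [lintegral_const_mul' _ _ ENNReal.coe_ne_top]
    _ ≤ D * (2 ^ n * ∫⁻ x in K, ‖fderiv ℝ f x‖ₑ) := by
        gcongr
        refine hy.trans ?_
        rw [setLAverage_eq, ← hGint]
        refine ENNReal.div_le_of_le_mul ?_
        refine hbound.trans (le_of_eq ?_)
        rw [hν, Measure.restrict_apply_univ, mul_comm]
    _ = _ := by push_cast; ring
end

noncomputable def Br {n : ℕ} (p : ℝ) (X Z : EuclideanSpace ℝ (Fin n)) : ℝ :=
  ‖X‖ ^ p + (p - 1) * ‖Z‖ ^ p - p * (‖Z‖ ^ (p - 2) * ⟪Z, X⟫)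

lemma young_p {p s t : ℝ} (hp : 1 < p) (hs : 0 ≤ s) (ht : 0 ≤ t) :
    p * (t ^ (p - 1) * s) ≤ s ^ p + (p - 1) * t ^ p := by
  have hp0 : 0 < p := by linarith
  have h := Real.geom_mean_le_arith_mean2_weighted (w₁ := 1 / p) (w₂ := (p - 1) / p)
    (p₁ := s ^ p) (p₂ := t ^ p) (by positivity) (div_nonneg (by linarith) hp0.le)
    (by positivity) (by positivity) (by field_simp; ring)
  rw [← Real.rpow_mul hs, ← Real.rpow_mul ht, mul_one_div_cancel hp0.ne', Real.rpow_one,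
    mul_div_cancel₀ _ hp0.ne'] at h
  have h2 := mul_le_mul_of_nonneg_left h hp0.le
  have e : p * (1 / p * s ^ p + (p - 1) / p * t ^ p) = s ^ p + (p - 1) * t ^ p := by
    field_simp
  rw [e] at h2
  linarith [mul_comm s (t ^ (p - 1))]

section
variable {n : ℕ}

lemma inner_pow_le {p : ℝ} (_ : 1 < p) (X Z : EuclideanSpace ℝ (Fin n)) :
    ‖Z‖ ^ (p - 2) * ⟪Z, X⟫ ≤ ‖Z‖ ^ (p - 1) * ‖X‖ := by
  rcases eq_or_ne Z 0 with rfl | hZ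
  · simp; positivity
  · have h0 : 0 < ‖Z‖ := norm_pos_iff.2 hZ
    calc ‖Z‖ ^ (p - 2) * ⟪Z, X⟫ ≤ ‖Z‖ ^ (p - 2) * (‖Z‖ * ‖X‖) := by
          gcongr; exact real_inner_le_norm _ _
      _ = ‖Z‖ ^ (p - 1) * ‖X‖ := by
          rw [show p - 1 = (p - 2) + 1 by ring, Real.rpow_add_one h0.ne']; ring

lemma Br_nonneg {p : ℝ} (hp : 1 < p) (X Z : EuclideanSpace ℝ (Fin n)) : 0 ≤ Br p X Z := by
  have h1 := young_p hp (norm_nonneg X) (norm_nonneg Z)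
  have h2 := mul_le_mul_of_nonneg_left (inner_pow_le hp X Z) (by linarith : 0 ≤ p)
  unfold Br
  linarith

lemma self_pow {p : ℝ} (hp : 1 < p) (Z : EuclideanSpace ℝ (Fin n)) :
    ‖Z‖ ^ (p - 2) * ⟪Z, Z⟫ = ‖Z‖ ^ p := by
  rcases eq_or_ne Z 0 with rfl | hZ
  · simp [Real.zero_rpow (by linarith : p ≠ 0)]
  · have h0 : 0 < ‖Z‖ := norm_pos_iff.2 hZ
    rw [real_inner_self_eq_norm_sq, ← Real.rpow_natCast, ← Real.rpow_add h0]
    congr 1; push_cast; ring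

lemma Br_pos {p : ℝ} (hp : 1 < p) {X Z : EuclideanSpace ℝ (Fin n)} (h : X ≠ Z) :
    0 < Br p X Z := by
  have hp0 : 0 < p := by linarith
  have h1 := Br_nonneg hp ((1 / 2 : ℝ) • (X + Z)) Z
  have h2 : ‖(1 / 2 : ℝ) • (X + Z)‖ ^ p < 1 / 2 * (‖X‖ ^ p + ‖Z‖ ^ p) := by
    by_cases he : ‖X‖ = ‖Z‖
    · have h3 := (norm_midpoint_lt_iff he).2 h
      calc ‖(1 / 2 : ℝ) • (X + Z)‖ ^ p < ‖X‖ ^ p :=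
            Real.rpow_lt_rpow (norm_nonneg _) h3 hp0
        _ = _ := by rw [← he]; ring
    · have hsc := (strictConvexOn_rpow hp).2
      have h3 := hsc (norm_nonneg X) (norm_nonneg Z) he
        (by norm_num : (0:ℝ) < 1 / 2) (by norm_num : (0:ℝ) < 1 / 2) (by norm_num)
      simp only [smul_eq_mul] at h3
      have h4 : ‖(1 / 2 : ℝ) • (X + Z)‖ ≤ 1 / 2 * ‖X‖ + 1 / 2 * ‖Z‖ := by
        rw [norm_smul]
        have := norm_add_le X Z
        norm_num
        linarith
      have h5 := Real.rpow_le_rpow (norm_nonneg _) h4 hp0.le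
      linarith
  have hs := self_pow hp Z
  have e : ‖Z‖ ^ (p - 2) * ⟪Z, (1 / 2 : ℝ) • (X + Z)⟫ =
      1 / 2 * (‖Z‖ ^ (p - 2) * ⟪Z, X⟫) + 1 / 2 * ‖Z‖ ^ p := by
    rw [← hs, inner_smul_right, inner_add_right]; ring
  unfold Br at h1 ⊢
  rw [e] at h1
  nlinarith

lemma Br_cont {p : ℝ} (hp : 1 < p) :
    Continuous (fun z : EuclideanSpace ℝ (Fin n) × EuclideanSpace ℝ (Fin n) => Br p z.1 z.2) := by
  have hp0 : 0 < p := by linarith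
  have h1 : Continuous (fun Z : EuclideanSpace ℝ (Fin n) => ‖Z‖ ^ p) :=
    continuous_norm.rpow_const (fun _ => Or.inr hp0.le)
  have h2 : Continuous (fderiv ℝ (fun Z : EuclideanSpace ℝ (Fin n) => ‖Z‖ ^ p)) :=
    (contDiff_norm_rpow hp).continuous_fderiv (by norm_num)
  have h3 : Continuous (fun z : EuclideanSpace ℝ (Fin n) × EuclideanSpace ℝ (Fin n) =>
      fderiv ℝ (fun Z : EuclideanSpace ℝ (Fin n) => ‖Z‖ ^ p) z.2 z.1) :=
    (h2.comp continuous_snd).clm_apply continuous_fst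
  have e : (fun z : EuclideanSpace ℝ (Fin n) × EuclideanSpace ℝ (Fin n) => Br p z.1 z.2) =
      fun z => ‖z.1‖ ^ p + (p - 1) * ‖z.2‖ ^ p -
        fderiv ℝ (fun Z : EuclideanSpace ℝ (Fin n) => ‖Z‖ ^ p) z.2 z.1 := by
    ext z
    rw [fderiv_norm_rpow _ hp]
    simp [Br]
    ring
  rw [e]
  exact ((h1.comp continuous_fst).add (continuous_const.mul (h1.comp continuous_snd))).sub h3

lemma Br_control {p : ℝ} (hp : 1 < p) {R τ : ℝ} (hR : 0 ≤ R) (hτ : 0 < τ) :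
    ∃ C : ℝ, 0 ≤ C ∧ ∀ X Z : EuclideanSpace ℝ (Fin n), ‖X‖ ≤ R → ‖X - Z‖ ≤ τ + C * Br p X Z := by
  have hp1 : 0 < p - 1 := by linarith
  set R' : ℝ := 1 + R + 2 * p * R / (p - 1) with hR'
  have hq : 0 ≤ 2 * p * R / (p - 1) := by positivity
  have hlarge : ∀ X Z : EuclideanSpace ℝ (Fin n), ‖X‖ ≤ R → R' ≤ ‖Z‖ →
      ‖X - Z‖ ≤ 4 / (p - 1) * Br p X Z := by
    intro X Z hX hZ
    have hZ1 : 1 ≤ ‖Z‖ := by linarith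
    have hZ0 : 0 < ‖Z‖ := by linarith
    have h1 := inner_pow_le hp X Z
    have h2 : ‖Z‖ ^ (p - 1) * ‖X‖ ≤ ‖Z‖ ^ (p - 1) * R := by gcongr
    have h3 : ‖Z‖ ^ p = ‖Z‖ ^ (p - 1) * ‖Z‖ := by
      rw [← Real.rpow_add_one hZ0.ne']; congr 1; ring
    have h4 : 1 ≤ ‖Z‖ ^ (p - 1) := Real.one_le_rpow hZ1 hp1.le
    have h5 : p * R ≤ (p - 1) * ‖Z‖ / 2 := by
      have : 2 * p * R / (p - 1) ≤ ‖Z‖ := by linarith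
      rw [div_le_iff₀ hp1] at this
      linarith
    have h6 : 0 ≤ ‖X‖ ^ p := by positivity
    have h7 : (p - 1) * ‖Z‖ / 2 ≤ Br p X Z := by
      unfold Br
      have h8 : p * (‖Z‖ ^ (p - 2) * ⟪Z, X⟫) ≤ ‖Z‖ ^ (p - 1) * ((p - 1) * ‖Z‖ / 2) := by
        calc p * (‖Z‖ ^ (p - 2) * ⟪Z, X⟫) ≤ p * (‖Z‖ ^ (p - 1) * R) :=
              mul_le_mul_of_nonneg_left (h1.trans h2) (by linarith)
          _ = ‖Z‖ ^ (p - 1) * (p * R) := by ring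
          _ ≤ _ := by gcongr
      have h9 : (p - 1) * ‖Z‖ / 2 ≤ ‖Z‖ ^ (p - 1) * ((p - 1) * ‖Z‖ / 2) :=
        le_mul_of_one_le_left (by positivity) h4
      rw [h3]
      nlinarith
    have h10 : ‖X - Z‖ ≤ 2 * ‖Z‖ := by
      have := norm_sub_le X Z
      linarith
    calc ‖X - Z‖ ≤ 2 * ‖Z‖ := h10
      _ = 4 / (p - 1) * ((p - 1) * ‖Z‖ / 2) := by field_simp; ring
      _ ≤ _ := by gcongr
  set T : Set (EuclideanSpace ℝ (Fin n) × EuclideanSpace ℝ (Fin n)) :=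
    (closedBall 0 R ×ˢ closedBall 0 R') ∩ {z | τ ≤ ‖z.1 - z.2‖} with hT
  have hTc : IsCompact T := by
    refine ((isCompact_closedBall _ _).prod (isCompact_closedBall _ _)).inter_right ?_
    exact isClosed_le continuous_const (by fun_prop)
  obtain ⟨C1, hC10, hC1⟩ : ∃ C1 : ℝ, 0 ≤ C1 ∧ ∀ z ∈ T, ‖z.1 - z.2‖ ≤ C1 * Br p z.1 z.2 := by
    rcases T.eq_empty_or_nonempty with hE | hN
    · exact ⟨0, le_rfl, by simp [hE]⟩
    · obtain ⟨z0, hz0, hmin⟩ := hTc.exists_isMinOn hN (Br_cont hp).continuousOn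
      have hne : z0.1 ≠ z0.2 := by
        intro h
        have := hz0.2
        simp only [mem_ofPred_eq, h, sub_self, norm_zero] at this
        linarith
      have hpos := Br_pos hp hne
      refine ⟨(R + R') / Br p z0.1 z0.2, by positivity, fun z hz => ?_⟩
      have hz1 : ‖z.1‖ ≤ R := by simpa using hz.1.1
      have hz2 : ‖z.2‖ ≤ R' := by simpa using hz.1.2
      have h1 : Br p z0.1 z0.2 ≤ Br p z.1 z.2 := hmin hz
      calc ‖z.1 - z.2‖ ≤ R + R' := by have := norm_sub_le z.1 z.2; linarith
        _ = (R + R') / Br p z0.1 z0.2 * Br p z0.1 z0.2 := by field_simp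
        _ ≤ _ := by gcongr
  refine ⟨C1 + 4 / (p - 1), by positivity, fun X Z hX => ?_⟩
  have hB := Br_nonneg hp X Z
  have ha : 0 ≤ C1 * Br p X Z := by positivity
  have hb : 0 ≤ 4 / (p - 1) * Br p X Z := by positivity
  rw [add_mul]
  rcases le_total R' ‖Z‖ with h | h
  · linarith [hlarge X Z hX h]
  · rcases le_total τ ‖X - Z‖ with h' | h'
    · have := hC1 (X, Z) ⟨⟨by simpa using hX, by simpa using h⟩, h'⟩
      simp only at this
      linarith
    · linarith

lemma hidden_pw {p : ℝ} (hp : 1 < p) {α β P : ℝ} (hα : 0 < α) (hβ : 0 ≤ β)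
    (hP : P = (α ^ p + β ^ p) / 2) {X b Z : EuclideanSpace ℝ (Fin n)}
    (hZ : P • Z = (1 / 2 : ℝ) • (α ^ p • X + β ^ (p - 1) • b)) :
    P * ‖Z‖ ^ p + 1 / 2 * (α ^ p * Br p X Z) ≤ 1 / 2 * (‖α • X‖ ^ p + ‖b‖ ^ p) := by
  have hp0 : 0 < p := by linarith
  have h1 := Br_nonneg hp b (β • Z)
  have e1 : ‖β • Z‖ ^ (p - 2) * ⟪β • Z, b⟫ = β ^ (p - 1) * (‖Z‖ ^ (p - 2) * ⟪Z, b⟫) := by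
    rcases hβ.eq_or_lt with h | h
    · rw [← h, Real.zero_rpow (by linarith : p - 1 ≠ 0)]; simp
    · rw [norm_smul, Real.norm_of_nonneg hβ, Real.mul_rpow hβ (norm_nonneg _), real_inner_smul_left,
        show p - 1 = (p - 2) + 1 by ring, Real.rpow_add_one h.ne']
      ring
  have e2 : ‖β • Z‖ ^ p = β ^ p * ‖Z‖ ^ p := by
    rw [norm_smul, Real.norm_of_nonneg hβ, Real.mul_rpow hβ (norm_nonneg _)]
  have e3 : ‖α • X‖ ^ p = α ^ p * ‖X‖ ^ p := by
    rw [norm_smul, Real.norm_of_nonneg hα.le, Real.mul_rpow hα.le (norm_nonneg _)]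
  have e4 : P * ⟪Z, Z⟫ = 1 / 2 * (α ^ p * ⟪Z, X⟫ + β ^ (p - 1) * ⟪Z, b⟫) := by
    have := congrArg (fun W => ⟪Z, W⟫) hZ
    simpa [inner_smul_right, inner_add_right, mul_add] using this
  have e5 : P * ‖Z‖ ^ p = 1 / 2 * (α ^ p * (‖Z‖ ^ (p - 2) * ⟪Z, X⟫) +
      β ^ (p - 1) * (‖Z‖ ^ (p - 2) * ⟪Z, b⟫)) := by
    rw [← self_pow hp Z]
    linear_combination (‖Z‖ ^ (p - 2)) * e4
  have e6 : P * ‖Z‖ ^ p = 1 / 2 * (α ^ p * ‖Z‖ ^ p + β ^ p * ‖Z‖ ^ p) := by rw [hP]; ring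
  unfold Br at h1 ⊢
  rw [e1, e2] at h1
  rw [e3]
  nlinarith
end

section
variable {n : ℕ} {Ω : Set (EuclideanSpace ℝ (Fin n))}

lemma gm_props (hΩ : IsOpen Ω) (hb : IsBounded Ω) :
    IsFiniteMeasure ((gaussianMeasure n).restrict Ω) ∧
    (∀ᵐ x ∂((gaussianMeasure n).restrict Ω), x ∈ Ω) ∧
    ∃ a b : ℝ≥0, (gaussianMeasure n).restrict Ω ≤ (a : ENNReal) • volume ∧
      volume.restrict Ω ≤ (b : ENNReal) • ((gaussianMeasure n).restrict Ω) := by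
  set c : ℝ := (2 * π) ^ (-(n : ℝ) / 2) with hc
  have hc0 : 0 < c := by positivity
  set g : EuclideanSpace ℝ (Fin n) → ENNReal :=
    fun x => ENNReal.ofReal (c * Real.exp (-‖x‖ ^ 2 / 2)) with hg
  have hgm : Measurable g := by
    apply ENNReal.measurable_ofReal.comp
    have : Continuous (fun x : EuclideanSpace ℝ (Fin n) => c * Real.exp (-‖x‖ ^ 2 / 2)) := by
      fun_prop
    exact this.measurable
  have hgd : gaussianMeasure n = volume.withDensity g := rfl
  have hle : gaussianMeasure n ≤ (c.toNNReal : ENNReal) • volume := by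
    rw [hgd, ← withDensity_const]
    refine withDensity_mono (Filter.Eventually.of_forall fun x => ?_)
    refine ENNReal.ofReal_le_ofReal ?_
    refine mul_le_of_le_one_right hc0.le (Real.exp_le_one_iff.2 ?_)
    have := sq_nonneg ‖x‖
    linarith
  have hfin : gaussianMeasure n Ω < ⊤ := by
    refine (hle Ω).trans_lt ?_
    rw [Measure.smul_apply, smul_eq_mul]
    exact ENNReal.mul_lt_top ENNReal.coe_lt_top hb.measure_lt_top
  obtain ⟨R, hR⟩ := hb.exists_norm_le
  set d : ℝ := c * Real.exp (-R ^ 2 / 2) with hd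
  have hd0 : 0 < d := by positivity
  refine ⟨⟨by simpa using hfin⟩, ae_restrict_mem hΩ.measurableSet, c.toNNReal, (d⁻¹).toNNReal,
    Measure.restrict_le_self.trans hle, ?_⟩
  rw [hgd, restrict_withDensity hΩ.measurableSet, ← withDensity_smul _ hgm]
  conv_lhs => rw [← withDensity_one (μ := volume.restrict Ω)]
  refine withDensity_mono ?_
  filter_upwards [ae_restrict_mem hΩ.measurableSet] with x hx
  have h1 : d ≤ c * Real.exp (-‖x‖ ^ 2 / 2) := by
    rw [hd]
    gcongr
    exact hR x hx
  show (1 : ENNReal) ≤ ENNReal.ofReal (d⁻¹) * ENNReal.ofReal (c * Real.exp (-‖x‖ ^ 2 / 2))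
  rw [← ENNReal.ofReal_mul (by positivity), ← ENNReal.ofReal_one]
  refine ENNReal.ofReal_le_ofReal ?_
  calc 1 = d⁻¹ * d := by field_simp
    _ ≤ _ := by gcongr

lemma norm_grad (v : EuclideanSpace ℝ (Fin n) → ℝ) (x) : ‖gradient v x‖ = ‖fderiv ℝ v x‖ := by
  unfold gradient
  simp

lemma open_null {μ : Measure (EuclideanSpace ℝ (Fin n))} {b : ℝ≥0}
    (hvμ : volume.restrict Ω ≤ (b : ENNReal) • μ) {U : Set (EuclideanSpace ℝ (Fin n))}
    (hU : IsOpen U) (hUΩ : U ⊆ Ω) (h0 : μ U = 0) : U = ∅ := by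
  have h := hvμ U
  rw [Measure.smul_apply, h0, smul_zero, Measure.restrict_apply hU.measurableSet,
    inter_eq_left.2 hUΩ] at h
  exact (hU.measure_eq_zero_iff volume).1 (le_antisymm h zero_le)

lemma zero_pow_half {p t : ℝ} (s : ℝ) (ht : 0 ≤ t) : (0 * s + t ^ 2) ^ (p / 2) = t ^ p := by
  rw [zero_mul, zero_add, ← Real.rpow_natCast, ← Real.rpow_mul ht]
  congr 1; push_cast; ring

lemma Sd_eq {d t : ℝ} (hd : 0 < d) (h : d ≤ t) : Sd d d t = 1 - (d / t) ^ 2 := by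
  have h2 : -t - d ≤ 0 := by linarith
  have h3 : 0 ≤ t - d := by linarith
  simp [Sd, qd, max_eq_right h2, max_eq_left h3, hd.ne', div_pow]

structure HS (p : ℝ) (Ω : Set (EuclideanSpace ℝ (Fin n)))
    (μ : Measure (EuclideanSpace ℝ (Fin n))) (u : EuclideanSpace ℝ (Fin n) → ℝ) (lam : ℝ) :
    Prop where
  hn : 2 ≤ n
  hp : 1 < p
  hΩ : IsOpen Ω
  hb : IsBounded Ω
  hc : Convex ℝ Ω
  hne : Ω.Nonempty
  hμ : ∀ᵐ x ∂μ, x ∈ Ω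
  hab : ∃ a b : ℝ≥0, μ ≤ (a : ENNReal) • volume ∧ volume.restrict Ω ≤ (b : ENNReal) • μ
  hu : Adm Ω u
  hupos : ∀ x ∈ Ω, 0 < u x
  huL : ∃ L, 0 ≤ L ∧ ∀ x ∈ Ω, ‖fderiv ℝ u x‖ ≤ L
  hnorm : ∫ x, u x ^ p ∂μ = 1
  hlam : 0 ≤ lam
  hray : ∀ φ, IsTestFun n Ω φ → lam * ∫ x, |φ x| ^ p ∂μ ≤
      ∫ x, (0 * φ x ^ 2 + ‖fderiv ℝ φ x‖ ^ 2) ^ (p / 2) ∂μ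
  hen : ∫ x, ‖fderiv ℝ u x‖ ^ p ∂μ ≤ lam

structure HM (p : ℝ) (Ω : Set (EuclideanSpace ℝ (Fin n)))
    (μ : Measure (EuclideanSpace ℝ (Fin n))) (ε Λ : ℝ) (w : EuclideanSpace ℝ (Fin n) → ℝ) :
    Prop where
  hw : Adm Ω w
  hε : 0 < ε
  hw0 : ∀ x ∈ closure Ω, 0 ≤ w x
  hnorm : ∫ x, w x ^ p ∂μ = 1
  hray : ∀ φ, IsTestFun n Ω φ → Λ * ∫ x, |φ x| ^ p ∂μ ≤
      ∫ x, (ε * φ x ^ 2 + ‖fderiv ℝ φ x‖ ^ 2) ^ (p / 2) ∂μ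
  hint : Integrable (fun x => (ε * w x ^ 2 + ‖fderiv ℝ w x‖ ^ 2) ^ (p / 2)) μ
  heq : ∫ x, (ε * w x ^ 2 + ‖fderiv ℝ w x‖ ^ 2) ^ (p / 2) ∂μ = Λ

lemma lam_nonneg (p : ℝ) : 0 ≤ lambdaPGamma n p Ω := by
  refine Real.sInf_nonneg ?_
  rintro r ⟨v, hv, hv0, rfl⟩
  exact div_nonneg (integral_nonneg fun x => by positivity)
    (integral_nonneg fun x => by positivity)

lemma lam_ray {p : ℝ} (φ : EuclideanSpace ℝ (Fin n) → ℝ) (hφ : IsTestFun n Ω φ) :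
    lambdaPGamma n p Ω * ∫ x in Ω, |φ x| ^ p ∂(gaussianMeasure n) ≤
      ∫ x in Ω, (0 * φ x ^ 2 + ‖fderiv ℝ φ x‖ ^ 2) ^ (p / 2) ∂(gaussianMeasure n) := by
  have e : ∀ x, (0 * φ x ^ 2 + ‖fderiv ℝ φ x‖ ^ 2) ^ (p / 2) = ‖gradient φ x‖ ^ p := fun x => by
    rw [zero_pow_half _ (norm_nonneg _), norm_grad]
  simp only [e]
  have hN : 0 ≤ ∫ x in Ω, ‖gradient φ x‖ ^ p ∂(gaussianMeasure n) :=
    integral_nonneg fun x => by positivity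
  have hD : 0 ≤ ∫ x in Ω, |φ x| ^ p ∂(gaussianMeasure n) :=
    integral_nonneg fun x => by positivity
  rcases hD.eq_or_lt with h | h
  · rw [← h]; simpa using hN
  · by_cases hφ0 : φ = 0
    · by_cases hp : p = 0
      · subst hp
        simp only [Real.rpow_zero]
        simp only [Real.rpow_zero] at h
        have h1 : lambdaPGamma n 0 Ω ≤ 1 := by
          by_cases hex : ∃ v : EuclideanSpace ℝ (Fin n) → ℝ, IsTestFun n Ω v ∧ v ≠ 0
          · obtain ⟨v, hv, hv0⟩ := hex
            refine csInf_le ⟨0, ?_⟩ ⟨v, hv, hv0, ?_⟩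
            · rintro r ⟨v, hv, hv0, rfl⟩
              exact div_nonneg (integral_nonneg fun x => by positivity)
                (integral_nonneg fun x => by positivity)
            · simp only [Real.rpow_zero]
              rw [div_self h.ne']
          · have : lambdaPGamma n 0 Ω = 0 := by
              unfold lambdaPGamma
              convert Real.sInf_empty
              ext r
              simp only [mem_empty_iff_false, iff_false]
              rintro ⟨v, hv, hv0, rfl⟩
              exact hex ⟨v, hv, hv0⟩
            rw [this]; norm_num
        exact mul_le_of_le_one_left h.le h1
      · subst hφ0
        simp [Real.zero_rpow hp] at h
    · rw [← le_div_iff₀ h]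
      refine csInf_le ⟨0, ?_⟩ ⟨φ, hφ, hφ0, rfl⟩
      rintro r ⟨v, hv, hv0, rfl⟩
      exact div_nonneg (integral_nonneg fun x => by positivity)
        (integral_nonneg fun x => by positivity)

lemma leps_bdd (p ε : ℝ) (hε : 0 ≤ ε) : BddBelow { r : ℝ | ∃ v : EuclideanSpace ℝ (Fin n) → ℝ,
    IsTestFun n Ω v ∧
    (∫ x in Ω, |v x| ^ p ∂(gaussianMeasure n)) = 1 ∧ r = Jeps n p ε Ω v } := by
  refine ⟨0, ?_⟩
  rintro r ⟨v, hv, hv0, rfl⟩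
  exact integral_nonneg fun x => by positivity

lemma scale_test {p ε : ℝ} (hp : 1 < p) (hε : 0 ≤ ε) (φ : EuclideanSpace ℝ (Fin n) → ℝ)
    (hφ : IsTestFun n Ω φ) {D : ℝ} (hD : 0 < D)
    (hDe : ∫ x in Ω, |φ x| ^ p ∂(gaussianMeasure n) = D) :
    ∃ v, IsTestFun n Ω v ∧ (∫ x in Ω, |v x| ^ p ∂(gaussianMeasure n)) = 1 ∧
      Jeps n p ε Ω v = D⁻¹ * Jeps n p ε Ω φ := by
  have hp0 : 0 < p := by linarith
  set c : ℝ := D ^ (-(1 / p)) with hc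
  have hc0 : 0 < c := by positivity
  have hcp : c ^ p = D⁻¹ := by
    rw [hc, ← Real.rpow_mul hD.le, ← Real.rpow_neg_one]
    congr 1; field_simp
  refine ⟨fun x => c * φ x, ⟨contDiff_const.mul hφ.1, hφ.2.1.mul_left, ?_⟩, ?_, ?_⟩
  · exact (closure_mono (fun x hx => by
      simp only [Function.mem_support] at hx ⊢
      exact right_ne_zero_of_mul hx)).trans hφ.2.2
  · have : ∀ x, |c * φ x| ^ p = D⁻¹ * |φ x| ^ p := fun x => by
      rw [abs_mul, abs_of_pos hc0, Real.mul_rpow hc0.le (abs_nonneg _), hcp]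
    simp only [this]
    rw [integral_const_mul, hDe, inv_mul_cancel₀ hD.ne']
  · unfold Jeps
    rw [← integral_const_mul]
    congr 1
    ext x
    have hd : DifferentiableAt ℝ φ x := hφ.1.differentiable (by simp) x
    have : ‖gradient (fun x => c * φ x) x‖ = c * ‖gradient φ x‖ := by
      rw [norm_grad, norm_grad, fderiv_const_mul hd, norm_smul, Real.norm_of_nonneg hc0.le]
    rw [this, show ε * (c * φ x) ^ 2 + (c * ‖gradient φ x‖) ^ 2 =
      c ^ 2 * (ε * φ x ^ 2 + ‖gradient φ x‖ ^ 2) by ring,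
      Real.mul_rpow (by positivity) (by positivity), ← hcp]
    congr 1
    rw [← Real.rpow_natCast, ← Real.rpow_mul hc0.le]
    congr 1; push_cast; ring

lemma leps_ray {p ε : ℝ} (hp : 1 < p) (hε : 0 ≤ ε) (φ : EuclideanSpace ℝ (Fin n) → ℝ)
    (hφ : IsTestFun n Ω φ) :
    lambdaEps n p ε Ω * ∫ x in Ω, |φ x| ^ p ∂(gaussianMeasure n) ≤
      ∫ x in Ω, (ε * φ x ^ 2 + ‖fderiv ℝ φ x‖ ^ 2) ^ (p / 2) ∂(gaussianMeasure n) := by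
  have hN : 0 ≤ ∫ x in Ω, (ε * φ x ^ 2 + ‖fderiv ℝ φ x‖ ^ 2) ^ (p / 2) ∂(gaussianMeasure n) :=
    integral_nonneg fun x => by positivity
  have hD : 0 ≤ ∫ x in Ω, |φ x| ^ p ∂(gaussianMeasure n) :=
    integral_nonneg fun x => by positivity
  rcases hD.eq_or_lt with h | h
  · rw [← h]; simpa using hN
  · obtain ⟨v, h1, h2, h3⟩ := scale_test hp hε φ hφ h rfl
    have h4 : lambdaEps n p ε Ω ≤ Jeps n p ε Ω v :=
      csInf_le (leps_bdd p ε hε) ⟨v, h1, h2, rfl⟩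
    rw [h3, ← div_eq_inv_mul, le_div_iff₀ h] at h4
    unfold Jeps at h4
    simpa only [norm_grad] using h4

lemma leps_pos {p ε : ℝ} (hp : 1 < p) (hε : 0 < ε) (hΩ : IsOpen Ω) (hb : IsBounded Ω)
    (hne : Ω.Nonempty) : 0 < lambdaEps n p ε Ω := by
  obtain ⟨hfin, hμ, a, b, ha, hbb⟩ := gm_props hΩ hb
  have hp0 : 0 < p := by linarith
  have hεp : 0 < ε ^ (p / 2) := by positivity
  refine lt_of_lt_of_le hεp ?_
  refine le_csInf ?_ ?_
  · obtain ⟨x, hx⟩ := hne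
    obtain ⟨f, f1, f2, f3, f4, f5⟩ := exists_contDiff_tsupport_subset (n := ⊤) (hΩ.mem_nhds hx)
    have hft : IsTestFun n Ω f := ⟨f3, f2, f1⟩
    have hD : 0 ≤ ∫ x in Ω, |f x| ^ p ∂(gaussianMeasure n) :=
      integral_nonneg fun x => by positivity
    have hcont : Continuous (fun x => |f x| ^ p) :=
      f3.continuous.abs.rpow_const (fun _ => Or.inr hp0.le)
    have hI : Integrable (fun x => |f x| ^ p) ((gaussianMeasure n).restrict Ω) := by
      refine integrable_of_bdd hΩ hμ hcont.continuousOn 1 (fun x _ => ?_)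
      have := f4 (mem_range_self x)
      rw [abs_of_nonneg (by positivity), abs_of_nonneg this.1]
      exact Real.rpow_le_one this.1 this.2 hp0.le
    rcases hD.eq_or_lt with h | h
    · exfalso
      have h0 := (integral_eq_zero_iff_of_nonneg (fun x => by positivity) hI).1 h.symm
      have hU : IsOpen (Ω ∩ {x | 0 < |f x| ^ p}) :=
        hΩ.inter (isOpen_lt continuous_const hcont)
      have := open_null hbb hU inter_subset_left (by
        refine measure_mono_null (inter_subset_right) ?_
        refine measure_mono_null (fun x hx => ?_) h0
        intro h'
        simp only [mem_ofPred_eq] at hx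
        have h'' : |f x| ^ p = 0 := h'
        rw [h''] at hx
        exact lt_irrefl _ hx)
      have hx' : x ∈ Ω ∩ {x | 0 < |f x| ^ p} := ⟨hx, by
        show 0 < |f x| ^ p
        rw [f5]; simp⟩
      rw [this] at hx'
      exact hx'
    · obtain ⟨v, h1, h2, h3⟩ := scale_test hp hε.le f hft h rfl
      exact ⟨_, v, h1, h2, rfl⟩
  · rintro r ⟨v, hv, hv1, rfl⟩
    have hv1' : ContDiff ℝ 1 v := hv.1.of_le (by simp)
    obtain ⟨M, hM0, hM⟩ := c1c_bound hv1' hv.2.1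
    have hc : Continuous (fun x => (ε * v x ^ 2 + ‖gradient v x‖ ^ 2) ^ (p / 2)) := by
      simp only [norm_grad]
      have h1 := hv1'.continuous
      have h2 := hv1'.continuous_fderiv (by norm_num)
      refine Continuous.rpow_const ?_ (fun _ => Or.inr (by linarith))
      fun_prop
    calc ε ^ (p / 2) = ∫ x in Ω, ε ^ (p / 2) * |v x| ^ p ∂(gaussianMeasure n) := by
          rw [integral_const_mul, hv1, mul_one]
      _ ≤ Jeps n p ε Ω v := by
          refine integral_mono_of_nonneg (Filter.Eventually.of_forall fun x => ?_) ?_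
            (Filter.Eventually.of_forall fun x => ?_)
          · show 0 ≤ ε ^ (p / 2) * |v x| ^ p
            positivity
          · refine integrable_of_bdd hΩ hμ hc.continuousOn ((ε * M ^ 2 + M ^ 2) ^ (p / 2))
              (fun x _ => ?_)
            rw [abs_of_nonneg (by positivity), ← sq_abs (v x), norm_grad]
            refine Real.rpow_le_rpow (by positivity) ?_ (by linarith)
            have := (hM x).1
            have := (hM x).2
            gcongr
          · show ε ^ (p / 2) * |v x| ^ p ≤ _
            have : |v x| ^ p = (v x ^ 2) ^ (p / 2) := by
              rw [← sq_abs, ← Real.rpow_natCast, ← Real.rpow_mul (abs_nonneg _)]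
              congr 1; push_cast; ring
            rw [this, ← Real.mul_rpow hε.le (sq_nonneg _)]
            refine Real.rpow_le_rpow (by positivity) ?_ (by linarith)
            have := sq_nonneg ‖gradient v x‖
            linarith

lemma HM_of {p ε : ℝ} (hp : 1 < p) (hε : 0 < ε) (hΩ : IsOpen Ω) (hb : IsBounded Ω)
    (hne : Ω.Nonempty) {w : EuclideanSpace ℝ (Fin n) → ℝ} (h : IsNormalizedMinimizer n p ε Ω w) :
    HM p Ω ((gaussianMeasure n).restrict Ω) ε (lambdaEps n p ε Ω) w := by
  obtain ⟨h1, h2, h3, h4, h5, h6⟩ := h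
  have hpos := leps_pos hp hε hΩ hb hne
  have h6' : ∫ x in Ω, (ε * w x ^ 2 + ‖fderiv ℝ w x‖ ^ 2) ^ (p / 2) ∂(gaussianMeasure n) =
      lambdaEps n p ε Ω := by
    rw [← h6]; unfold Jeps; simp only [norm_grad]
  refine ⟨⟨h1, h2, h4⟩, hε, h3, h5, leps_ray hp hε.le, ?_, h6'⟩
  by_contra hni
  rw [integral_undef hni] at h6'
  linarith
end

section
variable {n : ℕ} {Ω : Set (EuclideanSpace ℝ (Fin n))}

lemma u_props (hΩ : IsOpen Ω) (hb : IsBounded Ω) (hc : Convex ℝ Ω) (hne : Ω.Nonempty)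
    {u : EuclideanSpace ℝ (Fin n) → ℝ} (hu1 : ContDiffOn ℝ 1 u (closure Ω))
    (hub : ∀ x ∈ frontier Ω, u x = 0) :
    Adm Ω u ∧ ∃ L, 0 ≤ L ∧ ∀ x ∈ Ω, ‖fderiv ℝ u x‖ ≤ L := by
  refine ⟨⟨hu1.continuousOn, hu1.mono subset_closure, hub⟩, ?_⟩
  have hud : UniqueDiffOn ℝ (closure Ω) := uniqueDiffOn_convex hc.closure
    (hne.mono (interior_maximal subset_closure hΩ))
  have h1 := hu1.continuousOn_fderivWithin hud (by norm_num)
  obtain ⟨L, hL⟩ := (hb.isCompact_closure).exists_bound_of_continuousOn h1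
  refine ⟨max L 0, le_max_right _ _, fun x hx => ?_⟩
  have := hL x (subset_closure hx)
  rw [fderivWithin_of_mem_nhds (Filter.mem_of_superset (hΩ.mem_nhds hx) subset_closure)] at this
  exact this.trans (le_max_left _ _)

lemma en_abs {μ : Measure (EuclideanSpace ℝ (Fin n))} [IsFiniteMeasure μ] {p lam : ℝ} (hp : 1 < p)
    (hlam : 0 ≤ lam)
    (hΩ : IsOpen Ω) (hb : IsBounded Ω) (hμ : ∀ᵐ x ∂μ, x ∈ Ω)
    {u : EuclideanSpace ℝ (Fin n) → ℝ} (hu : Adm Ω u) (hupos : ∀ x ∈ Ω, 0 < u x)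
    {L : ℝ} (hL : ∀ x ∈ Ω, ‖fderiv ℝ u x‖ ≤ L) (hL0 : 0 ≤ L)
    (hnorm : ∫ x, u x ^ p ∂μ = 1)
    (heig : ∀ φ : EuclideanSpace ℝ (Fin n) → ℝ, IsTestFun n Ω φ →
      ∫ x, ‖gradient u x‖ ^ (p - 2) * ⟪gradient u x, gradient φ x⟫ ∂μ
        = lam * ∫ x, u x ^ (p - 1) * φ x ∂μ) :
    ∫ x, ‖fderiv ℝ u x‖ ^ p ∂μ ≤ lam := by
  have hp0 : 0 < p := by linarith
  obtain ⟨M, hM0, hM⟩ := hu.bdd hb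
  have hgc : ContinuousOn (gradient u) Ω := by
    unfold gradient
    exact (LinearIsometryEquiv.continuous _).comp_continuousOn (hu.cont_fderiv hΩ)
  have hgL : ∀ x ∈ Ω, ‖gradient u x‖ ≤ L := fun x hx => by rw [norm_grad]; exact hL x hx
  have hgm : AEStronglyMeasurable (gradient u) μ := ae_meas_of_cont hΩ hμ hgc
  -- the field
  have hAbound : ∀ x ∈ Ω, ∀ V : EuclideanSpace ℝ (Fin n), ∀ m : ℝ, ‖V‖ ≤ m →
      ‖‖gradient u x‖ ^ (p - 2) * ⟪gradient u x, V⟫‖ ≤ L ^ (p - 1) * m := by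
    intro x hx V m hV
    have h1 := inner_pow_le hp V (gradient u x)
    have h2 := inner_pow_le hp (-V) (gradient u x)
    rw [inner_neg_right, norm_neg] at h2
    have h3 : ‖gradient u x‖ ^ (p - 1) * ‖V‖ ≤ L ^ (p - 1) * m := by
      have := hgL x hx
      have : ‖gradient u x‖ ^ (p - 1) ≤ L ^ (p - 1) :=
        Real.rpow_le_rpow (norm_nonneg _) this (by linarith)
      gcongr
    rw [Real.norm_eq_abs, abs_le]
    constructor <;> linarith
  have key : ∀ d : ℝ, 0 < d → ∫ x, Sd d d (u x) * ‖fderiv ℝ u x‖ ^ p ∂μ ≤ lam := by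
    intro d hd
    obtain ⟨w, w1, w2, w3, w4⟩ := trunc_props hΩ hb hu hd hd
    obtain ⟨φ, φ1, φ2, φ3, m, hm0, hm⟩ := mollify_seq hΩ w1 w2 w3
    have hgφ : ∀ x, Filter.Tendsto (fun j => gradient (φ j) x) Filter.atTop (𝓝 (gradient w x)) := by
      intro x
      unfold gradient
      exact ((LinearIsometryEquiv.continuous _).tendsto _).comp (φ3 x)
    have hlim1 : Filter.Tendsto (fun j => ∫ x, ‖gradient u x‖ ^ (p - 2) *
        ⟪gradient u x, gradient (φ j) x⟫ ∂μ) Filter.atTop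
        (𝓝 (∫ x, ‖gradient u x‖ ^ (p - 2) * ⟪gradient u x, gradient w x⟫ ∂μ)) := by
      refine tendsto_integral_of_dominated_convergence (fun _ => L ^ (p - 1) * m) (fun j => ?_)
        (integrable_const _) (fun j => ?_) (Filter.Eventually.of_forall fun x => ?_)
      · have h1 : AEStronglyMeasurable (gradient (φ j)) μ := by
          have : Continuous (gradient (φ j)) := by
            unfold gradient
            exact (LinearIsometryEquiv.continuous _).comp ((φ1 j).1.continuous_fderiv (by simp))
          exact this.aestronglyMeasurable
        exact (hgm.norm.aemeasurable.pow_const _).aestronglyMeasurable.mul (hgm.inner h1)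
      · filter_upwards [hμ] with x hx
        exact hAbound x hx _ m (by rw [norm_grad]; exact (hm j x).2)
      · exact (Filter.Tendsto.inner tendsto_const_nhds (hgφ x)).const_mul _
    have hup : AEStronglyMeasurable (fun x => u x ^ (p - 1)) μ := ae_meas_of_cont hΩ hμ
      (hu.cont.rpow_const (fun x _ => Or.inr (by linarith)))
    have hub : ∀ x ∈ Ω, u x ≤ M := fun x hx =>
      (le_abs_self _).trans (hM x (subset_closure hx))
    have hlim2 : Filter.Tendsto (fun j => lam * ∫ x, u x ^ (p - 1) * φ j x ∂μ) Filter.atTop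
        (𝓝 (lam * ∫ x, u x ^ (p - 1) * w x ∂μ)) := by
      refine Filter.Tendsto.const_mul _ ?_
      refine tendsto_integral_of_dominated_convergence (fun _ => M ^ (p - 1) * m) (fun j => ?_)
        (integrable_const _) (fun j => ?_) (Filter.Eventually.of_forall fun x => ?_)
      · exact hup.mul (φ1 j).1.continuous.aestronglyMeasurable
      · filter_upwards [hμ] with x hx
        have h0 := (hupos x hx).le
        rw [norm_mul, Real.norm_of_nonneg (by positivity)]
        have h1 := (hm j x).1
        have h2 : u x ^ (p - 1) ≤ M ^ (p - 1) := Real.rpow_le_rpow h0 (hub x hx) (by linarith)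
        rw [Real.norm_eq_abs]
        gcongr
      · exact (φ2 x).const_mul _
    have heq := tendsto_nhds_unique (hlim1.congr (fun j => heig (φ j) (φ1 j))) hlim2
    have e1 : ∫ x, Sd d d (u x) * ‖fderiv ℝ u x‖ ^ p ∂μ =
        ∫ x, ‖gradient u x‖ ^ (p - 2) * ⟪gradient u x, gradient w x⟫ ∂μ := by
      refine integral_congr_ae ?_
      filter_upwards [hμ] with x hx
      have : gradient w x = Sd d d (u x) • gradient u x := by
        unfold gradient
        rw [(w4 x hx).2]
        simp
      rw [this, inner_smul_right, ← norm_grad, ← self_pow hp]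
      ring
    rw [e1, heq]
    have hup1 : Integrable (fun x => u x ^ p) μ := by
      by_contra h
      rw [integral_undef h] at hnorm
      exact zero_ne_one hnorm
    have h2 : ∫ x, u x ^ (p - 1) * w x ∂μ ≤ ∫ x, u x ^ p ∂μ := by
      refine integral_mono_ae ?_ hup1 ?_
      · refine Integrable.mono' hup1 (hup.mul w1.continuous.aestronglyMeasurable) ?_
        filter_upwards [hμ] with x hx
        have h0 := hupos x hx
        rw [(w4 x hx).1, norm_mul, Real.norm_of_nonneg (by positivity), Real.norm_eq_abs]
        calc u x ^ (p - 1) * |Sf d d (u x)| ≤ u x ^ (p - 1) * |u x| :=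
              mul_le_mul_of_nonneg_left (Sf_le hd hd.le _) (by positivity)
          _ = u x ^ p := by
              rw [abs_of_pos h0, ← Real.rpow_add_one h0.ne']; congr 1; ring
      · filter_upwards [hμ] with x hx
        have h0 := hupos x hx
        rw [(w4 x hx).1]
        calc u x ^ (p - 1) * Sf d d (u x) ≤ u x ^ (p - 1) * |u x| := by
              gcongr; exact (le_abs_self _).trans (Sf_le hd hd.le _)
          _ = u x ^ p := by
              rw [abs_of_pos h0, ← Real.rpow_add_one h0.ne']; congr 1; ring
    rw [hnorm] at h2
    exact mul_le_of_le_one_right hlam h2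
  have hd : ∀ j : ℕ, (0:ℝ) < 1 / ((j : ℝ) + 1) := fun j => by positivity
  refine le_of_tendsto' (x := Filter.atTop) ?_ (fun j : ℕ => key _ (hd j))
  refine tendsto_integral_of_dominated_convergence (fun _ => L ^ p) (fun j => ?_)
    (integrable_const _) (fun j => ?_) ?_
  · refine ae_meas_of_cont hΩ hμ ?_
    refine ((Sd_cont (hd j)).comp_continuousOn hu.cont).mul ?_
    exact (hu.cont_fderiv hΩ).norm.rpow_const (fun x _ => Or.inr hp0.le)
  · filter_upwards [hμ] with x hx
    obtain ⟨h2, h3⟩ := Sd_mem (hd j) (hd j).le (u x)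
    rw [Real.norm_of_nonneg (by positivity)]
    calc _ ≤ ‖fderiv ℝ u x‖ ^ p := mul_le_of_le_one_left (by positivity) h3
      _ ≤ L ^ p := Real.rpow_le_rpow (norm_nonneg _) (hL x hx) hp0.le
  · filter_upwards [hμ] with x hx
    have h0 := hupos x hx
    have hz := tendsto_one_div_add_atTop_nhds_zero_nat (𝕜 := ℝ)
    have h1 : Filter.Tendsto (fun j : ℕ => 1 - (1 / ((j : ℝ) + 1) / u x) ^ 2) Filter.atTop (𝓝 1) := by
      simpa using tendsto_const_nhds.sub ((hz.div_const (u x)).pow 2)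
    have h2 : Filter.Tendsto (fun j : ℕ => Sd (1 / ((j : ℝ) + 1)) (1 / ((j : ℝ) + 1)) (u x))
        Filter.atTop (𝓝 1) := by
      refine h1.congr' ?_
      filter_upwards [hz.eventually (eventually_le_nhds h0)] with j hj
      exact (Sd_eq (hd j) hj).symm
    simpa using h2.mul_const (‖fderiv ℝ u x‖ ^ p)

lemma HS_of (hn : 2 ≤ n) {p : ℝ} (hp : 1 < p)
    (hΩ : IsOpen Ω) (hb : IsBounded Ω) (hc : Convex ℝ Ω)
    {u : EuclideanSpace ℝ (Fin n) → ℝ} (hu1 : ContDiffOn ℝ 1 u (closure Ω))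
    (hupos : ∀ x ∈ Ω, 0 < u x) (hub : ∀ x ∈ frontier Ω, u x = 0)
    (hnorm : (∫ x in Ω, u x ^ p ∂(gaussianMeasure n)) = 1)
    (heig : ∀ φ : EuclideanSpace ℝ (Fin n) → ℝ, IsTestFun n Ω φ →
      ∫ x in Ω, ‖gradient u x‖ ^ (p - 2) * ⟪gradient u x, gradient φ x⟫ ∂(gaussianMeasure n)
        = lambdaPGamma n p Ω * ∫ x in Ω, u x ^ (p - 1) * φ x ∂(gaussianMeasure n)) :
    HS p Ω ((gaussianMeasure n).restrict Ω) u (lambdaPGamma n p Ω) := by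
  obtain ⟨hfin, hμ, hab⟩ := gm_props hΩ hb
  have hne : Ω.Nonempty := by
    by_contra h
    rw [not_nonempty_iff_eq_empty] at h
    rw [h] at hnorm
    simp at hnorm
  obtain ⟨h1, L, hL0, hL⟩ := u_props hΩ hb hc hne hu1 hub
  exact ⟨hn, hp, hΩ, hb, hc, hne, hμ, hab, h1, hupos, ⟨L, hL0, hL⟩, hnorm, lam_nonneg p, lam_ray,
    en_abs hp (lam_nonneg p) hΩ hb hμ h1 hupos hL hL0 hnorm heig⟩
end

section
variable {n : ℕ} {Ω : Set (EuclideanSpace ℝ (Fin n))}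

noncomputable def sg (p : ℝ) (u w : EuclideanSpace ℝ (Fin n) → ℝ) (x : EuclideanSpace ℝ (Fin n)) : ℝ :=
  ((u x ^ p + w x ^ p) / 2) ^ (1 / p)

noncomputable def th (p : ℝ) (u w : EuclideanSpace ℝ (Fin n) → ℝ) (x : EuclideanSpace ℝ (Fin n)) : ℝ :=
  u x ^ p / (u x ^ p + w x ^ p)

lemma sg_adm {p : ℝ} (hp : 1 < p)
    {u w : EuclideanSpace ℝ (Fin n) → ℝ} (hu : Adm Ω u) (hw : Adm Ω w)
    (hupos : ∀ x ∈ Ω, 0 < u x) (hw0 : ∀ x ∈ closure Ω, 0 ≤ w x) : Adm Ω (sg p u w) := by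
  have hp0 : 0 < p := by linarith
  refine ⟨?_, ?_, ?_⟩
  · refine ContinuousOn.rpow_const ?_ (fun x _ => Or.inr (by positivity))
    refine ContinuousOn.div_const (ContinuousOn.add ?_ ?_) 2
    · exact hu.1.rpow_const (fun x _ => Or.inr hp0.le)
    · exact hw.1.rpow_const (fun x _ => Or.inr hp0.le)
  · refine ContDiffOn.rpow_const_of_ne ?_ (fun x hx => ?_)
    · refine ContDiffOn.div_const (ContDiffOn.add ?_ ?_) 2
      · exact hu.2.1.rpow_const_of_ne (fun x hx => (hupos x hx).ne')
      · exact hw.2.1.rpow_const_of_le (by norm_num; exact hp.le)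
    · have := hupos x hx
      have := hw0 x (subset_closure hx)
      positivity
  · intro x hx
    simp [sg, hu.2.2 x hx, hw.2.2 x hx, Real.zero_rpow hp0.ne',
      Real.zero_rpow (inv_ne_zero hp0.ne')]

lemma th_c1 {p : ℝ} (hp : 1 < p)
    {u w : EuclideanSpace ℝ (Fin n) → ℝ} (hu : Adm Ω u) (hw : Adm Ω w)
    (hupos : ∀ x ∈ Ω, 0 < u x) (hw0 : ∀ x ∈ closure Ω, 0 ≤ w x) :
    ContDiffOn ℝ 1 (th p u w) Ω := by
  have h1 : ContDiffOn ℝ 1 (fun x => u x ^ p) Ω :=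
    hu.2.1.rpow_const_of_ne (fun x hx => (hupos x hx).ne')
  refine h1.div (h1.add ?_) (fun x hx => ?_)
  · exact hw.2.1.rpow_const_of_le (by norm_num; exact hp.le)
  · have := hupos x hx
    have := hw0 x (subset_closure hx)
    positivity

lemma grad_eq {f : EuclideanSpace ℝ (Fin n) → ℝ} {x G : EuclideanSpace ℝ (Fin n)}
    (h : HasFDerivAt f (InnerProductSpace.toDual ℝ _ G) x) : gradient f x = G := by
  unfold gradient
  rw [h.fderiv]
  simp

lemma hidden_grads {p : ℝ} (hp : 1 < p) {u w : EuclideanSpace ℝ (Fin n) → ℝ}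
    {x : EuclideanSpace ℝ (Fin n)} (hu : DifferentiableAt ℝ u x) (hw : DifferentiableAt ℝ w x)
    (hu0 : 0 < u x) (hw0 : 0 ≤ w x) :
    ∃ X Z : EuclideanSpace ℝ (Fin n), gradient u x = u x • X ∧
      ((u x ^ p + w x ^ p) / 2) • Z =
        (1 / 2 : ℝ) • (u x ^ p • X + w x ^ (p - 1) • gradient w x) ∧
      gradient (sg p u w) x = sg p u w x • Z ∧
      gradient (th p u w) x = (p * th p u w x) • (X - Z) := by
  have hp0 : 0 < p := by linarith
  have hup : 0 < u x ^ p := by positivity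
  have hwp : 0 ≤ w x ^ p := by positivity
  set a := gradient u x with ha
  set b := gradient w x with hb
  have hau : HasFDerivAt u (InnerProductSpace.toDual ℝ _ a) x := hu.hasGradientAt
  have hbw : HasFDerivAt w (InnerProductSpace.toDual ℝ _ b) x := hw.hasGradientAt
  set P : ℝ := (u x ^ p + w x ^ p) / 2 with hP
  have hP0 : 0 < P := by positivity
  set X := (u x)⁻¹ • a with hX
  set Z := P⁻¹ • ((1 / 2 : ℝ) • (u x ^ p • X + w x ^ (p - 1) • b)) with hZ
  have hPZ : P • Z = (1 / 2 : ℝ) • (u x ^ p • X + w x ^ (p - 1) • b) := by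
    rw [hZ, smul_smul, mul_inv_cancel₀ hP0.ne', one_smul]
  have haX : a = u x • X := by rw [hX, smul_smul, mul_inv_cancel₀ hu0.ne', one_smul]
  have hd1 : HasFDerivAt (fun y => u y ^ p)
      (InnerProductSpace.toDual ℝ _ ((p * u x ^ p) • X)) x := by
    have := hau.rpow_const (p := p) (Or.inl hu0.ne')
    refine this.congr_fderiv ?_
    rw [hX, smul_smul]
    simp only [map_smulₛₗ, RCLike.conj_to_real]
    congr 1
    rw [Real.rpow_sub_one hu0.ne']; field_simp
  have hd2 : HasFDerivAt (fun y => w y ^ p)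
      (InnerProductSpace.toDual ℝ _ ((p * w x ^ (p - 1)) • b)) x := by
    have := hbw.rpow_const (p := p) (Or.inr hp.le)
    refine this.congr_fderiv ?_
    simp only [map_smulₛₗ, RCLike.conj_to_real]
  have hd3 : HasFDerivAt (fun y => u y ^ p + w y ^ p)
      (InnerProductSpace.toDual ℝ _ ((2 * p * P) • Z)) x := by
    refine (hd1.add hd2).congr_fderiv ?_
    rw [← map_add]
    congr 1
    rw [mul_smul (2 * p) P Z, hPZ]
    module
  refine ⟨X, Z, haX, hPZ, grad_eq ?_, grad_eq ?_⟩
  · have h4 : HasFDerivAt (fun y => (u y ^ p + w y ^ p) / 2)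
        ((1 / 2 : ℝ) • InnerProductSpace.toDual ℝ _ ((2 * p * P) • Z)) x := by
      have := hd3.const_mul (1 / 2 : ℝ)
      refine this.congr_of_eventuallyEq (Filter.Eventually.of_forall fun y => ?_)
      ring
    have h5 := h4.rpow_const (p := 1 / p) (Or.inl hP0.ne')
    refine h5.congr_fderiv ?_
    simp only [map_smulₛₗ, RCLike.conj_to_real, smul_smul]
    congr 1
    unfold sg
    rw [← hP, Real.rpow_sub_one hP0.ne']
    field_simp
  · have hne : u x ^ p + w x ^ p ≠ 0 := by positivity
    have h4 := (hasDerivAt_inv hne).comp_hasFDerivAt x hd3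
    have h5 := hd1.mul h4
    have h6 : HasFDerivAt (th p u w) _ x := h5.congr_of_eventuallyEq
      (Filter.Eventually.of_forall fun y => by simp [th, div_eq_mul_inv])
    refine h6.congr_fderiv ?_
    simp only [map_smulₛₗ, RCLike.conj_to_real, smul_smul, map_sub, smul_sub, Function.comp]
    have e2 : P = (u x ^ p + w x ^ p) / 2 := hP
    have e : u x ^ p + w x ^ p = 2 * P := by rw [e2]; ring
    unfold th
    rw [e]
    have c1 : u x ^ p * (-((2 * P) ^ 2)⁻¹ * (2 * p * P)) = -(p * (u x ^ p / (2 * P))) := by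
      field_simp
    have c2 : (2 * P)⁻¹ * (p * u x ^ p) = p * (u x ^ p / (2 * P)) := by
      field_simp
    rw [c1, c2, neg_smul]
    abel
end

section
variable {n : ℕ} {Ω : Set (EuclideanSpace ℝ (Fin n))}
variable {μ : Measure (EuclideanSpace ℝ (Fin n))} [IsFiniteMeasure μ]
variable {p lam : ℝ} {u : EuclideanSpace ℝ (Fin n) → ℝ}

lemma HM.pw {p ε Λ : ℝ} {w : EuclideanSpace ℝ (Fin n) → ℝ} (h : HM p Ω μ ε Λ w) (hp : 1 < p) (x) :
    ‖fderiv ℝ w x‖ ^ p ≤ (ε * w x ^ 2 + ‖fderiv ℝ w x‖ ^ 2) ^ (p / 2) := by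
  rw [← zero_pow_half (w x ^ 2) (norm_nonneg (fderiv ℝ w x))]
  have := h.hε
  refine Real.rpow_le_rpow (by positivity) ?_ (by linarith)
  gcongr

lemma HM.grad_int {ε Λ : ℝ} {w : EuclideanSpace ℝ (Fin n) → ℝ} (h : HM p Ω μ ε Λ w)
    (hp : 1 < p) (hΩ : IsOpen Ω) (hμ : ∀ᵐ x ∂μ, x ∈ Ω) :
    Integrable (fun x => ‖fderiv ℝ w x‖ ^ p) μ ∧ ∫ x, ‖fderiv ℝ w x‖ ^ p ∂μ ≤ Λ := by
  have hI : Integrable (fun x => ‖fderiv ℝ w x‖ ^ p) μ := by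
    refine Integrable.mono' h.hint ?_ (Filter.Eventually.of_forall fun x => ?_)
    · exact ae_meas_of_cont hΩ hμ ((h.hw.cont_fderiv hΩ).norm.rpow_const
        (fun x _ => Or.inr (by linarith)))
    · rw [Real.norm_of_nonneg (by positivity)]
      exact h.pw hp x
  refine ⟨hI, ?_⟩
  rw [← h.heq]
  exact integral_mono hI h.hint (h.pw hp)

lemma HM.pow_int {ε Λ : ℝ} {w : EuclideanSpace ℝ (Fin n) → ℝ} (h : HM p Ω μ ε Λ w) :
    Integrable (fun x => w x ^ p) μ := by
  by_contra hh
  have := h.hnorm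
  rw [integral_undef hh] at this
  exact zero_ne_one this

lemma HS.pow_int (h : HS p Ω μ u lam) :
    Integrable (fun x => u x ^ p) μ := by
  by_contra hh
  have := h.hnorm
  rw [integral_undef hh] at this
  exact zero_ne_one this

lemma HM.Lam_nonneg {ε Λ : ℝ} {w : EuclideanSpace ℝ (Fin n) → ℝ} (h : HM p Ω μ ε Λ w) : 0 ≤ Λ := by
  rw [← h.heq]
  have := h.hε
  exact integral_nonneg fun x => by positivity

lemma HS.Lam_le (h : HS p Ω μ u lam) {δ : ℝ} (hδ : 0 < δ) : ∃ ε₀ : ℝ, 0 < ε₀ ∧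
    ∀ ε, 0 < ε → ε < ε₀ → ∀ Λ w, HM p Ω μ ε Λ w → Λ ≤ lam + δ := by
  have hp := h.hp
  obtain ⟨M, hM0, hM⟩ := h.hu.bdd h.hb
  obtain ⟨L, hL0, hL⟩ := h.huL
  have hcont : ∀ ε : ℝ, ContinuousOn (fun x => (ε * u x ^ 2 + ‖fderiv ℝ u x‖ ^ 2) ^ (p / 2)) Ω := by
    intro ε
    have h1 := h.hu.cont
    have h2 := h.hu.cont_fderiv h.hΩ
    refine ContinuousOn.rpow_const ?_ (fun _ _ => Or.inr (by linarith))
    fun_prop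
  have hbd : ∀ ε : ℝ, 0 ≤ ε → ε ≤ 1 → ∀ x ∈ Ω,
      |(ε * u x ^ 2 + ‖fderiv ℝ u x‖ ^ 2) ^ (p / 2)| ≤ (1 * M ^ 2 + L ^ 2) ^ (p / 2) := by
    intro ε h0 h1 x hx
    rw [abs_of_nonneg (by positivity), ← sq_abs (u x)]
    refine Real.rpow_le_rpow (by positivity) ?_ (by linarith)
    have := hM x (subset_closure hx)
    have := hL x hx
    gcongr
  have hlim : Filter.Tendsto (fun ε : ℝ => ∫ x, (ε * u x ^ 2 + ‖fderiv ℝ u x‖ ^ 2) ^ (p / 2) ∂μ)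
      (𝓝[>] 0) (𝓝 (∫ x, (0 * u x ^ 2 + ‖fderiv ℝ u x‖ ^ 2) ^ (p / 2) ∂μ)) := by
    have hev : ∀ᶠ ε : ℝ in 𝓝[>] 0, 0 ≤ ε ∧ ε ≤ 1 := by
      filter_upwards [Ioc_mem_nhdsGT (zero_lt_one' ℝ)] with ε hε
      exact ⟨hε.1.le, hε.2⟩
    refine tendsto_integral_filter_of_dominated_convergence
      (fun _ => (1 * M ^ 2 + L ^ 2) ^ (p / 2)) ?_ ?_ (integrable_const _) ?_
    · exact Filter.Eventually.of_forall fun ε => ae_meas_of_cont h.hΩ h.hμ (hcont ε)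
    · filter_upwards [hev] with ε hε
      filter_upwards [h.hμ] with x hx
      exact hbd ε hε.1 hε.2 x hx
    · refine Filter.Eventually.of_forall fun x => ?_
      refine Filter.Tendsto.rpow_const ?_ (Or.inr (by linarith))
      have : Filter.Tendsto (fun ε : ℝ => ε) (𝓝[>] 0) (𝓝 0) := nhdsWithin_le_nhds
      exact (this.mul_const _).add_const _
  have hle : ∫ x, (0 * u x ^ 2 + ‖fderiv ℝ u x‖ ^ 2) ^ (p / 2) ∂μ < lam + δ := by
    simp only [zero_pow_half _ (norm_nonneg _)]
    linarith [h.hen]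
  have hev := hlim.eventually (eventually_lt_nhds hle)
  rw [eventually_nhdsWithin_iff, Metric.eventually_nhds_iff] at hev
  obtain ⟨r, hr, hev⟩ := hev
  refine ⟨min r 1, by positivity, fun ε hε hεr Λ w hm => ?_⟩
  have h1 := hev (y := ε) (by rw [Real.dist_eq, sub_zero, abs_of_pos hε]; exact hεr.trans_le (min_le_left _ _)) hε
  have hi : Integrable (fun x => (ε * u x ^ 2 + ‖fderiv ℝ u x‖ ^ 2) ^ (p / 2)) μ :=
    integrable_of_bdd h.hΩ h.hμ (hcont ε) _ (hbd ε hε.le (hεr.le.trans (min_le_right _ _)))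
  have h2 := ray_adm h.hΩ h.hb h.hμ hp hε.le hm.hray h.hu hi
  have e : ∫ x, |u x| ^ p ∂μ = 1 := by
    rw [← h.hnorm]
    refine integral_congr_ae ?_
    filter_upwards [h.hμ] with x hx
    rw [abs_of_pos (h.hupos x hx)]
  rw [e, mul_one] at h2
  exact h2.trans h1.le

lemma HS.energy (h : HS p Ω μ u lam) {ε Λ : ℝ} {w : EuclideanSpace ℝ (Fin n) → ℝ}
    (hm : HM p Ω μ ε Λ w) :
    ∃ Q : EuclideanSpace ℝ (Fin n) → ℝ, Integrable Q μ ∧ ∫ x, Q x ∂μ ≤ (Λ - lam) / 2 ∧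
      ∀ x ∈ Ω, 0 ≤ Q x ∧ ∃ X Z : EuclideanSpace ℝ (Fin n), gradient u x = u x • X ∧
        gradient (th p u w) x = (p * th p u w x) • (X - Z) ∧ u x ^ p * Br p X Z ≤ 2 * Q x := by
  have hp := h.hp
  have hp0 : 0 < p := by linarith
  obtain ⟨L, hL0, hL⟩ := h.huL
  have hsa := sg_adm hp h.hu hm.hw h.hupos hm.hw0
  have hIu : Integrable (fun x => ‖fderiv ℝ u x‖ ^ p) μ := by
    refine integrable_of_bdd h.hΩ h.hμ ((h.hu.cont_fderiv h.hΩ).norm.rpow_const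
        (fun x _ => Or.inr (by linarith))) (L ^ p) (fun x hx => ?_)
    rw [abs_of_nonneg (by positivity)]
    exact Real.rpow_le_rpow (norm_nonneg _) (hL x hx) hp0.le
  obtain ⟨hIw, hwΛ⟩ := hm.grad_int hp h.hΩ h.hμ
  have key : ∀ x ∈ Ω, ∃ X Z : EuclideanSpace ℝ (Fin n), gradient u x = u x • X ∧
        gradient (th p u w) x = (p * th p u w x) • (X - Z) ∧
        ‖fderiv ℝ (sg p u w) x‖ ^ p + 1 / 2 * (u x ^ p * Br p X Z) ≤
          1 / 2 * (‖fderiv ℝ u x‖ ^ p + ‖fderiv ℝ w x‖ ^ p) := by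
    intro x hx
    have hw0 := hm.hw0 x (subset_closure hx)
    have hu0 := h.hupos x hx
    obtain ⟨X, Z, e1, e2, e3, e4⟩ := hidden_grads hp (h.hu.diffAt h.hΩ hx) (hm.hw.diffAt h.hΩ hx)
      hu0 hw0
    refine ⟨X, Z, e1, e4, ?_⟩
    have := hidden_pw hp hu0 hw0 rfl e2
    rw [← norm_grad, e3, norm_smul, Real.mul_rpow (norm_nonneg _) (norm_nonneg _)]
    have e5 : ‖sg p u w x‖ ^ p = (u x ^ p + w x ^ p) / 2 := by
      unfold sg
      rw [Real.norm_of_nonneg (by positivity), ← Real.rpow_mul (by positivity),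
        one_div_mul_cancel hp0.ne', Real.rpow_one]
    rw [e5, ← norm_grad u, ← norm_grad w, e1]
    exact this
  have hIs : Integrable (fun x => ‖fderiv ℝ (sg p u w) x‖ ^ p) μ := by
    refine Integrable.mono' ((hIu.add hIw).const_mul (1 / 2)) ?_ ?_
    · exact ae_meas_of_cont h.hΩ h.hμ ((hsa.cont_fderiv h.hΩ).norm.rpow_const
        (fun x _ => Or.inr (by linarith)))
    · filter_upwards [h.hμ] with x hx
      obtain ⟨X, Z, _, _, h3⟩ := key x hx
      have hB := Br_nonneg hp X Z
      have hu0 := h.hupos x hx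
      have : 0 ≤ u x ^ p * Br p X Z := by positivity
      rw [Real.norm_of_nonneg (by positivity)]
      simp only [Pi.add_apply]
      linarith
  refine ⟨fun x => 1 / 2 * (‖fderiv ℝ u x‖ ^ p + ‖fderiv ℝ w x‖ ^ p) -
    ‖fderiv ℝ (sg p u w) x‖ ^ p, ((hIu.add hIw).const_mul (1 / 2)).sub hIs, ?_, fun x hx => ?_⟩
  · have hr := ray_adm h.hΩ h.hb h.hμ hp le_rfl h.hray hsa
      (by simpa only [zero_pow_half _ (norm_nonneg _)] using hIs)
    simp only [zero_pow_half _ (norm_nonneg _)] at hr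
    have e : ∫ x, |sg p u w x| ^ p ∂μ = 1 := by
      have : ∫ x, |sg p u w x| ^ p ∂μ = ∫ x, 1 / 2 * (u x ^ p + w x ^ p) ∂μ := by
        refine integral_congr_ae ?_
        filter_upwards [h.hμ] with x hx
        have hw0 := hm.hw0 x (subset_closure hx)
        have hu0 := h.hupos x hx
        unfold sg
        rw [abs_of_nonneg (by positivity), ← Real.rpow_mul (by positivity),
          one_div_mul_cancel hp0.ne', Real.rpow_one]
        ring
      rw [this, integral_const_mul, integral_add h.pow_int hm.pow_int, h.hnorm, hm.hnorm]
      norm_num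
    rw [e, mul_one] at hr
    have hIa : Integrable (fun x => 1 / 2 * (‖fderiv ℝ u x‖ ^ p + ‖fderiv ℝ w x‖ ^ p)) μ :=
      (hIu.add hIw).const_mul (1 / 2)
    have e2 : ∫ x, (1 / 2 * (‖fderiv ℝ u x‖ ^ p + ‖fderiv ℝ w x‖ ^ p) -
        ‖fderiv ℝ (sg p u w) x‖ ^ p) ∂μ = 1 / 2 * (∫ x, ‖fderiv ℝ u x‖ ^ p ∂μ +
        ∫ x, ‖fderiv ℝ w x‖ ^ p ∂μ) - ∫ x, ‖fderiv ℝ (sg p u w) x‖ ^ p ∂μ := by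
      rw [integral_sub hIa hIs, integral_const_mul, integral_add hIu hIw]
    refine e2.le.trans ?_
    linarith [h.hen]
  · obtain ⟨X, Z, h1, h2, h3⟩ := key x hx
    have hB := Br_nonneg hp X Z
    have hu0 := h.hupos x hx
    have : 0 ≤ u x ^ p * Br p X Z := by positivity
    refine ⟨by linarith, X, Z, h1, h2, by linarith⟩

lemma th_mem {w : EuclideanSpace ℝ (Fin n) → ℝ} {x : EuclideanSpace ℝ (Fin n)}
    (hu0 : 0 < u x) (hw0 : 0 ≤ w x) :
    0 ≤ th p u w x ∧ th p u w x ≤ 1 := by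
  have : 0 ≤ w x ^ p := by positivity
  have : 0 < u x ^ p := by positivity
  refine ⟨by unfold th; positivity, ?_⟩
  unfold th
  rw [div_le_one (by positivity)]
  linarith

lemma HS.grad_small (h : HS p Ω μ u lam) {K : Set (EuclideanSpace ℝ (Fin n))} (hK : IsCompact K)
    (hKΩ : K ⊆ Ω) {δ : ℝ} (hδ : 0 < δ) :
    ∃ ε₀ : ℝ, 0 < ε₀ ∧ ∀ ε, 0 < ε → ε < ε₀ → ∀ Λ w, HM p Ω μ ε Λ w →
      ∫⁻ x in K, ‖fderiv ℝ (th p u w) x‖ₑ ∂μ ≤ ENNReal.ofReal δ := by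
  have hp := h.hp
  have hp0 : 0 < p := by linarith
  rcases K.eq_empty_or_nonempty with hKe | hKn
  · exact ⟨1, one_pos, fun ε _ _ Λ w _ => by simp [hKe]⟩
  obtain ⟨L, hL0, hL⟩ := h.huL
  obtain ⟨x0, hx0, hmin⟩ := hK.exists_isMinOn hKn (h.hu.cont.mono hKΩ)
  set m := u x0 with hmdef
  have hm0 : 0 < m := h.hupos x0 (hKΩ hx0)
  set A : ℝ := μ.real univ with hA
  have hA0 : 0 ≤ A := measureReal_nonneg
  set τ : ℝ := δ / (2 * p * (A + 1)) with hτ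
  have hτ0 : 0 < τ := by positivity
  obtain ⟨C, hC0, hC⟩ := Br_control (n := n) hp (R := L / m) (by positivity) hτ0
  set C' : ℝ := p * C * (2 / m ^ p) with hC'
  have hC'0 : 0 ≤ C' := by positivity
  obtain ⟨ε₀, hε₀, hΛ⟩ := h.Lam_le (δ := δ / (C' + 1)) (by positivity)
  refine ⟨ε₀, hε₀, fun ε hε hεε Λ w hm => ?_⟩
  have hΛ' := hΛ ε hε hεε Λ w hm
  obtain ⟨Q, hQi, hQ, hQx⟩ := h.energy hm
  have hpt : ∀ x ∈ K, ‖fderiv ℝ (th p u w) x‖ₑ ≤ ENNReal.ofReal (p * τ + C' * Q x) := by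
    intro x hxK
    have hx := hKΩ hxK
    obtain ⟨hQ0, X, Z, e1, e2, e3⟩ := hQx x hx
    have hu0 := h.hupos x hx
    have hw0 := hm.hw0 x (subset_closure hx)
    have hmx : m ≤ u x := hmin hxK
    have hXL : ‖X‖ ≤ L / m := by
      have h1 : u x * ‖X‖ ≤ L := by
        have := hL x hx
        rwa [← norm_grad, e1, norm_smul, Real.norm_of_nonneg hu0.le] at this
      rw [le_div_iff₀ hm0]
      calc ‖X‖ * m ≤ ‖X‖ * u x := by gcongr
        _ ≤ L := by linarith [mul_comm ‖X‖ (u x)]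
    have hB := Br_nonneg hp X Z
    have hBQ : Br p X Z ≤ 2 / m ^ p * Q x := by
      have h1 : m ^ p ≤ u x ^ p := Real.rpow_le_rpow hm0.le hmx hp0.le
      have h2 : m ^ p * Br p X Z ≤ 2 * Q x := (mul_le_mul_of_nonneg_right h1 hB).trans e3
      have h3 : 0 < m ^ p := by positivity
      rw [div_mul_eq_mul_div, le_div_iff₀ h3]
      linarith
    rw [← ofReal_norm]
    refine ENNReal.ofReal_le_ofReal ?_
    obtain ⟨t0, t1⟩ := th_mem (p := p) hu0 hw0
    rw [← norm_grad, e2, norm_smul, Real.norm_of_nonneg (by positivity)]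
    calc p * th p u w x * ‖X - Z‖ ≤ p * 1 * (τ + C * (2 / m ^ p * Q x)) := by
          have := hC X Z hXL
          have h4 : C * Br p X Z ≤ C * (2 / m ^ p * Q x) := by gcongr
          have h5 : ‖X - Z‖ ≤ τ + C * (2 / m ^ p * Q x) := by linarith
          gcongr
      _ = _ := by rw [hC']; ring
  have hI : Integrable (fun x => p * τ + C' * Q x) μ := (integrable_const _).add (hQi.const_mul _)
  calc ∫⁻ x in K, ‖fderiv ℝ (th p u w) x‖ₑ ∂μ
      ≤ ∫⁻ x in K, ENNReal.ofReal (p * τ + C' * Q x) ∂μ := setLIntegral_mono' hK.measurableSet hpt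
    _ ≤ ∫⁻ x, ENNReal.ofReal (p * τ + C' * Q x) ∂μ := setLIntegral_le_lintegral _ _
    _ = ENNReal.ofReal (∫ x, (p * τ + C' * Q x) ∂μ) := by
        rw [ofReal_integral_eq_lintegral_ofReal hI]
        filter_upwards [h.hμ] with x hx
        have := (hQx x hx).1
        show 0 ≤ _
        positivity
    _ ≤ ENNReal.ofReal δ := by
        refine ENNReal.ofReal_le_ofReal ?_
        rw [integral_add (integrable_const _) (hQi.const_mul _), integral_const, integral_const_mul]
        have h1 : A * (p * τ) ≤ δ / 2 := by
          have : A * (p * τ) = δ / 2 * (A / (A + 1)) := by rw [hτ]; field_simp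
          rw [this]
          refine mul_le_of_le_one_right (by positivity) ?_
          rw [div_le_one (by positivity)]; linarith
        have h2 : C' * ∫ x, Q x ∂μ ≤ δ / 2 := by
          calc C' * ∫ x, Q x ∂μ ≤ C' * ((δ / (C' + 1)) / 2) := by
                gcongr; linarith
            _ = δ / 2 * (C' / (C' + 1)) := by field_simp
            _ ≤ _ := by
              refine mul_le_of_le_one_right (by positivity) ?_
              rw [div_le_one (by positivity)]; linarith
        rw [smul_eq_mul]
        linarith
end

section
variable {n : ℕ} {Ω : Set (EuclideanSpace ℝ (Fin n))} {μ : Measure (EuclideanSpace ℝ (Fin n))}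
  [IsFiniteMeasure μ] {p lam : ℝ} {u : EuclideanSpace ℝ (Fin n) → ℝ}

lemma add_pow_le2 {a b p : ℝ} (ha : 0 ≤ a) (hb : 0 ≤ b) (hp : 0 ≤ p) :
    (a + b) ^ p ≤ 2 ^ p * (a ^ p + b ^ p) := by
  have h1 : 0 ≤ a ^ p := by positivity
  have h2 : 0 ≤ b ^ p := by positivity
  rcases le_total a b with h | h
  · calc (a + b) ^ p ≤ (2 * b) ^ p := Real.rpow_le_rpow (by positivity) (by linarith) hp
      _ = 2 ^ p * b ^ p := Real.mul_rpow (by norm_num) hb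
      _ ≤ _ := by gcongr; linarith
  · calc (a + b) ^ p ≤ (2 * a) ^ p := Real.rpow_le_rpow (by positivity) (by linarith) hp
      _ = 2 ^ p * a ^ p := Real.mul_rpow (by norm_num) ha
      _ ≤ _ := by gcongr; linarith

lemma HS.ui (h : HS p Ω μ u lam) : ∃ C : ℝ, 0 ≤ C ∧ ∀ ε Λ w, HM p Ω μ ε Λ w → Λ ≤ lam + 1 →
    ∀ B : Set (EuclideanSpace ℝ (Fin n)), ∫ x in B, w x ^ p ∂μ ≤
      C * ((μ.real B) ^ (1 / (n : ℝ)) + μ.real B) := by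
  have hp := h.hp
  have hlam := h.hlam
  obtain ⟨a, b, hμv, hvμ⟩ := h.hab
  obtain ⟨C, hC0, hC⟩ := gns_p (μ := μ) h.hn h.hΩ hμv hvμ hp
  refine ⟨2 ^ p * (C * (lam + 2) + 2 ^ p), by positivity, fun ε Λ w hm hΛ B => ?_⟩
  obtain ⟨f, hf, hfc, hfs, hfe⟩ := trunc_props h.hΩ h.hb hm.hw one_pos one_pos
  obtain ⟨M, hM0, hM⟩ := c1c_bound hf hfc
  have hfI : Integrable (fun x => |f x| ^ p) μ := by
    refine integrable_of_bdd h.hΩ h.hμ ?_ (M ^ p) ?_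
    · exact (hf.continuous.abs.rpow_const (fun x => Or.inr (by linarith))).continuousOn
    · intro x _
      rw [abs_of_nonneg (by positivity)]
      exact Real.rpow_le_rpow (abs_nonneg _) (hM x).1 (by linarith)
  have h1 : ∫ x, |f x| ^ p ∂μ ≤ 1 := by
    rw [← hm.hnorm]
    refine integral_mono_ae hfI hm.pow_int ?_
    filter_upwards [h.hμ] with x hx
    have h0 := hm.hw0 x (subset_closure hx)
    refine Real.rpow_le_rpow (abs_nonneg _) ?_ (by linarith)
    rw [(hfe x hx).1]
    have := Sf_le (k := 1) (r := 1) one_pos zero_le_one (w x)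
    rwa [abs_of_nonneg h0] at this
  have h2 : ∫ x, ‖fderiv ℝ f x‖ ^ p ∂μ ≤ lam + 1 := by
    refine le_trans ?_ ((hm.grad_int hp h.hΩ h.hμ).2.trans hΛ)
    refine integral_mono_of_nonneg (Filter.Eventually.of_forall fun x => by positivity)
      (hm.grad_int hp h.hΩ h.hμ).1 ?_
    filter_upwards [h.hμ] with x hx
    refine Real.rpow_le_rpow (by positivity) ?_ (by linarith)
    have := Sd_mem (k := 1) (r := 1) one_pos zero_le_one (w x)
    rw [(hfe x hx).2, norm_smul, Real.norm_of_nonneg this.1]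
    exact mul_le_of_le_one_left (norm_nonneg _) this.2
  have h3 := hC f hf hfc hfs B
  have h4 : ∫ x in B, w x ^ p ∂μ ≤ ∫ x in B, 2 ^ p * (|f x| ^ p + 2 ^ p) ∂μ := by
    refine integral_mono_ae hm.pow_int.integrableOn ?_ ?_
    · exact ((hfI.add (integrable_const _)).const_mul _).integrableOn
    · refine ae_restrict_of_ae ?_
      filter_upwards [h.hμ] with x hx
      have h0 := hm.hw0 x (subset_closure hx)
      have := Sf_ge (k := 1) (r := 1) one_pos zero_le_one (w x)
      rw [abs_of_nonneg h0, ← (hfe x hx).1] at this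
      refine le_trans (Real.rpow_le_rpow h0 (by linarith : w x ≤ |f x| + 2) (by linarith)) ?_
      exact add_pow_le2 (abs_nonneg _) (by norm_num) (by linarith)
  have h5 : ∫ x in B, 2 ^ p * (|f x| ^ p + 2 ^ p) ∂μ =
      2 ^ p * (∫ x in B, |f x| ^ p ∂μ + 2 ^ p * μ.real B) := by
    rw [integral_const_mul, integral_add hfI.integrableOn (integrable_const _)]
    simp [mul_comm]
  rw [h5] at h4
  refine h4.trans ?_
  set m := (μ.real B) ^ (1 / (n : ℝ)) with hmm
  have hm0 : 0 ≤ m := by positivity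
  have hB0 : 0 ≤ μ.real B := measureReal_nonneg
  have h6 : ∫ x in B, |f x| ^ p ∂μ ≤ C * m * (lam + 2) :=
    h3.trans (mul_le_mul_of_nonneg_left (by linarith) (by positivity))
  have h2p : (0:ℝ) ≤ 2 ^ p := by positivity
  rw [mul_assoc]
  refine mul_le_mul_of_nonneg_left ?_ h2p
  have : 0 ≤ C * (lam + 2) * μ.real B := by positivity
  have : 0 ≤ 2 ^ p * m := by positivity
  nlinarith

lemma cvx_exh {E : Type*} [NormedAddCommGroup E] [NormedSpace ℝ E] [FiniteDimensional ℝ E]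
    {Ω K : Set E} (hΩ : IsOpen Ω) (hc : Convex ℝ Ω) (hK : IsCompact K) (hKΩ : K ⊆ Ω) :
    ∃ K', IsCompact K' ∧ Convex ℝ K' ∧ K ⊆ K' ∧ K' ⊆ Ω := by
  have hex : ∀ x ∈ Ω, ∃ t : Set E, t.Finite ∧ convexHull ℝ t ∈ 𝓝 x ∧ convexHull ℝ t ⊆ Ω := by
    intro x hx
    obtain ⟨t, h1, h2⟩ :=
      (convex_singleton (𝕜 := ℝ) x).exists_subset_interior_convexHull_finset_of_isCompact
        isCompact_singleton (t := Ω) (by rw [nhdsSet_singleton]; exact hΩ.mem_nhds hx)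
    exact ⟨t, t.finite_toSet, mem_interior_iff_mem_nhds.1 (h1 rfl), h2⟩
  choose! t ht0 ht1 ht2 using hex
  obtain ⟨T, hTs, hT⟩ := hK.elim_nhds_subcover (fun x => convexHull ℝ (t x))
    (fun x hx => ht1 x (hKΩ hx))
  have hfin : (⋃ x ∈ T, t x).Finite :=
    T.finite_toSet.biUnion (fun x hx => ht0 x (hKΩ (hTs x hx)))
  refine ⟨convexHull ℝ (⋃ x ∈ T, t x), hfin.isCompact_convexHull ℝ, convex_convexHull ℝ _, ?_, ?_⟩
  · refine hT.trans (iUnion₂_subset fun x hx => convexHull_mono ?_)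
    exact subset_biUnion_of_mem (u := t) hx
  · refine convexHull_min (iUnion₂_subset fun x hx => ?_) hc
    exact (subset_convexHull ℝ _).trans (ht2 x (hKΩ (hTs x hx)))

lemma HS.exhaust (h : HS p Ω μ u lam) {κ : ℝ} (hκ : 0 < κ) :
    ∃ K, IsCompact K ∧ Convex ℝ K ∧ K ⊆ Ω ∧ volume K ≠ 0 ∧ μ.real Kᶜ ≤ κ := by
  obtain ⟨x0, hx0⟩ := h.hne
  obtain ⟨r, hr, hrΩ⟩ := Metric.nhds_basis_closedBall.mem_iff.1 (h.hΩ.mem_nhds hx0)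
  obtain ⟨K0, hK0Ω, hK0, hK0m⟩ := h.hΩ.measurableSet.exists_isCompact_sdiff_lt (μ := μ)
    (measure_ne_top μ Ω) (ENNReal.ofReal_pos.2 hκ).ne'
  obtain ⟨K, hK1, hK2, hsub, hKΩ⟩ := cvx_exh h.hΩ h.hc (hK0.union (isCompact_closedBall x0 r))
    (union_subset hK0Ω hrΩ)
  refine ⟨K, hK1, hK2, hKΩ, ?_, ?_⟩
  · have h1 : 0 < volume (closedBall x0 r) := measure_closedBall_pos _ _ hr
    exact (h1.trans_le (measure_mono (subset_union_right.trans hsub))).ne'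
  · have h1 : μ Kᶜ ≤ μ (Ω \ K0) := by
      refine measure_mono_ae ?_
      filter_upwards [h.hμ] with x hx hxK
      exact ⟨hx, fun hxK0 => hxK (hsub (Or.inl hxK0))⟩
    exact ENNReal.toReal_le_of_le_ofReal hκ.le (h1.trans hK0m.le)

lemma th_sep {p U W k0 M : ℝ} (hp : 1 < p) (hU : 0 < U) (hW : 0 ≤ W) (hk : 0 < k0)
    (hM : U ≤ M) (h : k0 < |W - U|) :
    (k0 / M) / (2 * (2 + k0 / M)) ≤ |U ^ p / (U ^ p + W ^ p) - 1 / 2| := by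
  have hM0 : 0 < M := by linarith
  set q := k0 / M with hq
  have hq0 : 0 < q := by positivity
  have hqU : q * U ≤ k0 := by
    rw [hq, div_mul_eq_mul_div, div_le_iff₀ hM0]; nlinarith
  have hA : 0 < U ^ p := by positivity
  have hB : 0 ≤ W ^ p := by positivity
  set A := U ^ p
  set B := W ^ p
  have e : A / (A + B) - 1 / 2 = (A - B) / (2 * (A + B)) := by field_simp; ring
  rw [e, abs_div, abs_of_pos (by positivity : 0 < 2 * (A + B)), div_le_div_iff₀ (by positivity) (by positivity)]
  rcases le_total U W with hUW | hUW
  · rw [abs_of_nonneg (by linarith)] at h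
    have h1 : (1 + q) * A ≤ B := by
      calc (1 + q) * A ≤ (1 + q) ^ p * A := by
            gcongr
            exact Real.self_le_rpow_of_one_le (by linarith) hp.le
        _ = ((1 + q) * U) ^ p := (Real.mul_rpow (by positivity) hU.le).symm
        _ ≤ _ := Real.rpow_le_rpow (by positivity) (by linarith) (by linarith)
    rw [abs_of_nonpos (by nlinarith)]
    nlinarith
  · rw [abs_of_nonpos (by linarith)] at h
    have hWq : W ≤ (1 - q) * U := by linarith
    have hq1 : 0 ≤ 1 - q := by
      by_contra hh
      nlinarith
    have h1 : B ≤ (1 - q) * A := by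
      calc B ≤ ((1 - q) * U) ^ p := Real.rpow_le_rpow hW hWq (by linarith)
        _ = (1 - q) ^ p * A := Real.mul_rpow hq1 hU.le
        _ ≤ _ := by
            gcongr
            exact Real.rpow_le_self_of_le_one hq1 (by linarith) hp.le
    have h2 : B ≤ A := by nlinarith
    have h3 := mul_le_mul_of_nonneg_left h2 hq0.le
    rw [abs_of_nonneg (by linarith)]
    linarith
end

section
variable {n : ℕ} {Ω : Set (EuclideanSpace ℝ (Fin n))} {μ : Measure (EuclideanSpace ℝ (Fin n))}
  [IsFiniteMeasure μ] {p lam : ℝ} {u : EuclideanSpace ℝ (Fin n) → ℝ}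

lemma small_m {n : ℕ} (hn : 2 ≤ n) {A C c κ : ℝ} (hc : 0 < c) (hκ : 0 < κ) :
    ∃ m : ℝ, 0 < m ∧ m ≤ κ ∧ A * m + C * (m ^ (1 / (n : ℝ)) + m) ≤ c := by
  have hn0 : (0:ℝ) < n := by exact_mod_cast (by omega : 0 < n)
  have hcont : ContinuousAt (fun m : ℝ => A * m + C * (m ^ (1 / (n : ℝ)) + m)) 0 := by
    have : ContinuousAt (fun m : ℝ => m ^ (1 / (n : ℝ))) 0 :=
      Real.continuousAt_rpow_const _ _ (Or.inr (by positivity))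
    fun_prop
  have h0 : (fun m : ℝ => A * m + C * (m ^ (1 / (n : ℝ)) + m)) 0 < c := by
    have : (0:ℝ) ^ (1 / (n : ℝ)) = 0 := Real.zero_rpow (by positivity)
    show A * 0 + C * ((0:ℝ) ^ (1 / (n : ℝ)) + 0) < c
    rw [this]; simpa using hc
  have h1 := hcont.eventually_lt continuousAt_const h0
  have h2 : ∀ᶠ m : ℝ in 𝓝[>] 0, A * m + C * (m ^ (1 / (n : ℝ)) + m) < c :=
    h1.filter_mono nhdsWithin_le_nhds
  have h3 : ∀ᶠ m : ℝ in 𝓝[>] 0, m ∈ Ioc 0 κ := Ioc_mem_nhdsGT hκ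
  obtain ⟨m, hm, hm'⟩ := (h2.and h3).exists
  exact ⟨m, hm'.1, hm'.2, hm.le⟩

lemma HS.conc (h : HS p Ω μ u lam) {K : Set (EuclideanSpace ℝ (Fin n))} (hK : IsCompact K)
    (hKc : Convex ℝ K) (hKΩ : K ⊆ Ω) (hK0 : volume K ≠ 0) {τ σ : ℝ} (hτ : 0 < τ) (hσ : 0 < σ) :
    ∃ ε₀ : ℝ, 0 < ε₀ ∧ ∀ ε, 0 < ε → ε < ε₀ → ∀ Λ w, HM p Ω μ ε Λ w →
      ∃ y ∈ K, μ.real {x ∈ K | τ ≤ |th p u w x - th p u w y|} ≤ σ := by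
  obtain ⟨a, b, hμv, hvμ⟩ := h.hab
  obtain ⟨C, hC⟩ := poincare h.hΩ hKc hK hK0 hKΩ
  set δ : ℝ := τ * σ / ((a * C * b : ℝ≥0) + 1 : ℝ) with hδ
  have hδ0 : 0 < δ := by positivity
  obtain ⟨ε₀, hε₀, H⟩ := h.grad_small hK hKΩ hδ0
  refine ⟨ε₀, hε₀, fun ε h1 h2 Λ w hm => ?_⟩
  have hth := th_c1 h.hp h.hu hm.hw h.hupos hm.hw0
  obtain ⟨y, hy, hyC⟩ := hC _ hth
  refine ⟨y, hy, ?_⟩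
  have hg := H ε h1 h2 Λ w hm
  have e1 : ∫⁻ x in K, ‖th p u w x - th p u w y‖ₑ ∂μ ≤
      a * ∫⁻ x in K, ‖th p u w x - th p u w y‖ₑ := by
    rw [← smul_eq_mul, ← lintegral_smul_measure, ← Measure.restrict_smul]
    exact lintegral_mono' (Measure.restrict_mono subset_rfl hμv) le_rfl
  have e2 : ∫⁻ x in K, ‖fderiv ℝ (th p u w) x‖ₑ ≤ b * ∫⁻ x in K, ‖fderiv ℝ (th p u w) x‖ₑ ∂μ := by
    rw [← smul_eq_mul, ← lintegral_smul_measure, ← Measure.restrict_smul]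
    refine lintegral_mono' ?_ le_rfl
    have := Measure.restrict_mono (s := K) subset_rfl hvμ
    rwa [Measure.restrict_restrict hK.measurableSet, inter_eq_left.2 hKΩ] at this
  have e3 : ∫⁻ x in K, ‖th p u w x - th p u w y‖ₑ ∂μ ≤ ENNReal.ofReal (τ * σ) := by
    calc _ ≤ a * (C * (b * ENNReal.ofReal δ)) := by
          refine e1.trans ?_
          gcongr
          refine hyC.trans ?_
          gcongr
          refine e2.trans ?_
          gcongr
      _ = ENNReal.ofReal ((a * C * b : ℝ≥0) * δ) := by
          rw [ENNReal.ofReal_mul (NNReal.coe_nonneg _), ENNReal.ofReal_coe_nnreal]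
          push_cast; ring
      _ ≤ _ := by
          refine ENNReal.ofReal_le_ofReal ?_
          rw [hδ, mul_div_assoc', div_le_iff₀ (by positivity)]
          have : 0 < τ * σ := by positivity
          nlinarith
  have hcont : ContinuousOn (fun x => th p u w x - th p u w y) K :=
    (hth.continuousOn.mono hKΩ).sub continuousOn_const
  have hm1 : AEMeasurable (fun x => ‖th p u w x - th p u w y‖ₑ) (μ.restrict K) := by
    have := (hcont.aestronglyMeasurable (μ := μ) hK.measurableSet)
    exact this.enorm
  have e4 := mul_meas_ge_le_lintegral₀ hm1 (ENNReal.ofReal τ)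
  have e5 : {x ∈ K | τ ≤ |th p u w x - th p u w y|} =
      K ∩ {x | ENNReal.ofReal τ ≤ ‖th p u w x - th p u w y‖ₑ} := by
    ext x
    simp only [mem_inter_iff, mem_ofPred_eq]
    rw [← Real.norm_eq_abs, ← ofReal_norm, ENNReal.ofReal_le_ofReal_iff (norm_nonneg _)]
  have hKm := hK.measurableSet
  have e6 : μ.restrict K {x | ENNReal.ofReal τ ≤ ‖th p u w x - th p u w y‖ₑ} =
      μ {x ∈ K | τ ≤ |th p u w x - th p u w y|} := by
    rw [e5, Measure.restrict_apply' hKm, inter_comm]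
  rw [e6] at e4
  have e7 := e4.trans e3
  rw [ENNReal.ofReal_mul hτ.le] at e7
  refine ENNReal.toReal_le_of_le_ofReal hσ.le ?_
  exact (ENNReal.mul_le_mul_iff_right (ENNReal.ofReal_pos.2 hτ).ne' ENNReal.ofReal_ne_top).1 e7

lemma HS.conv_meas (h : HS p Ω μ u lam) {k0 κ : ℝ} (hk : 0 < k0) (hκ : 0 < κ) :
    ∃ ε₀ : ℝ, 0 < ε₀ ∧ ∀ ε, 0 < ε → ε < ε₀ → ∀ Λ w, HM p Ω μ ε Λ w →
      μ.real {x | x ∈ Ω ∧ k0 < |w x - u x|} ≤ κ := by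
  have hp := h.hp
  obtain ⟨M0, hM00, hM0⟩ := h.hu.bdd h.hb
  set M := M0 + 1 with hMd
  have hM : 0 < M := by positivity
  set c := (k0 / M) / (2 * (2 + k0 / M)) with hc
  have hc0 : 0 < c := by positivity
  obtain ⟨C, hC0, hC⟩ := h.ui
  obtain ⟨m, hm0, hmκ, hmc⟩ := small_m (A := M ^ p) (C := C) h.hn (by positivity : 0 < c / 4) hκ
  obtain ⟨K, hK, hKc, hKΩ, hKv, hKm⟩ := h.exhaust (by positivity : 0 < m / 2)
  obtain ⟨ε1, hε1, H1⟩ := h.Lam_le one_pos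
  obtain ⟨ε2, hε2, H2⟩ := h.conc hK hKc hKΩ hKv (by positivity : 0 < c / 8) (by positivity : 0 < m / 2)
  refine ⟨min ε1 ε2, lt_min hε1 hε2, fun ε he0 he Λ w hw => ?_⟩
  have hΛ := H1 ε he0 (he.trans_le (min_le_left _ _)) Λ w hw
  obtain ⟨y, hyK, hy⟩ := H2 ε he0 (he.trans_le (min_le_right _ _)) Λ w hw
  set θ := th p u w with hθ
  set B := Kᶜ ∪ {x ∈ K | c / 8 ≤ |θ x - θ y|} with hB
  have hBm : μ.real B ≤ m := by
    refine (measureReal_union_le _ _).trans ?_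
    linarith
  have hth : ContinuousOn θ K := (th_c1 h.hp h.hu hw.hw h.hupos hw.hw0).continuousOn.mono hKΩ
  have hBme : MeasurableSet B := by
    refine hK.measurableSet.compl.union ?_
    exact ((hth.sub continuousOn_const).abs.preimage_isClosed_of_isClosed hK.isClosed
      isClosed_Ici).measurableSet
  set g : EuclideanSpace ℝ (Fin n) → ℝ := fun x => u x ^ p + w x ^ p with hg
  have hgI : Integrable g μ := h.pow_int.add hw.pow_int
  have hg2 : ∫ x, g x ∂μ = 2 := by
    rw [hg, integral_add h.pow_int hw.pow_int, h.hnorm, hw.hnorm]; norm_num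
  have hω : ∫ x in B, g x ∂μ ≤ c / 4 := by
    have e1 : ∫ x in B, g x ∂μ = ∫ x in B, u x ^ p ∂μ + ∫ x in B, w x ^ p ∂μ :=
      integral_add h.pow_int.integrableOn hw.pow_int.integrableOn
    have e2 : ∫ x in B, u x ^ p ∂μ ≤ M ^ p * μ.real B := by
      calc _ ≤ ∫ x in B, M ^ p ∂μ := by
            refine integral_mono_ae h.pow_int.integrableOn (integrable_const _) ?_
            refine ae_restrict_of_ae ?_
            filter_upwards [h.hμ] with x hx
            refine Real.rpow_le_rpow (h.hupos x hx).le ?_ (by linarith)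
            have := (le_abs_self _).trans (hM0 x (subset_closure hx))
            linarith
        _ = _ := by simp [mul_comm]
    have e3 := hC ε Λ w hw hΛ B
    have e4 : M ^ p * μ.real B ≤ M ^ p * m := by gcongr
    have e5 : C * ((μ.real B) ^ (1 / (n : ℝ)) + μ.real B) ≤ C * (m ^ (1 / (n : ℝ)) + m) := by
      gcongr
    linarith
  have hθy := th_mem (p := p) (h.hupos y (hKΩ hyK)) (hw.hw0 y (subset_closure (hKΩ hyK)))
  have hid : ∫ x, ((2 * θ y - 1) * g x - (u x ^ p - w x ^ p)) ∂μ = 2 * (2 * θ y - 1) := by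
    have hI1 : Integrable (fun x => (2 * θ y - 1) * g x) μ := hgI.const_mul _
    have hI2 : Integrable (fun x => u x ^ p - w x ^ p) μ := h.pow_int.sub hw.pow_int
    rw [integral_sub hI1 hI2, integral_const_mul, hg2, integral_sub h.pow_int hw.pow_int, h.hnorm,
      hw.hnorm]
    ring
  have hI3 : Integrable (fun x => c / 4 * g x + 2 * B.indicator g x) μ :=
    (hgI.const_mul _).add ((hgI.indicator hBme).const_mul _)
  have hbd : |2 * (2 * θ y - 1)| ≤ c / 2 + 2 * (c / 4) := by
    rw [← hid, ← Real.norm_eq_abs]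
    refine (norm_integral_le_of_norm_le hI3 ?_).trans ?_
    · filter_upwards [h.hμ] with x hx
      have hu0 := h.hupos x hx
      have hw0 := hw.hw0 x (subset_closure hx)
      have hg0 : 0 < g x := by
        have : 0 < u x ^ p := by positivity
        have : 0 ≤ w x ^ p := by positivity
        simp only [hg]; linarith
      have hθx := th_mem (p := p) hu0 hw0
      have e : (2 * θ y - 1) * g x - (u x ^ p - w x ^ p) = 2 * (θ y - θ x) * g x := by
        have : θ x * g x = u x ^ p := by
          simp only [hθ, th]; exact div_mul_cancel₀ _ hg0.ne'
        have e2 : w x ^ p = g x - u x ^ p := by simp [hg]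
        rw [e2]; linarith
      rw [e, Real.norm_eq_abs, abs_mul, abs_mul, abs_two, abs_of_pos hg0]
      by_cases hxB : x ∈ B
      · rw [indicator_of_mem hxB]
        have : |θ y - θ x| ≤ 1 := by
          rw [abs_le]; constructor <;> linarith [hθx.1, hθx.2, hθy.1, hθy.2]
        have : 0 ≤ c / 4 * g x := by positivity
        nlinarith
      · rw [indicator_of_notMem hxB]
        have hxK : x ∈ K := by
          by_contra hh; exact hxB (Or.inl hh)
        have : |θ y - θ x| ≤ c / 8 := by
          rw [abs_sub_comm]
          by_contra hh
          exact hxB (Or.inr ⟨hxK, (not_le.1 hh).le⟩)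
        nlinarith
    · have hI1 : Integrable (fun x => c / 4 * g x) μ := hgI.const_mul _
      have hI2 : Integrable (fun x => 2 * B.indicator g x) μ := (hgI.indicator hBme).const_mul _
      rw [integral_add hI1 hI2, integral_const_mul, integral_const_mul, hg2,
        integral_indicator hBme]
      linarith
  refine le_trans (measureReal_mono ?_) (hBm.trans hmκ)
  rintro x ⟨hx, hxk⟩
  by_contra hxB
  have hxK : x ∈ K := by
    by_contra hh; exact hxB (Or.inl hh)
  have h1 : |θ x - θ y| ≤ c / 8 := by
    by_contra hh
    exact hxB (Or.inr ⟨hxK, (not_le.1 hh).le⟩)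
  have huM : u x ≤ M := by
    have := (le_abs_self _).trans (hM0 x (subset_closure hx))
    linarith
  have h2 : c ≤ |θ x - 1 / 2| :=
    th_sep hp (h.hupos x hx) (hw.hw0 x (subset_closure hx)) hk huM hxk
  rw [abs_le] at h1 hbd
  have h3 : |θ x - 1 / 2| ≤ c / 2 := by
    rw [abs_le]; constructor <;> linarith [h1.1, h1.2, hbd.1, hbd.2]
  linarith
end

section
variable {n : ℕ} {Ω : Set (EuclideanSpace ℝ (Fin n))} {μ : Measure (EuclideanSpace ℝ (Fin n))}
  [IsFiniteMeasure μ] {p lam : ℝ} {u : EuclideanSpace ℝ (Fin n) → ℝ}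

lemma phi_cpx {ε a x p : ℝ} (hε : 0 ≤ ε) :
    (ε * a ^ 2 + x ^ 2) ^ (p / 2) = ‖(⟨√ε * a, x⟩ : ℂ)‖ ^ p := by
  have h : ε * a ^ 2 + x ^ 2 = ‖(⟨√ε * a, x⟩ : ℂ)‖ ^ 2 := by
    rw [Complex.sq_norm, Complex.normSq_mk]
    have := Real.mul_self_sqrt hε
    nlinarith
  rw [h, ← Real.rpow_natCast, ← Real.rpow_mul (norm_nonneg _)]
  congr 1; push_cast; ring

lemma conv_pw {E : Type*} [NormedAddCommGroup E] [NormedSpace ℝ E] {ε a b p s : ℝ} (hε : 0 ≤ ε)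
    (hp : 1 < p) (hs0 : 0 ≤ s) (hs1 : s ≤ 1) (X Y : E) :
    (ε * ((1 - s) * a + s * b) ^ 2 + ‖(1 - s) • X + s • Y‖ ^ 2) ^ (p / 2) ≤
      (1 - s) * (ε * a ^ 2 + ‖X‖ ^ 2) ^ (p / 2) + s * (ε * b ^ 2 + ‖Y‖ ^ 2) ^ (p / 2) := by
  have hz : ‖(1 - s) • X + s • Y‖ ≤ (1 - s) * ‖X‖ + s * ‖Y‖ := by
    refine (norm_add_le _ _).trans ?_
    rw [norm_smul, norm_smul, Real.norm_of_nonneg hs0, Real.norm_of_nonneg (by linarith)]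
  calc _ ≤ (ε * ((1 - s) * a + s * b) ^ 2 + ((1 - s) * ‖X‖ + s * ‖Y‖) ^ 2) ^ (p / 2) := by
        refine Real.rpow_le_rpow (by positivity) ?_ (by linarith)
        gcongr
    _ ≤ _ := by
        rw [phi_cpx hε, phi_cpx hε, phi_cpx hε]
        have e : (⟨√ε * ((1 - s) * a + s * b), (1 - s) * ‖X‖ + s * ‖Y‖⟩ : ℂ) =
            (1 - s) • (⟨√ε * a, ‖X‖⟩ : ℂ) + s • (⟨√ε * b, ‖Y‖⟩ : ℂ) := by
          apply Complex.ext <;> simp <;> ring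
        rw [e]
        have h1 : ‖(1 - s) • (⟨√ε * a, ‖X‖⟩ : ℂ) + s • (⟨√ε * b, ‖Y‖⟩ : ℂ)‖ ≤
            (1 - s) * ‖(⟨√ε * a, ‖X‖⟩ : ℂ)‖ + s * ‖(⟨√ε * b, ‖Y‖⟩ : ℂ)‖ := by
          refine (norm_add_le _ _).trans ?_
          rw [norm_smul, norm_smul, Real.norm_of_nonneg hs0, Real.norm_of_nonneg (by linarith)]
        refine (Real.rpow_le_rpow (norm_nonneg _) h1 (by linarith)).trans ?_
        have := (convexOn_rpow hp.le).2 (mem_Ici.2 (norm_nonneg (⟨√ε * a, ‖X‖⟩ : ℂ)))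
          (mem_Ici.2 (norm_nonneg (⟨√ε * b, ‖Y‖⟩ : ℂ))) (by linarith : 0 ≤ 1 - s) hs0 (by ring)
        simpa using this

lemma phi_le {ε c W M L x p : ℝ} (hp : 1 < p) (hε : 0 ≤ ε) (hε1 : ε ≤ 1) (hc0 : 0 ≤ c)
    (hcW : c ≤ W + M) (hW : 0 ≤ W) (hM : 0 ≤ M) (hx0 : 0 ≤ x) (hx : x ≤ L) :
    (ε * c ^ 2 + x ^ 2) ^ (p / 2) ≤ 2 ^ p * (W ^ p + (M + L) ^ p) := by
  have hL : 0 ≤ L := hx0.trans hx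
  refine le_trans ?_ (add_pow_le2 hW (by positivity) (by linarith))
  have e := zero_pow_half (p := p) 0 (by positivity : 0 ≤ W + (M + L))
  rw [← e]
  refine Real.rpow_le_rpow (by positivity) ?_ (by linarith)
  have h1 : ε * c ^ 2 ≤ (W + M) ^ 2 := by
    have : c ^ 2 ≤ (W + M) ^ 2 := by gcongr
    nlinarith [sq_nonneg c]
  have h2 : x ^ 2 ≤ L ^ 2 := by gcongr
  nlinarith [mul_nonneg (add_nonneg hW hM) hL]

lemma HS.level_energy (h : HS p Ω μ u lam) : ∃ C : ℝ, 0 ≤ C ∧ ∀ ε Λ w, HM p Ω μ ε Λ w → ε ≤ 1 →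
    Λ ≤ lam + 1 → ∀ k r, 0 < k → 0 < r → ∀ f : EuclideanSpace ℝ (Fin n) → ℝ,
    (∀ x ∈ Ω, fderiv ℝ f x =
      Sd k r (w x - u x) • fderiv ℝ (fun y => w y - u y) x) →
    ∫ x, ‖fderiv ℝ f x‖ ^ p ∂μ ≤
      C * ∫ x in {x | x ∈ Ω ∧ k < |w x - u x|}, (1 + w x ^ p) ∂μ := by
  have hp := h.hp
  have hlam := h.hlam
  obtain ⟨M, hM0, hM⟩ := h.hu.bdd h.hb
  obtain ⟨L, hL0, hL⟩ := h.huL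
  set C : ℝ := 2 ^ p * (lam + 1) + 2 ^ p * (2 ^ p * (1 + (M + L) ^ p)) + 2 ^ p * L ^ p with hCdef
  refine ⟨C, by positivity, fun ε Λ w hm hε1 hΛ k r hk hr f hf => ?_⟩
  have hε := hm.hε
  have hΛ0 := hm.Lam_nonneg
  have hd : Adm Ω (fun x => w x - u x) := hm.hw.sub h.hu
  have hv : Adm Ω (fun x => w x - Sf k r (w x - u x)) := hm.hw.sub (hd.comp hk.le hr)
  set d : EuclideanSpace ℝ (Fin n) → ℝ := fun x => w x - u x with hddef
  set v : EuclideanSpace ℝ (Fin n) → ℝ := fun x => w x - Sf k r (w x - u x) with hvdef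
  set A : Set (EuclideanSpace ℝ (Fin n)) := {x | x ∈ Ω ∧ k < |w x - u x|} with hA
  have hAo : IsOpen A := by
    have := hd.cont.abs.isOpen_inter_preimage h.hΩ (isOpen_Ioi (a := k))
    exact this
  have hAm := hAo.measurableSet
  set Φ : EuclideanSpace ℝ (Fin n) → ℝ := fun x => (ε * w x ^ 2 + ‖fderiv ℝ w x‖ ^ 2) ^ (p / 2) with hΦ
  set Ψ : EuclideanSpace ℝ (Fin n) → ℝ := fun x => (ε * v x ^ 2 + ‖fderiv ℝ v x‖ ^ 2) ^ (p / 2) with hΨ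
  -- pointwise
  have key : ∀ x ∈ Ω, Ψ x ≤ (1 - Sd k r (d x)) * Φ x +
      Sd k r (d x) * (2 ^ p * (w x ^ p + (M + L) ^ p)) := by
    intro x hx
    have hu0 := (h.hupos x hx).le
    have hw0 := hm.hw0 x (subset_closure hx)
    obtain ⟨c, hc0, hc1, hc⟩ := Sf_fac hr hk.le (d x)
    have hs := Sd_mem hr hk.le (d x)
    have huM := (le_abs_self _).trans (hM x (subset_closure hx))
    set s := Sd k r (d x) with hsd
    have e1 : v x = (1 - s) * w x + s * (w x - c * d x) := by
      show w x - Sf k r (d x) = _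
      rw [hc]; ring
    have e2 : fderiv ℝ v x = (1 - s) • fderiv ℝ w x + s • fderiv ℝ u x := by
      have hD := (hm.hw.diffAt h.hΩ hx)
      have hDu := (h.hu.diffAt h.hΩ hx)
      have hDs := ((hd.comp hk.le hr).diffAt h.hΩ hx)
      have a1 : fderiv ℝ v x = fderiv ℝ w x - fderiv ℝ (fun x => Sf k r (d x)) x :=
        fderiv_fun_sub hD hDs
      have a2 : fderiv ℝ d x = fderiv ℝ w x - fderiv ℝ u x := fderiv_fun_sub hD hDu
      rw [a1, fderiv_Sf h.hΩ hd hr hx, a2, ← hsd]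
      module
    have h1 := conv_pw (a := w x) (b := w x - c * d x) hε.le hp hs.1 hs.2 (fderiv ℝ w x) (fderiv ℝ u x)
    have h2 : (ε * (w x - c * d x) ^ 2 + ‖fderiv ℝ u x‖ ^ 2) ^ (p / 2) ≤
        2 ^ p * (w x ^ p + (M + L) ^ p) := by
      refine phi_le hp hε.le hε1 ?_ ?_ hw0 hM0 (norm_nonneg _) (hL x hx)
      · simp only [hddef]; nlinarith
      · simp only [hddef]; nlinarith
    simp only [hΨ]
    rw [e1, e2]
    refine h1.trans ?_
    have := mul_le_mul_of_nonneg_left h2 hs.1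
    linarith
  have hwI := hm.pow_int
  have hΦ0 : ∀ x, 0 ≤ Φ x := fun x => by simp only [hΦ]; positivity
  have hΨ0 : ∀ x, 0 ≤ Ψ x := fun x => by simp only [hΨ]; positivity
  have hΨI : Integrable Ψ μ := by
    have hI : Integrable (fun x => Φ x + 2 ^ p * (w x ^ p + (M + L) ^ p)) μ :=
      hm.hint.add ((hwI.add (integrable_const _)).const_mul _)
    refine Integrable.mono' hI ?_ ?_
    · refine ae_meas_of_cont h.hΩ h.hμ ?_
      have h1 := hv.cont
      have h2 := hv.cont_fderiv h.hΩ
      refine ContinuousOn.rpow_const ?_ (fun x _ => Or.inr (by linarith))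
      fun_prop
    · filter_upwards [h.hμ] with x hx
      rw [Real.norm_of_nonneg (hΨ0 x)]
      have hw0 := hm.hw0 x (subset_closure hx)
      have hs := Sd_mem hr hk.le (d x)
      have h3 : 0 ≤ 2 ^ p * (w x ^ p + (M + L) ^ p) := by positivity
      have h4 := hΦ0 x
      refine (key x hx).trans ?_
      nlinarith
  have hmin := ray_adm h.hΩ h.hb h.hμ hp hε.le hm.hray hv hΨI
  have hvI : Integrable (fun x => |v x| ^ p) μ := by
    obtain ⟨N, hN0, hN⟩ := hv.bdd h.hb
    refine integrable_of_bdd h.hΩ h.hμ ?_ (N ^ p) ?_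
    · exact hv.cont.abs.rpow_const (fun x _ => Or.inr (by linarith))
    · intro x hx
      rw [abs_of_nonneg (by positivity)]
      exact Real.rpow_le_rpow (abs_nonneg _) (hN x (subset_closure hx)) (by linarith)
  have hAw : ∫ x, w x ^ p ∂μ - ∫ x, |v x| ^ p ∂μ ≤ ∫ x in A, w x ^ p ∂μ := by
    rw [← integral_sub hwI hvI, ← integral_indicator hAm]
    refine integral_mono_ae (hwI.sub hvI) (hwI.indicator hAm) ?_
    filter_upwards [h.hμ] with x hx
    by_cases hxA : x ∈ A
    · rw [indicator_of_mem hxA]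
      have : 0 ≤ |v x| ^ p := by positivity
      linarith
    · rw [indicator_of_notMem hxA]
      have hw0 := hm.hw0 x (subset_closure hx)
      have : |w x - u x| ≤ k := by
        by_contra hh; exact hxA ⟨hx, not_le.1 hh⟩
      have : v x = w x := by
        simp only [hvdef]; rw [Sf_zero hr hk.le this]; ring
      simp only [this, abs_of_nonneg hw0]
      simp
  have hdiff : ∫ x, (Φ x - Ψ x) ∂μ ≤ (lam + 1) * ∫ x in A, w x ^ p ∂μ := by
    rw [integral_sub hm.hint hΨI]
    have e : ∫ x, Φ x ∂μ = Λ * ∫ x, w x ^ p ∂μ := by rw [hm.hnorm, mul_one]; exact hm.heq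
    have e3 : 0 ≤ ∫ x in A, w x ^ p ∂μ := by
      refine setIntegral_nonneg hAm fun x hx => ?_
      have := hm.hw0 x (subset_closure hx.1)
      positivity
    rw [e]
    have hmin' : Λ * ∫ x, |v x| ^ p ∂μ ≤ ∫ x, Ψ x ∂μ := hmin
    have e4 := mul_le_mul_of_nonneg_left hAw hΛ0
    have e5 := mul_le_mul_of_nonneg_right hΛ e3
    linarith
  have hgI : Integrable (fun x => 2 ^ p * (2 ^ p * (w x ^ p + (M + L) ^ p)) + 2 ^ p * L ^ p) μ :=
    (((hwI.add (integrable_const _)).const_mul _).const_mul _).add (integrable_const _)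
  set g : EuclideanSpace ℝ (Fin n) → ℝ :=
    fun x => 2 ^ p * (2 ^ p * (w x ^ p + (M + L) ^ p)) + 2 ^ p * L ^ p with hg
  have hI2 : Integrable (fun x => 2 ^ p * (Φ x - Ψ x)) μ := (hm.hint.sub hΨI).const_mul _
  have step : ∫ x, ‖fderiv ℝ f x‖ ^ p ∂μ ≤ ∫ x, (2 ^ p * (Φ x - Ψ x) + A.indicator g x) ∂μ := by
    refine integral_mono_of_nonneg (Filter.Eventually.of_forall fun x => by positivity)
      (hI2.add (hgI.indicator hAm)) ?_
    filter_upwards [h.hμ] with x hx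
    have hw0 := hm.hw0 x (subset_closure hx)
    have hD := (hm.hw.diffAt h.hΩ hx)
    have hDu := (h.hu.diffAt h.hΩ hx)
    have a2 : fderiv ℝ d x = fderiv ℝ w x - fderiv ℝ u x := fderiv_fun_sub hD hDu
    have hs := Sd_mem hr hk.le (d x)
    have hk1 := key x hx
    have hf1 : fderiv ℝ f x = Sd k r (d x) • fderiv ℝ d x := hf x hx
    have hn : ‖fderiv ℝ d x‖ ^ p ≤ 2 ^ p * (Φ x + L ^ p) := by
      rw [a2]
      refine (Real.rpow_le_rpow (norm_nonneg _) (norm_sub_le _ _) (by linarith)).trans ?_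
      refine (add_pow_le2 (norm_nonneg _) (norm_nonneg _) (by linarith)).trans ?_
      have b1 := hm.pw hp x
      have b2 := Real.rpow_le_rpow (norm_nonneg _) (hL x hx) (by linarith : 0 ≤ p)
      gcongr
    set s := Sd k r (d x) with hsd
    have hfn : ‖fderiv ℝ f x‖ ^ p ≤ s * (2 ^ p * (Φ x + L ^ p)) := by
      rw [hf1, norm_smul, Real.norm_of_nonneg hs.1, Real.mul_rpow hs.1 (norm_nonneg _)]
      have : s ^ p ≤ s := Real.rpow_le_self_of_le_one hs.1 hs.2 hp.le
      exact mul_le_mul this hn (by positivity) hs.1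
    have h2p : (0:ℝ) ≤ 2 ^ p := by positivity
    have hk2 : s * Φ x ≤ (Φ x - Ψ x) + s * (2 ^ p * (w x ^ p + (M + L) ^ p)) := by linarith
    have hk3 := mul_le_mul_of_nonneg_left hk2 h2p
    refine hfn.trans ?_
    by_cases hxA : x ∈ A
    · rw [indicator_of_mem hxA]
      simp only [hg]
      have c1 : 0 ≤ 2 ^ p * (2 ^ p * (w x ^ p + (M + L) ^ p)) := by positivity
      have c2 : 0 ≤ 2 ^ p * L ^ p := by positivity
      have c3 := mul_le_mul_of_nonneg_right hs.2 c1
      have c4 := mul_le_mul_of_nonneg_right hs.2 c2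
      linarith
    · rw [indicator_of_notMem hxA]
      have : |w x - u x| ≤ k := by
        by_contra hh; exact hxA ⟨hx, not_le.1 hh⟩
      have hs0 : s = 0 := Sd_zero hr hk.le this
      rw [hs0] at hk3 ⊢
      linarith
  refine step.trans ?_
  rw [integral_add hI2 (hgI.indicator hAm), integral_const_mul, integral_indicator hAm]
  have hwA : ∫ x in A, (1 + w x ^ p) ∂μ = μ.real A + ∫ x in A, w x ^ p ∂μ := by
    rw [integral_add (integrable_const _) hwI.integrableOn]; simp
  have hgA : ∫ x in A, g x ∂μ ≤
      (2 ^ p * (2 ^ p * (1 + (M + L) ^ p)) + 2 ^ p * L ^ p) * ∫ x in A, (1 + w x ^ p) ∂μ := by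
    rw [← integral_const_mul]
    refine setIntegral_mono_on hgI.integrableOn ?_ hAm ?_
    · exact (((integrable_const _).add hwI).const_mul _).integrableOn
    · intro x hx
      have hw0 : 0 ≤ w x ^ p := by
        have := hm.hw0 x (subset_closure hx.1); positivity
      have hML : 0 ≤ (M + L) ^ p := by positivity
      have hLp : 0 ≤ L ^ p := by positivity
      have h2p : (0:ℝ) ≤ 2 ^ p := by positivity
      have c1 : w x ^ p + (M + L) ^ p ≤ (1 + (M + L) ^ p) * (1 + w x ^ p) := by nlinarith
      have c2 := mul_le_mul_of_nonneg_left (mul_le_mul_of_nonneg_left c1 h2p) h2p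
      have c3 : 0 ≤ 2 ^ p * L ^ p * w x ^ p := by positivity
      simp only [hg]
      linarith
  have hA0 : 0 ≤ μ.real A := measureReal_nonneg
  have hq : (lam + 1) * ∫ x in A, w x ^ p ∂μ ≤ (lam + 1) * ∫ x in A, (1 + w x ^ p) ∂μ := by
    rw [hwA]
    refine mul_le_mul_of_nonneg_left (by linarith) (by linarith)
  have h2p : (0:ℝ) ≤ 2 ^ p := by positivity
  have hq2 := mul_le_mul_of_nonneg_left (hdiff.trans hq) h2p
  rw [hCdef]
  linarith
end

section
variable {n : ℕ} {Ω : Set (EuclideanSpace ℝ (Fin n))} {μ : Measure (EuclideanSpace ℝ (Fin n))}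
  [IsFiniteMeasure μ] {p lam : ℝ} {u : EuclideanSpace ℝ (Fin n) → ℝ}

lemma small_m2 {n : ℕ} (hn : 2 ≤ n) {C c : ℝ} (hC : 0 ≤ C) (hc : 0 < c) :
    ∃ m : ℝ, 0 < m ∧ ∀ t, 0 ≤ t → t ≤ m → C * t ^ (1 / (n : ℝ)) ≤ c := by
  obtain ⟨m, h0, -, h1⟩ := small_m (A := 0) (C := C) hn hc one_pos
  refine ⟨m, h0, fun t ht htm => ?_⟩
  have h2 : C * t ^ (1 / (n : ℝ)) ≤ C * m ^ (1 / (n : ℝ)) := by gcongr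
  nlinarith [mul_nonneg hC h0.le]

lemma HS.decay (h : HS p Ω μ u lam) : ∃ C m : ℝ, 0 ≤ C ∧ 0 < m ∧
    ∀ ε Λ w, HM p Ω μ ε Λ w → ε ≤ 1 → Λ ≤ lam + 1 → ∀ k l, 0 < k → k < l → l ≤ 2 →
    μ.real {x | x ∈ Ω ∧ k < |w x - u x|} ≤ m →
    (l - k) * μ.real {x | x ∈ Ω ∧ l < |w x - u x|} ≤
      C * (μ.real {x | x ∈ Ω ∧ k < |w x - u x|} *
        μ.real {x | x ∈ Ω ∧ k < |w x - u x|} ^ (1 / (n : ℝ))) := by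
  have hp := h.hp
  obtain ⟨M, hM0, hM⟩ := h.hu.bdd h.hb
  obtain ⟨a, b, hμv, hvμ⟩ := h.hab
  obtain ⟨C1, hC10, hC1⟩ := gns (μ := μ) h.hn h.hΩ hμv hvμ
  obtain ⟨C2, hC20, hC2⟩ := gns_p (μ := μ) h.hn h.hΩ hμv hvμ hp
  obtain ⟨C3, hC30, hC3⟩ := h.level_energy
  set C4 : ℝ := C3 * (1 + 2 ^ p * (1 + (M + 2) ^ p)) with hC4
  have hC40 : 0 ≤ C4 := by positivity
  obtain ⟨m, hm0, hmC⟩ := small_m2 (n := n) h.hn (C := C2 * (1 + 2 * C4)) (by positivity)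
    (by norm_num : (0:ℝ) < 1 / 2)
  refine ⟨2 * C1 * (1 + 2 * C4), m, by positivity, hm0, ?_⟩
  intro ε Λ w hm hε1 hΛ k l hk hkl hl2 hmA
  set A : Set (EuclideanSpace ℝ (Fin n)) := {x | x ∈ Ω ∧ k < |w x - u x|} with hA
  have hd : Adm Ω (fun x => w x - u x) := hm.hw.sub h.hu
  have hop : ∀ t : ℝ, IsOpen {x | x ∈ Ω ∧ t < |w x - u x|} := fun t =>
    hd.cont.abs.isOpen_inter_preimage h.hΩ (isOpen_Ioi (a := t))
  have hAm := (hop k).measurableSet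
  have hr : 0 < (l - k) / 2 := by linarith
  obtain ⟨f, hf, hfc, hfs, hfe⟩ := trunc_props h.hΩ h.hb hd hk hr
  obtain ⟨N, hN0, hN⟩ := c1c_bound hf hfc
  have hfI : Integrable (fun x => |f x| ^ p) μ := by
    refine integrable_of_bdd h.hΩ h.hμ ?_ (N ^ p) ?_
    · exact (hf.continuous.abs.rpow_const (fun x => Or.inr (by linarith))).continuousOn
    · intro x _
      rw [abs_of_nonneg (by positivity)]
      exact Real.rpow_le_rpow (abs_nonneg _) (hN x).1 (by linarith)
  have hfI1 : Integrable (fun x => |f x|) μ := by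
    refine integrable_of_bdd h.hΩ h.hμ hf.continuous.abs.continuousOn N ?_
    intro x _
    rw [abs_abs]; exact (hN x).1
  have hgI : Integrable (fun x => ‖fderiv ℝ f x‖ ^ p) μ := by
    refine integrable_of_bdd h.hΩ h.hμ ?_ (N ^ p) ?_
    · exact ((hf.continuous_fderiv one_ne_zero).norm.rpow_const (fun x => Or.inr (by linarith))).continuousOn
    · intro x _
      rw [abs_of_nonneg (by positivity)]
      exact Real.rpow_le_rpow (norm_nonneg _) (hN x).2 (by linarith)
  have hoff : ∀ x ∈ Ω, x ∉ A → f x = 0 ∧ fderiv ℝ f x = 0 := by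
    intro x hx hxA
    have : |w x - u x| ≤ k := by
      by_contra hh; exact hxA ⟨hx, not_le.1 hh⟩
    rw [(hfe x hx).1, (hfe x hx).2, Sf_zero hr hk.le this, Sd_zero hr hk.le this]
    simp
  set F := ∫ x, |f x| ^ p ∂μ with hF
  set G := ∫ x, ‖fderiv ℝ f x‖ ^ p ∂μ with hG
  have hF0 : 0 ≤ F := integral_nonneg fun x => by positivity
  have hG0 : 0 ≤ G := integral_nonneg fun x => by positivity
  have hFA : ∫ x in A, |f x| ^ p ∂μ = F := by
    rw [← integral_indicator hAm]
    refine integral_congr_ae ?_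
    filter_upwards [h.hμ] with x hx
    by_cases hxA : x ∈ A
    · rw [indicator_of_mem hxA]
    · rw [indicator_of_notMem hxA, (hoff x hx hxA).1, abs_zero, Real.zero_rpow (by linarith)]
  set t := μ.real A with ht
  have ht0 : 0 ≤ t := measureReal_nonneg
  set t' := t ^ (1 / (n : ℝ)) with ht'
  have ht'0 : 0 ≤ t' := by positivity
  have hsm := hmC t ht0 hmA
  have e1 : F ≤ C2 * t' * (F + G) := by
    have := hC2 f hf hfc hfs A
    rwa [hFA] at this
  have e2 : G ≤ C4 * (t + F) := by
    have g1 := hC3 ε Λ w hm hε1 hΛ k _ hk hr f (fun x hx => (hfe x hx).2)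
    have g2 : ∫ x in A, (1 + w x ^ p) ∂μ ≤
        ∫ x in A, (1 + 2 ^ p * (1 + (M + 2) ^ p)) * (1 + |f x| ^ p) ∂μ := by
      refine setIntegral_mono_on ((integrable_const _).add hm.pow_int).integrableOn
        (((integrable_const _).add hfI).const_mul _).integrableOn hAm ?_
      intro x hx
      have hw0 := hm.hw0 x (subset_closure hx.1)
      have := Sf_ge hr hk.le (w x - u x)
      rw [← (hfe x hx.1).1] at this
      have huM := (le_abs_self _).trans (hM x (subset_closure hx.1))
      have hwd := le_abs_self (w x - u x)
      have c1 : w x ≤ |f x| + (M + 2) := by linarith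
      have c2 := (Real.rpow_le_rpow hw0 c1 (by linarith : 0 ≤ p)).trans
        (add_pow_le2 (abs_nonneg _) (by positivity) (by linarith))
      have c3 : 0 ≤ |f x| ^ p := by positivity
      have c4 : 0 ≤ (M + 2) ^ p := by positivity
      have c5 : |f x| ^ p + (M + 2) ^ p ≤ (1 + (M + 2) ^ p) * (1 + |f x| ^ p) := by nlinarith
      have c6 := mul_le_mul_of_nonneg_left c5 (by positivity : (0:ℝ) ≤ 2 ^ p)
      linarith
    have g3 : ∫ x in A, (1 + 2 ^ p * (1 + (M + 2) ^ p)) * (1 + |f x| ^ p) ∂μ =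
        (1 + 2 ^ p * (1 + (M + 2) ^ p)) * (t + F) := by
      rw [integral_const_mul, integral_add (integrable_const _) hfI.integrableOn, hFA]
      simp [ht]
    rw [g3] at g2
    refine g1.trans ((mul_le_mul_of_nonneg_left g2 hC30).trans ?_)
    rw [hC4, mul_assoc]
  have e3 : G ≤ 2 * C4 * t := by
    have q0 : C2 * t' + 2 * (C4 * (C2 * t')) ≤ 1 / 2 := by linarith
    have q1 : 0 ≤ C2 * t' := by positivity
    have q2 : 0 ≤ C4 * (C2 * t') := by positivity
    have q3 : F ≤ 2 * (C2 * t') * G := by nlinarith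
    have q4 := mul_le_mul_of_nonneg_left q3 hC40
    nlinarith
  have e4 : ∫ x, ‖fderiv ℝ f x‖ ∂μ ≤ t + G := by
    have i1 : Integrable (A.indicator (fun _ => (1:ℝ))) μ := (integrable_const _).indicator hAm
    have : t + G = ∫ x, (A.indicator (fun _ => (1:ℝ)) x + ‖fderiv ℝ f x‖ ^ p) ∂μ := by
      rw [integral_add i1 hgI, integral_indicator hAm]
      simp [ht, hG]
      rfl
    rw [this]
    refine integral_mono_of_nonneg (Filter.Eventually.of_forall fun x => norm_nonneg _)
      (i1.add hgI) ?_
    filter_upwards [h.hμ] with x hx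
    by_cases hxA : x ∈ A
    · rw [indicator_of_mem hxA]
      rcases le_total ‖fderiv ℝ f x‖ 1 with h1 | h1
      · have : 0 ≤ ‖fderiv ℝ f x‖ ^ p := by positivity
        linarith
      · have := Real.self_le_rpow_of_one_le h1 hp.le
        linarith
    · rw [indicator_of_notMem hxA, (hoff x hx hxA).2]
      simp only [norm_zero]
      rw [Real.zero_rpow (by linarith)]
      simp
  have e5 := hC1 f hf hfc hfs A
  set B : Set (EuclideanSpace ℝ (Fin n)) := {x | x ∈ Ω ∧ l < |w x - u x|} with hB
  have hBm := (hop l).measurableSet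
  have e6 : (l - k) / 2 * μ.real B ≤ ∫ x in A, |f x| ∂μ := by
    calc (l - k) / 2 * μ.real B = ∫ x in B, (l - k) / 2 ∂μ := by simp [mul_comm]
      _ ≤ ∫ x in B, |f x| ∂μ := by
          refine setIntegral_mono_on (integrable_const _).integrableOn hfI1.integrableOn hBm ?_
          intro x hx
          have := Sf_ge hr hk.le (w x - u x)
          rw [← (hfe x hx.1).1] at this
          have := hx.2
          linarith
      _ ≤ _ := by
          refine setIntegral_mono_set hfI1.integrableOn
            (Filter.Eventually.of_forall fun x => abs_nonneg _) ?_
          exact Filter.Eventually.of_forall fun x hx => ⟨hx.1, hkl.trans hx.2⟩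
  have e7 : ∫ x, ‖fderiv ℝ f x‖ ∂μ ≤ (1 + 2 * C4) * t := by linarith
  have e8 := mul_le_mul_of_nonneg_left e7 (by positivity : 0 ≤ C1 * t')
  linarith

lemma stampacchia {φ : ℝ → ℝ} {C D k0 m : ℝ} {n : ℕ} (hn : 2 ≤ n) (hφ0 : ∀ k, 0 ≤ φ k)
    (hanti : ∀ k l, k ≤ l → φ l ≤ φ k) (hC : 0 ≤ C) (hD : 0 < D)
    (hdec : ∀ k l, k0 ≤ k → k < l → l ≤ k0 + D → (l - k) * φ l ≤ C * (φ k * φ k ^ (1 / (n : ℝ))))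
    (hm : 0 ≤ m) (hmC : 2 * C * m ^ (1 / (n : ℝ)) ≤ D * (1 / 2) ^ n) (h0 : φ k0 ≤ m) :
    φ (k0 + D) = 0 := by
  have hn0 : (0:ℝ) < n := by exact_mod_cast (by omega : 0 < n)
  have key : ∀ j : ℕ, φ (k0 + D * (1 - (1 / 2) ^ j)) ≤ m * ((1 / 2) ^ n) ^ j := by
    intro j
    induction j with
    | zero => simpa using h0
    | succ j ih =>
      set P : ℝ := (1 / 2) ^ j with hP
      have hP0 : 0 < P := by positivity
      have hP1 : P ≤ 1 := pow_le_one₀ (by norm_num) (by norm_num)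
      have hs : ((1:ℝ) / 2) ^ (j + 1) = P / 2 := by rw [pow_succ]; ring
      have h1 := hdec (k0 + D * (1 - P)) (k0 + D * (1 - P / 2)) (by nlinarith) (by nlinarith)
        (by nlinarith)
      rw [hs]
      set y := φ (k0 + D * (1 - P / 2))
      set z := φ (k0 + D * (1 - P))
      have hz0 : 0 ≤ z := hφ0 _
      set ρ : ℝ := ((1 / 2) ^ n) ^ j with hρ
      have hρ0 : 0 < ρ := by positivity
      have hzr : z ^ (1 / (n : ℝ)) ≤ m ^ (1 / (n : ℝ)) * P := by
        refine (Real.rpow_le_rpow hz0 ih (by positivity)).trans ?_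
        rw [Real.mul_rpow hm hρ0.le]
        have : ρ = P ^ n := by rw [hρ, hP, ← pow_mul, ← pow_mul, mul_comm]
        rw [this, one_div, Real.pow_rpow_inv_natCast hP0.le (by omega)]
      have h2 : z * z ^ (1 / (n : ℝ)) ≤ (m * ρ) * (m ^ (1 / (n : ℝ)) * P) :=
        mul_le_mul ih hzr (by positivity) (by positivity)
      have h3 : D * P / 2 * y ≤ C * ((m * ρ) * (m ^ (1 / (n : ℝ)) * P)) := by
        have := mul_le_mul_of_nonneg_left h2 hC
        nlinarith
      have h4 := mul_le_mul_of_nonneg_right hmC (by positivity : 0 ≤ m * ρ * P)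
      have h5 : (D * P) * y ≤ (D * P) * (m * (((1 / 2) ^ n) ^ j * (1 / 2) ^ n)) := by
        rw [← hρ]; linarith
      rw [pow_succ ((1 / 2 : ℝ) ^ n)]
      exact le_of_mul_le_mul_left h5 (by positivity)
  refine le_antisymm ?_ (hφ0 _)
  have hlim : Filter.Tendsto (fun j : ℕ => m * (((1:ℝ) / 2) ^ n) ^ j) Filter.atTop (𝓝 (m * 0)) := by
    refine Filter.Tendsto.const_mul _ (tendsto_pow_atTop_nhds_zero_of_lt_one (by positivity) ?_)
    exact pow_lt_one₀ (by norm_num) (by norm_num) (by omega)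
  rw [mul_zero] at hlim
  refine ge_of_tendsto' hlim fun j => (hanti _ _ ?_).trans (key j)
  have : 0 < ((1:ℝ) / 2) ^ j := by positivity
  nlinarith

lemma HS.unif (h : HS p Ω μ u lam) {η : ℝ} (hη : 0 < η) : ∃ ε₀ : ℝ, 0 < ε₀ ∧
    ∀ ε, 0 < ε → ε < ε₀ → ∀ Λ w, HM p Ω μ ε Λ w → ∀ x ∈ closure Ω, |w x - u x| < η := by
  obtain ⟨C, m0, hC0, hm00, hdec⟩ := h.decay
  obtain ⟨a, b, hμv, hvμ⟩ := h.hab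
  set k0 := min 1 (η / 4) with hk0
  have hk00 : 0 < k0 := lt_min one_pos (by positivity)
  obtain ⟨m1, hm10, hm1⟩ := small_m2 (n := n) h.hn (C := 2 * C) (by positivity)
    (by positivity : 0 < k0 * (1 / 2) ^ n)
  obtain ⟨ε1, hε1, H1⟩ := h.Lam_le one_pos
  obtain ⟨ε2, hε2, H2⟩ := h.conv_meas hk00 (lt_min hm00 hm10)
  refine ⟨min 1 (min ε1 ε2), lt_min one_pos (lt_min hε1 hε2), fun ε he0 he Λ w hw => ?_⟩
  have hΛ := H1 ε he0 (he.trans_le ((min_le_right _ _).trans (min_le_left _ _))) Λ w hw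
  have hme := H2 ε he0 (he.trans_le ((min_le_right _ _).trans (min_le_right _ _))) Λ w hw
  have he1 : ε ≤ 1 := (he.trans_le (min_le_left _ _)).le
  set φ : ℝ → ℝ := fun k => μ.real {x | x ∈ Ω ∧ k < |w x - u x|} with hφ
  have hanti : ∀ k l, k ≤ l → φ l ≤ φ k := fun k l hkl =>
    measureReal_mono fun x hx => ⟨hx.1, hkl.trans_lt hx.2⟩
  have hz : φ (k0 + k0) = 0 := by
    refine stampacchia (m := m1) h.hn (fun k => measureReal_nonneg) hanti hC0 hk00 ?_ hm10.le
      (hm1 m1 hm10.le le_rfl) (hme.trans (min_le_right _ _))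
    intro k l hk hkl hl
    refine hdec ε Λ w hw he1 hΛ k l (hk00.trans_le hk) hkl ?_ ?_
    · have := min_le_left 1 (η / 4)
      linarith
    · exact (hanti _ _ hk).trans (hme.trans (min_le_left _ _))
  have hd : Adm Ω (fun x => w x - u x) := hw.hw.sub h.hu
  have hop : IsOpen {x | x ∈ Ω ∧ k0 + k0 < |w x - u x|} :=
    hd.cont.abs.isOpen_inter_preimage h.hΩ (isOpen_Ioi (a := k0 + k0))
  have hem := open_null hvμ hop (fun x hx => hx.1) (by
    have := (measureReal_eq_zero_iff (measure_ne_top μ _)).1 hz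
    exact this)
  have hk4 : k0 ≤ η / 4 := min_le_right _ _
  intro x hx
  by_cases hxΩ : x ∈ Ω
  · by_contra hh
    have : x ∈ {x | x ∈ Ω ∧ k0 + k0 < |w x - u x|} := ⟨hxΩ, by linarith⟩
    rw [hem] at this
    exact this
  · have hxf : x ∈ frontier Ω := by
      rw [h.hΩ.frontier_eq]; exact ⟨hx, hxΩ⟩
    have := hd.2.2 x hxf
    simp only at this
    rw [this, abs_zero]; exact hη
end

/-- **Uniform convergence of the regularized minimizers** (Corollary 4.5 of the paper):
as `ε → 0⁺` the normalized minimizers of the `ε`-regularized problems converge uniformly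
on `cl Ω` to the unique normalized positive first eigenfunction `u`. -/
theorem regularized_minimizers_converge_uniformly
    (n : ℕ) (hn : 2 ≤ n) (p : ℝ) (hp : 1 < p)
    (Ω : Set (EuclideanSpace ℝ (Fin n)))
    (hΩo : IsOpen Ω) (hΩb : IsBounded Ω) (hΩconv : Convex ℝ Ω) (hΩ2 : HasC2Boundary n Ω)
    (hsc : ∃ R : ℝ, 0 < R ∧ ∀ x ∈ frontier Ω, ∃ y : EuclideanSpace ℝ (Fin n),
      dist x y = R ∧ closure Ω ⊆ Metric.closedBall y R)
    (u : EuclideanSpace ℝ (Fin n) → ℝ)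
    (hu1 : ContDiffOn ℝ 1 u (closure Ω))
    (hupos : ∀ x ∈ Ω, 0 < u x)
    (hub : ∀ x ∈ frontier Ω, u x = 0)
    (hnorm : (∫ x in Ω, u x ^ p ∂(gaussianMeasure n)) = 1)
    (heig : ∀ φ : EuclideanSpace ℝ (Fin n) → ℝ, IsTestFun n Ω φ →
      ∫ x in Ω, ‖gradient u x‖ ^ (p - 2) * ⟪gradient u x, gradient φ x⟫ ∂(gaussianMeasure n)
        = lambdaPGamma n p Ω * ∫ x in Ω, u x ^ (p - 1) * φ x ∂(gaussianMeasure n)) :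
    ∀ η : ℝ, 0 < η → ∃ ε₀ : ℝ, 0 < ε₀ ∧
      ∀ ε : ℝ, 0 < ε → ε < ε₀ →
        ∀ uε : EuclideanSpace ℝ (Fin n) → ℝ, IsNormalizedMinimizer n p ε Ω uε →
          ∀ x ∈ closure Ω, |uε x - u x| < η := by
  intro η hη
  haveI := (gm_props hΩo hΩb).1
  have hS := HS_of hn hp hΩo hΩb hΩconv hu1 hupos hub hnorm heig
  obtain ⟨ε₀, h0, H⟩ := hS.unif hη
  exact ⟨ε₀, h0, fun ε h1 h2 w hw => H ε h1 h2 _ w (HM_of hp h1 hΩo hΩb hS.hne hw)⟩
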